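/- There is no sentence ρ in the first-order language of rings such that for every finite field F, F satisfies ρ if and only if |F| ≡ 2 (mod 5). (In fact the same holds already for the class of finite prime fields: there is no ring-language sentence ρ such that for every prime p, the field 𝔽_p = ℤ/pℤ satisfies ρ if and only if p ≡ 2 (mod 5).) -/

import Mathlib

section
set_option linter.style.haveILetI false
open Polynomial

namespace AxP

/-- A nontrivial finitely generated algebra over an algebraically closed field has a point. -/
theorem exists_point (W A : Type*) [Field W] [IsAlgClosed W] [CommRing A] [Nontrivial A]
    [Algebra W A] [Algebra.FiniteType W A] : Nonempty (A →ₐ[W] W) := by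
  obtain ⟨m, hm⟩ := Ideal.exists_maximal A
  letI : Field (A ⧸ m) := Ideal.Quotient.field m
  haveI : Algebra.FiniteType W (A ⧸ m) :=
    Algebra.FiniteType.of_surjective (Ideal.Quotient.mkₐ W m) (Ideal.Quotient.mkₐ_surjective W m)
  haveI : Module.Finite W (A ⧸ m) := finite_of_finite_type_of_isJacobsonRing _ _
  have hb : Function.Bijective (algebraMap W (A ⧸ m)) :=
    IsAlgClosed.algebraMap_bijective_of_isIntegral
  let e : W ≃ₐ[W] (A ⧸ m) := AlgEquiv.ofBijective (Algebra.ofId W _) hb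
  exact ⟨(e.symm : (A ⧸ m) →ₐ[W] W).comp (Ideal.Quotient.mkₐ W m)⟩

theorem lift_mem {F : Type*} [Field F] (S : Subring F) (u : F[X][X])
    (h : ∀ i j, (u.coeff i).coeff j ∈ S) :
    u ∈ Polynomial.lifts (mapRingHom S.subtype) := by
  rw [Polynomial.lifts_iff_coeff_lifts]
  intro i
  have : u.coeff i ∈ Polynomial.lifts S.subtype := by
    rw [Polynomial.lifts_iff_coeff_lifts]
    intro j
    exact ⟨⟨_, h i j⟩, rfl⟩
  obtain ⟨q, hq⟩ := (Polynomial.mem_lifts _).1 this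
  exact ⟨q, hq⟩

theorem irreducible_map {W F : Type*} [Field W] [IsAlgClosed W] [Field F] (σ : W →+* F)
    (g : W[X][X]) (hm : g.Monic) (hg : Irreducible g) :
    Irreducible (g.map (mapRingHom σ)) := by
  letI := σ.toAlgebra
  have hmF : (g.map (mapRingHom σ)).Monic := hm.map _
  rw [hmF.irreducible_iff_natDegree']
  have hg' := (hm.irreducible_iff_natDegree').1 hg
  have hdeg : (g.map (mapRingHom σ)).natDegree = g.natDegree := hm.natDegree_map _
  refine ⟨fun h1 => hg'.1 ?_, ?_⟩
  · rw [h1] at hdeg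
    exact hm.natDegree_eq_zero.1 (by simpa using hdeg.symm)
  intro u v hu hv huv hmem
  classical
  let T : Finset F := (u.support.biUnion fun i => (u.coeff i).support.image (u.coeff i).coeff) ∪
    (v.support.biUnion fun i => (v.coeff i).support.image (v.coeff i).coeff)
  let A := Algebra.adjoin W (T : Set F)
  have memu : ∀ i j, (u.coeff i).coeff j ∈ A.toSubring := by
    intro i j
    by_cases h : (u.coeff i).coeff j = 0
    · rw [h]; exact A.toSubring.zero_mem
    · refine Algebra.subset_adjoin ?_
      refine Finset.mem_coe.2 (Finset.mem_union_left _ (Finset.mem_biUnion.2 ⟨i, ?_, ?_⟩))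
      · rw [mem_support_iff]; intro h0; rw [h0] at h; simp at h
      · exact Finset.mem_image.2 ⟨j, mem_support_iff.2 h, rfl⟩
  have memv : ∀ i j, (v.coeff i).coeff j ∈ A.toSubring := by
    intro i j
    by_cases h : (v.coeff i).coeff j = 0
    · rw [h]; exact A.toSubring.zero_mem
    · refine Algebra.subset_adjoin ?_
      refine Finset.mem_coe.2 (Finset.mem_union_right _ (Finset.mem_biUnion.2 ⟨i, ?_, ?_⟩))
      · rw [mem_support_iff]; intro h0; rw [h0] at h; simp at h
      · exact Finset.mem_image.2 ⟨j, mem_support_iff.2 h, rfl⟩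
  obtain ⟨u', hu', hud, hum⟩ := lifts_and_natDegree_eq_and_monic (lift_mem A.toSubring u memu) hu
  obtain ⟨v', hv', hvd, hvm⟩ := lifts_and_natDegree_eq_and_monic (lift_mem A.toSubring v memv) hv
  haveI : Algebra.FiniteType W A :=
    (Subalgebra.fg_iff_finiteType _).1 (Subalgebra.fg_adjoin_finset T)
  obtain ⟨ψ⟩ := exists_point W A
  have hinj : Function.Injective (mapRingHom A.toSubring.subtype) :=
    Polynomial.map_injective _ Subtype.val_injective
  have key : u' * v' = g.map (mapRingHom (algebraMap W A)) := by
    apply Polynomial.map_injective _ hinj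
    rw [Polynomial.map_mul, hu', hv', huv, Polynomial.map_map, mapRingHom_comp]
    rfl
  have key2 : (u'.map (mapRingHom (ψ : A →+* W))) * (v'.map (mapRingHom (ψ : A →+* W))) = g := by
    rw [← Polynomial.map_mul, key, Polynomial.map_map, mapRingHom_comp]
    have : (ψ : A →+* W).comp (algebraMap W A) = RingHom.id W := by
      ext x; simp
    rw [this]; simp
  refine hg'.2 _ _ (hum.map _) (hvm.map _) key2 ?_
  rw [hvm.natDegree_map, hvd, ← hdeg]
  exact hmem

end AxP

end

section
set_option linter.style.haveILetI false
open Polynomial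

namespace AxP

/-- all coefficients have degree at most `e` -/
def Bdd {k : Type*} [Semiring k] (e : ℕ) (h : k[X][X]) : Prop := ∀ i, (h.coeff i).natDegree ≤ e

section basics
variable {k : Type*} [CommRing k]

theorem Bdd.mono {e e' : ℕ} {h : k[X][X]} (H : Bdd e h) (hh : e ≤ e') : Bdd e' h :=
  fun i => (H i).trans hh

theorem Bdd.add {e : ℕ} {h h' : k[X][X]} (H : Bdd e h) (H' : Bdd e h') : Bdd e (h + h') :=
  fun i => by rw [coeff_add]; exact natDegree_add_le_of_degree_le (H i) (H' i)

theorem Bdd.sub {e : ℕ} {h h' : k[X][X]} (H : Bdd e h) (H' : Bdd e h') : Bdd e (h - h') :=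
  fun i => by
    rw [coeff_sub]; exact (natDegree_sub_le_of_le (H i) (H' i)).trans (by simp)

theorem Bdd.zero {e : ℕ} : Bdd e (0 : k[X][X]) := fun i => by simp

theorem Bdd.sum {ι : Type*} (s : Finset ι) {e : ℕ} {h : ι → k[X][X]} (H : ∀ i ∈ s, Bdd e (h i)) :
    Bdd e (∑ i ∈ s, h i) := fun i => by
  rw [finsetSum_coeff]; exact natDegree_sum_le_of_forall_le _ _ fun j hj => H j hj i

theorem Bdd.mul {e e' : ℕ} {h h' : k[X][X]} (H : Bdd e h) (H' : Bdd e' h') :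
    Bdd (e + e') (h * h') := fun i => by
  rw [coeff_mul]
  refine natDegree_sum_le_of_forall_le _ _ fun j _ => ?_
  exact natDegree_mul_le.trans (add_le_add (H _) (H' _))

theorem Bdd.pow {e : ℕ} {h : k[X][X]} (H : Bdd e h) (r : ℕ) : Bdd (r * e) (h ^ r) := by
  induction r with
  | zero =>
    intro i
    rw [pow_zero, coeff_one]; split_ifs <;> simp
  | succ r ih => rw [pow_succ, Nat.succ_mul]; exact ih.mul H

theorem Bdd.C {e : ℕ} {d : k[X]} (H : d.natDegree ≤ e) : Bdd e (Polynomial.C d) := fun i => by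
  rw [coeff_C]; split_ifs <;> simp [H]

theorem Bdd.Y {e : ℕ} : Bdd e (X : k[X][X]) := fun i => by
  rw [coeff_X]; split_ifs <;> simp

theorem Bdd.smul {e : ℕ} {h : k[X][X]} (H : Bdd e h) (c : k) : Bdd e (c • h) := fun i => by
  rw [coeff_smul]; exact (natDegree_smul_le _ _).trans (H i)

theorem Bdd.monic_mod [Nontrivial k] {c : ℕ} {g : k[X][X]} (hg : g.Monic) (hc : Bdd c g) (t : ℕ) :
    ∀ (e : ℕ) (h : k[X][X]), Bdd e h → h.natDegree < g.natDegree + t →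
      Bdd (e + t * c) (h %ₘ g) := by
  induction t with
  | zero =>
    intro e h H hd
    rw [(modByMonic_eq_self_iff hg).2]
    · simpa using H
    · exact degree_lt_degree (by simpa using hd)
  | succ t ih =>
    intro e h H hd
    set a := h.coeff (g.natDegree + t) with ha
    set h' := h - g * (Polynomial.C a * X ^ t) with hh'
    have hmod : h %ₘ g = h' %ₘ g := by
      rw [hh', sub_modByMonic, (modByMonic_eq_zero_iff_dvd hg).2 (dvd_mul_right _ _), sub_zero]
    have hB : Bdd (e + c) h' := by
      refine (H.mono (by omega)).sub ?_
      have h1 : Bdd (e + 0) (Polynomial.C a * X ^ t) := (Bdd.C (H _)).mul (by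
        have := (Bdd.Y (k := k) (e := 0)).pow t; simpa using this)
      have := hc.mul h1
      exact this.mono (by omega)
    have hXt : (Polynomial.C a * X ^ t : k[X][X]).natDegree ≤ t := natDegree_C_mul_X_pow_le _ _
    have hle : h'.natDegree ≤ g.natDegree + t := by
      refine (natDegree_sub_le_of_le (by omega : h.natDegree ≤ g.natDegree + t)
        (natDegree_mul_le.trans (add_le_add le_rfl hXt))).trans (by simp)
    have hco : h'.coeff (g.natDegree + t) = 0 := by
      rw [hh', coeff_sub, ← ha, ← mul_assoc, coeff_mul_X_pow, coeff_mul_C, hg.coeff_natDegree]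
      simp
    rw [hmod]
    by_cases h0 : h' = 0
    · rw [h0, zero_modByMonic]; exact Bdd.zero
    have hlt : h'.natDegree < g.natDegree + t := by
      refine lt_of_le_of_ne hle fun h1 => h0 ?_
      rw [← h1] at hco
      exact leadingCoeff_eq_zero.1 hco
    refine (ih (e + c) h' hB hlt).mono ?_
    rw [Nat.succ_mul]; omega

end basics

section dim
variable {k : Type*} [Field k]

/-- coefficients as a vector -/
noncomputable def cof (n e : ℕ) : k[X][X] →ₗ[k] (Fin n × Fin e → k) where
  toFun h := fun x => (h.coeff x.1).coeff x.2
  map_add' h h' := by ext; simp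
  map_smul' c h := by ext; simp

/-- polynomial from coefficients -/
noncomputable def pol (n e : ℕ) : (Fin n × Fin e → k) →ₗ[k] k[X][X] where
  toFun v := ∑ x, monomial (x.1 : ℕ) (monomial (x.2 : ℕ) (v x))
  map_add' v v' := by simp [Finset.sum_add_distrib]
  map_smul' c v := by
    simp only [Pi.smul_apply, RingHom.id_apply, Finset.smul_sum, smul_monomial]

theorem cof_eq_zero {n e : ℕ} {h : k[X][X]} (hn : h.natDegree < n)
    (he : ∀ i, (h.coeff i).natDegree < e) (h0 : cof n e h = 0) : h = 0 := by
  ext j i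
  by_cases hj : j < n
  · by_cases hi : i < e
    · exact congrFun h0 (⟨j, hj⟩, ⟨i, hi⟩)
    · rw [coeff_eq_zero_of_natDegree_lt]
      · simp
      · exact (he j).trans_le (by omega)
  · rw [coeff_eq_zero_of_natDegree_lt (by omega : h.natDegree < j)]; simp

theorem cof_pol {n e : ℕ} (v : Fin n × Fin e → k) : cof n e (pol n e v) = v := by
  ext ⟨j, i⟩
  simp only [cof, pol, LinearMap.coe_mk, AddHom.coe_mk, finsetSum_coeff]
  rw [Finset.sum_eq_single (j, i)]
  · simp
  · rintro ⟨j', i'⟩ - hne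
    rw [coeff_monomial]
    split_ifs with h1
    · rw [coeff_monomial]
      split_ifs with h2
      · exact absurd (Prod.ext (Fin.ext h1) (Fin.ext h2)) hne
      · rfl
    · simp
  · simp

theorem bdd_pol {n e : ℕ} (v : Fin n × Fin (e + 1) → k) : Bdd e (pol n (e + 1) v) := by
  refine Bdd.sum _ fun x _ i => ?_
  rw [coeff_monomial]
  split_ifs
  · exact (natDegree_monomial_le _).trans (by omega)
  · simp

theorem natDegree_pol {n e : ℕ} (hn : 0 < n) (v : Fin n × Fin e → k) :
    (pol n e v).natDegree < n := by
  refine Nat.lt_of_le_sub_one hn (natDegree_sum_le_of_forall_le _ _ fun x _ => ?_)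
  exact (natDegree_monomial_le _).trans (by omega)

theorem mod_lt {g : k[X][X]} (hg : g.Monic) (hn : 0 < g.natDegree) (h : k[X][X]) :
    (h %ₘ g).natDegree < g.natDegree :=
  natDegree_modByMonic_lt _ hg (by rintro rfl; simp at hn)

theorem dim_count {n c N E : ℕ} {g G : k[X][X]} (hg : g.Monic) (hgn : g.natDegree = n) (hn : 0 < n)
    (hgc : Bdd c g) (hp : Prime g) (hG : ¬ g ∣ G) (hGN : G.natDegree ≤ N) (hGE : Bdd E G)
    {V : Type*} [AddCommGroup V] [Module k V] (Λ : k[X][X] →ₗ[k] V)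
    (h1 : ∀ h, Λ (g * h) = 0) (h2 : ∀ h, Λ (G * h) = 0) (t : ℕ) (f : Fin t → k[X][X])
    (hf : LinearIndependent k fun i => Λ (f i)) : t ≤ n * (E + N * c) := by
  have hΛmod : ∀ h, Λ (h %ₘ g) = Λ h := by
    intro h
    conv_rhs => rw [← modByMonic_add_div h g, map_add, h1, add_zero]
  obtain ⟨e1, he1⟩ : ∃ e1, ∀ i, Bdd e1 (f i %ₘ g) := by
    refine ⟨∑ i, ∑ j ∈ Finset.range n, ((f i %ₘ g).coeff j).natDegree, fun i j => ?_⟩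
    by_cases hj : j < n
    · refine le_trans ?_ (Finset.single_le_sum (f := fun i => ∑ j ∈ Finset.range n,
        ((f i %ₘ g).coeff j).natDegree) (fun _ _ => Nat.zero_le _) (Finset.mem_univ i))
      exact Finset.single_le_sum (f := fun j => ((f i %ₘ g).coeff j).natDegree)
        (fun _ _ => Nat.zero_le _) (Finset.mem_range.2 hj)
    · rw [coeff_eq_zero_of_natDegree_lt]
      · simp
      · have := mod_lt hg (hgn ▸ hn) (f i)
        omega
  let δ := E + N * c
  let P : ((Fin t → k) × (Fin n × Fin (e1 + 1) → k)) →ₗ[k] k[X][X] :=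
    LinearMap.coprod (Fintype.linearCombination k (fun i => f i %ₘ g))
      ((((modByMonicHom g).restrictScalars k) ∘ₗ (LinearMap.mulLeft k G)) ∘ₗ (pol n (e1 + 1)))
  have hP : ∀ c' H, P (c', H) = ∑ i, c' i • (f i %ₘ g) + (G * pol n (e1 + 1) H) %ₘ g := by
    intro c' H
    simp only [P, LinearMap.coprod_apply, Fintype.linearCombination_apply, LinearMap.comp_apply]
    rfl
  have hbd : ∀ x, (P x).natDegree < n ∧ Bdd (e1 + δ) (P x) := by
    rintro ⟨c', H⟩
    rw [hP]
    constructor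
    · have hA : (∑ i, c' i • (f i %ₘ g)).natDegree ≤ n - 1 := by
        refine natDegree_sum_le_of_forall_le _ _ fun i _ => ?_
        have := mod_lt hg (hgn ▸ hn) (f i)
        exact (natDegree_smul_le _ _).trans (by omega)
      have hB := mod_lt hg (hgn ▸ hn) (G * pol n (e1 + 1) H)
      have hB' : (G * pol n (e1 + 1) H %ₘ g).natDegree ≤ n - 1 := by omega
      have := natDegree_add_le_of_degree_le hA hB'
      omega
    · refine Bdd.add ?_ ?_
      · exact Bdd.sum _ fun i _ => ((he1 i).smul _).mono (by omega)
      · have hlt : (G * pol n (e1 + 1) H).natDegree < g.natDegree + N := by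
          have := natDegree_pol hn H
          have := natDegree_mul_le (p := G) (q := pol n (e1 + 1) H)
          omega
        exact (Bdd.monic_mod hg hgc N _ _ (hGE.mul (bdd_pol H)) hlt).mono (by omega)
  have hinj : Function.Injective ((cof n (e1 + δ + 1)) ∘ₗ P) := by
    rw [injective_iff_map_eq_zero]
    rintro ⟨c', H⟩ hx
    have h0 : P (c', H) = 0 :=
      cof_eq_zero (hbd _).1 (fun i => Nat.lt_succ_of_le ((hbd _).2 i)) hx
    rw [hP] at h0
    have hc' : c' = 0 := by
      have := congrArg Λ h0
      rw [map_add, hΛmod, h2, add_zero, map_sum, map_zero] at this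
      simp only [map_smul, hΛmod] at this
      exact funext fun i => (Fintype.linearIndependent_iff.1 hf) c' this i
    subst hc'
    simp only [Pi.zero_apply, zero_smul, Finset.sum_const_zero, zero_add] at h0
    rw [modByMonic_eq_zero_iff_dvd hg] at h0
    have h3 := (hp.dvd_or_dvd h0).resolve_left hG
    have h4 : pol n (e1 + 1) H = 0 := by
      by_contra hne
      have := natDegree_le_of_dvd h3 hne
      have := natDegree_pol hn H
      omega
    have h5 := cof_pol H
    rw [h4, map_zero] at h5
    rw [← h5]; rfl
  have hcard := LinearMap.finrank_le_finrank_of_injective hinj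
  rw [Module.finrank_prod] at hcard
  simp only [Module.finrank_fintype_fun_eq_card, Fintype.card_fin, Fintype.card_prod] at hcard
  have : n * (e1 + δ + 1) = n * (e1 + 1) + n * δ := by ring
  change t ≤ n * δ
  omega

end dim
end AxP

end

section
set_option linter.style.haveILetI false
open Polynomial

namespace AxP

section dx
variable {k : Type*} [CommRing k]

/-- derivative with respect to the inner variable -/
noncomputable def dxl : k[X][X] →ₗ[k] k[X][X] :=
  (Bivariate.swap (R := k)).toLinearMap ∘ₗ
    ((derivative (R := k[X])).restrictScalars k) ∘ₗ (Bivariate.swap (R := k)).toLinearMap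

theorem dxl_apply (h : k[X][X]) :
    dxl h = Bivariate.swap (derivative (Bivariate.swap h)) := rfl

theorem dxl_mul (h h' : k[X][X]) : dxl (h * h') = dxl h * h' + h * dxl h' := by
  simp only [dxl_apply, map_mul, derivative_mul, map_add, Bivariate.swap_swap_apply]

theorem dxl_monomial (i j : ℕ) (r : k) :
    dxl (monomial i (monomial j r)) = monomial i (derivative (monomial j r)) := by
  rw [dxl_apply, Bivariate.swap_monomial_monomial, derivative_monomial, derivative_monomial,
    ← Bivariate.swap_monomial_monomial]
  congr 2
  rw [← C_eq_natCast, mul_comm, C_mul_monomial, mul_comm]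

theorem dxl_coeff (h : k[X][X]) (i : ℕ) : (dxl h).coeff i = derivative (h.coeff i) := by
  have key : ∀ (i j : ℕ) (q : k[X]), (dxl (monomial j q)).coeff i
      = derivative ((monomial j q).coeff i) := by
    intro i j q
    induction q using Polynomial.induction_on' with
    | add p q hp hq => rw [map_add, map_add, coeff_add, hp, hq, coeff_add, derivative_add]
    | monomial m r =>
      rw [dxl_monomial, coeff_monomial, coeff_monomial]
      split_ifs <;> simp
  induction h using Polynomial.induction_on' with
  | add p q hp hq => rw [map_add, coeff_add, hp, hq, coeff_add, derivative_add]
  | monomial j q => exact key i j q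

theorem Bdd.dxl {e : ℕ} {h : k[X][X]} (H : Bdd e h) : Bdd e (dxl h) := fun i => by
  rw [dxl_coeff]; exact (natDegree_derivative_le _).trans ((Nat.sub_le _ _).trans (H i))

theorem natDegree_dxl (h : k[X][X]) : (AxP.dxl h).natDegree ≤ h.natDegree := by
  rw [natDegree_le_iff_coeff_eq_zero]
  intro i hi
  rw [dxl_coeff, coeff_eq_zero_of_natDegree_lt hi, derivative_zero]

theorem Bdd.dy {e : ℕ} {h : k[X][X]} (H : Bdd e h) : Bdd e (derivative h) := fun i => by
  rw [coeff_derivative]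
  refine natDegree_mul_le.trans ?_
  have : ((i : k[X]) + 1).natDegree = 0 := by
    have : ((i : k[X]) + 1) = ((i + 1 : ℕ) : k[X]) := by push_cast; rfl
    rw [this, natDegree_natCast]
  rw [this, add_zero]; exact H _

/-- the derivation killing `g` -/
noncomputable def Dg (g : k[X][X]) : k[X][X] →ₗ[k] k[X][X] :=
  (LinearMap.mulLeft k (derivative g)) ∘ₗ dxl -
    (LinearMap.mulLeft k (dxl g)) ∘ₗ ((derivative (R := k[X])).restrictScalars k)

theorem Dg_apply (g h : k[X][X]) : Dg g h = derivative g * dxl h - dxl g * derivative h := rfl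

theorem Dg_mul (g h h' : k[X][X]) : Dg g (h * h') = Dg g h * h' + h * Dg g h' := by
  simp only [Dg_apply, dxl_mul, derivative_mul]; ring

theorem Dg_self (g : k[X][X]) : Dg g g = 0 := by rw [Dg_apply]; ring

theorem dxl_C (d : k[X]) : dxl (C d) = C (derivative d) := by
  ext1 i
  rw [dxl_coeff, coeff_C, coeff_C]; split_ifs <;> simp

theorem Dg_CX (g : k[X][X]) : Dg g (C X) = derivative g := by
  rw [Dg_apply, dxl_C]; simp

theorem Dg_one (g : k[X][X]) : Dg g 1 = 0 := by
  have := Dg_mul g 1 1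
  simpa using this

theorem Dg_pow (g h : k[X][X]) (r : ℕ) : Dg g (h ^ (r + 1)) = (r + 1 : ℕ) • (h ^ r * Dg g h) := by
  induction r with
  | zero => simp
  | succ r ih => rw [pow_succ, Dg_mul, ih]; simp only [nsmul_eq_mul]; push_cast; ring

theorem Dg_pow_char (p : ℕ) [CharP k p] (hp : p ≠ 0) (g h : k[X][X]) : Dg g (h ^ p) = 0 := by
  obtain ⟨q, rfl⟩ := Nat.exists_eq_succ_of_ne_zero hp
  rw [Nat.succ_eq_add_one, Dg_pow, nsmul_eq_mul]
  have : ((q + 1 : ℕ) : k[X][X]) = 0 := by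
    have h1 : ((q + 1 : ℕ) : k) = 0 := CharP.cast_eq_zero k (q + 1)
    have h2 : ((q + 1 : ℕ) : k[X][X]) = C (C ((q + 1 : ℕ) : k)) := by simp
    rw [h2, h1]; simp
  rw [this, zero_mul]

theorem Bdd.Dg {e c : ℕ} {g h : k[X][X]} (hc : Bdd c g) (H : Bdd e h) : Bdd (c + e) (Dg g h) := by
  rw [Dg_apply]
  exact (hc.dy.mul H.dxl).sub (hc.dxl.mul H.dy)

theorem natDegree_Dg (g h : k[X][X]) : (AxP.Dg g h).natDegree ≤ g.natDegree + h.natDegree := by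
  rw [Dg_apply]
  have h1 := natDegree_dxl g
  have h2 := natDegree_dxl h
  have h3 := natDegree_derivative_le g
  have h4 := natDegree_derivative_le h
  refine (natDegree_sub_le _ _).trans (max_le (natDegree_mul_le.trans ?_)
    (natDegree_mul_le.trans ?_)) <;> omega

theorem Bdd.Dg_iter {e c : ℕ} {g h : k[X][X]} (hc : Bdd c g) (H : Bdd e h) (r : ℕ) :
    Bdd (r * c + e) (((AxP.Dg g) ^ r) h) := by
  induction r with
  | zero => simpa using H
  | succ r ih =>
    rw [pow_succ', Module.End.mul_apply]
    exact (Bdd.Dg hc ih).mono (by rw [Nat.succ_mul]; omega)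

theorem natDegree_Dg_iter (g h : k[X][X]) (r : ℕ) :
    (((AxP.Dg g) ^ r) h).natDegree ≤ r * g.natDegree + h.natDegree := by
  induction r with
  | zero => simp
  | succ r ih =>
    rw [pow_succ', Module.End.mul_apply, Nat.succ_mul]
    exact (natDegree_Dg _ _).trans (by omega)

end dx

section van
variable {W R : Type*} [Field W] [CommRing R] [Algebra W R] (D : R →ₗ[W] R)

/-- vanishing to order `m` at a point -/
def Van (D : R →ₗ[W] R) (P : R →ₐ[W] W) (m : ℕ) (h : R) : Prop := ∀ r < m, P ((D ^ r) h) = 0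

theorem van_succ (P : R →ₐ[W] W) (m : ℕ) (h : R) :
    Van D P (m + 1) h ↔ P h = 0 ∧ Van D P m (D h) := by
  constructor
  · intro H
    refine ⟨by simpa using H 0 (by omega), fun r hr => ?_⟩
    have := H (r + 1) (by omega)
    rwa [pow_succ, Module.End.mul_apply] at this
  · rintro ⟨h0, H⟩ r hr
    cases r with
    | zero => simpa using h0
    | succ r => rw [pow_succ, Module.End.mul_apply]; exact H r (by omega)

theorem Van.mono {P : R →ₐ[W] W} {m m' : ℕ} {h : R} (H : Van D P m h) (hm : m' ≤ m) :
    Van D P m' h := fun r hr => H r (by omega)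

theorem Van.add {P : R →ₐ[W] W} {m : ℕ} {h h' : R} (H : Van D P m h) (H' : Van D P m h') :
    Van D P m (h + h') := fun r hr => by rw [map_add, map_add, H r hr, H' r hr, add_zero]

theorem Van.mul (hD : ∀ a b, D (a * b) = D a * b + a * D b)
    {P : R →ₐ[W] W} {m m' : ℕ} {h h' : R} (H : Van D P m h) (H' : Van D P m' h') :
    Van D P (m + m') (h * h') := by
  induction hs : m + m' generalizing m m' h h' with
  | zero => intro r hr; omega
  | succ s ih =>
    rw [van_succ]
    constructor
    · rw [map_mul]
      rcases Nat.eq_zero_or_pos m with rfl | hm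
      · have := H' 0 (by omega)
        rw [pow_zero, Module.End.one_apply] at this; rw [this, mul_zero]
      · have := H 0 (by omega)
        rw [pow_zero, Module.End.one_apply] at this; rw [this, zero_mul]
    · rw [hD]
      refine Van.add D ?_ ?_
      · cases m with
        | zero =>
          have := ih (m := 0) (m' := s) (h := D h) (h' := h') (fun r hr => by omega)
            (H'.mono D (by omega)) (by omega)
          exact this
        | succ m =>
          exact ih (m := m) (m' := m') ((van_succ D P m h).1 H).2 H' (by omega)
      · cases m' with
        | zero =>
          exact ih (m := s) (m' := 0) (H.mono D (by omega)) (fun r hr => by omega) (by omega)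
        | succ m' =>
          exact ih (m := m) (m' := m') H ((van_succ D P m' h').1 H').2 (by omega)

theorem Van.mul_right (hD : ∀ a b, D (a * b) = D a * b + a * D b)
    {P : R →ₐ[W] W} {m : ℕ} {h : R} (H : Van D P m h) (h' : R) :
    Van D P m (h * h') :=
  Van.mul D hD (m' := 0) H (fun r hr => by omega)

theorem Van.pow (hD : ∀ a b, D (a * b) = D a * b + a * D b)
    {P : R →ₐ[W] W} {h : R} (H : P h = 0) (m : ℕ) : Van D P m (h ^ m) := by
  induction m with
  | zero => intro r hr; omega
  | succ m ih =>
    rw [pow_succ]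
    refine ih.mul D hD (m' := 1) ?_
    intro r hr
    obtain rfl : r = 0 := by omega
    simpa using H

theorem Van.prod (hD : ∀ a b, D (a * b) = D a * b + a * D b)
    {P : R →ₐ[W] W} {m : ℕ} {ι : Type*} (s : Finset ι) (f : ι → R) (i : ι)
    (hi : i ∈ s) (H : Van D P m (f i)) : Van D P m (∏ j ∈ s, f j) := by
  classical
  rw [← Finset.mul_prod_erase s f hi]
  exact H.mul_right D hD _

theorem iter_eval (hD : ∀ a b, D (a * b) = D a * b + a * D b)
    {P : R →ₐ[W] W} {l : R} (hl : P l = 0) (r : ℕ) :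
    ∀ u, P ((D ^ r) (u * l ^ r)) = (r.factorial : W) * P u * P (D l) ^ r := by
  have hpow : ∀ r, D (l ^ (r + 1)) = (r + 1 : ℕ) • (l ^ r * D l) := by
    intro r
    induction r with
    | zero => simp
    | succ r ih => rw [pow_succ, hD, ih]; simp only [nsmul_eq_mul]; push_cast; ring
  induction r with
  | zero => intro u; simp
  | succ r ih =>
    intro u
    rw [pow_succ, Module.End.mul_apply, hD, hpow]
    have : D u * l ^ (r + 1) + u * (r + 1 : ℕ) • (l ^ r * D l)
        = (D u * l) * l ^ r + (u * ((r + 1 : ℕ) : R) * D l) * l ^ r := by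
      rw [nsmul_eq_mul]; ring
    rw [this, map_add, map_add, ih, ih]
    simp only [map_mul, hl, map_natCast, Nat.factorial_succ]
    push_cast; ring

/-- Hermite interpolation. -/
theorem interp_one (hD : ∀ a b, D (a * b) = D a * b + a * D b)
    {P : R →ₐ[W] W} {l u : R} (hl : P l = 0) (hDl : P (D l) ≠ 0) (hu : P u ≠ 0)
    (m : ℕ) (hm : ∀ r < m, (r.factorial : W) ≠ 0) (t : ℕ → W) :
    ∃ h, ∀ r < m, P ((D ^ r) (u * h)) = t r := by
  induction m with
  | zero => exact ⟨0, fun r hr => by omega⟩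
  | succ m ih =>
    obtain ⟨h, hh⟩ := ih (fun r hr => hm r (by omega))
    let a : W := (m.factorial : W) * P u * P (D l) ^ m
    have ha : a ≠ 0 := mul_ne_zero (mul_ne_zero (hm m (by omega)) hu) (pow_ne_zero _ hDl)
    refine ⟨h + ((t m - P ((D ^ m) (u * h))) / a) • l ^ m, fun r hr => ?_⟩
    rw [mul_add, mul_smul_comm, map_add, map_smul, map_add, map_smul]
    rcases Nat.lt_succ_iff_lt_or_eq.1 hr with h1 | rfl
    · rw [hh r h1]
      have := (Van.pow D hD hl m).mul_right D hD u r h1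
      rw [mul_comm u (l ^ m), this]; simp
    · rw [iter_eval D hD hl, smul_eq_mul, div_mul_cancel₀ _ ha]; ring

end van
end AxP

end

section
set_option linter.style.haveILetI false
open Polynomial

namespace AxP

theorem prime_of_irr {k : Type*} [Field k] {g : k[X][X]} (h : Irreducible g) : Prime g := h.prime

theorem Bdd.map {k l : Type*} [CommRing k] [CommRing l] (σ : k →+* l) {e : ℕ} {g : k[X][X]}
    (H : Bdd e g) : Bdd e (g.map (mapRingHom σ)) := fun i => by
  rw [coeff_map, coe_mapRingHom]; exact natDegree_map_le.trans (H i)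

universe u
theorem exists_frac {S : Type u} [CommRing S] {g : S} (hg : Prime g) :
    ∃ (M : Type u) (_ : Field M) (π : S →+* M), (∀ h, π h = 0 ↔ g ∣ h) ∧
      ∀ z, ∃ u v, ¬ g ∣ v ∧ z = π u / π v := by
  haveI hI : (Ideal.span {g} : Ideal S).IsPrime := (Ideal.span_singleton_prime hg.ne_zero).2 hg
  have hπ : ∀ h, ((algebraMap (S ⧸ (Ideal.span {g} : Ideal S)) (FractionRing (S ⧸ (Ideal.span {g} : Ideal S)))).comp
      (Ideal.Quotient.mk (Ideal.span {g} : Ideal S))) h = 0 ↔ g ∣ h := by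
    intro h
    rw [RingHom.comp_apply, map_eq_zero_iff _ (IsFractionRing.injective _ _),
      Ideal.Quotient.eq_zero_iff_mem, Ideal.mem_span_singleton]
  refine ⟨FractionRing (S ⧸ (Ideal.span {g} : Ideal S)), inferInstance, (algebraMap _ _).comp
    (Ideal.Quotient.mk (Ideal.span {g} : Ideal S)), hπ, fun z => ?_⟩
  obtain ⟨u, v, hv, huv⟩ := IsFractionRing.div_surjective (A := S ⧸ (Ideal.span {g} : Ideal S)) z
  obtain ⟨u, rfl⟩ := Ideal.Quotient.mk_surjective u
  obtain ⟨v, rfl⟩ := Ideal.Quotient.mk_surjective v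
  refine ⟨u, v, ?_, huv.symm⟩
  rw [← hπ]
  rw [RingHom.comp_apply]
  exact IsFractionRing.to_map_ne_zero_of_mem_nonZeroDivisors (R := S ⧸ (Ideal.span {g} : Ideal S)) hv

theorem nonvan {W : Type*} [Field W] [IsAlgClosed W] (p : ℕ) [Fact p.Prime] [CharP W p]
    {n c A : ℕ} {g : W[X][X]} (hg : g.Monic) (hgn : g.natDegree = n) (hn : 0 < n)
    (hgc : Bdd c g) (hirr : Irreducible g) (hgy : derivative g ≠ 0)
    (hpA : n * (A + n * c) < p) (q : Fin A → Fin n → W[X][X])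
    (hq : ∀ a j, (q a j).natDegree < n)
    (hdvd : g ∣ ∑ a, ∑ j, (q a j) ^ p * (C X ^ (a : ℕ) * X ^ (j : ℕ))) : ∀ a j, q a j = 0 := by
  have hpp : p.Prime := Fact.out
  have hprime : Prime g := prime_of_irr hirr
  obtain ⟨M, hM, π, hπ, hfrac⟩ := exists_frac hprime
  have hdlt : ∀ h : W[X][X], h.natDegree < n → g ∣ h → h = 0 := by
    intro h hh hd
    by_contra hne
    have := natDegree_le_of_dvd hd hne
    omega
  let τ : W →+* M := π.comp ((C : W[X] →+* W[X][X]).comp C)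
  haveI : CharP M p := charP_of_injective_ringHom τ.injective p
  let 𝔉 : Subfield M := (frobenius M p).fieldRange
  have hmem : ∀ z : M, z ^ p ∈ 𝔉 := fun z => ⟨z, by simp [frobenius_def]⟩
  have hτ : ∀ w, τ w ∈ 𝔉 := by
    intro w
    obtain ⟨v, hv⟩ := IsAlgClosed.exists_pow_nat_eq w hpp.pos
    rw [← hv, map_pow]; exact hmem _
  let σ : W →+* 𝔉 := τ.codRestrict 𝔉 hτ
  let x : M := π (C X)
  let y : M := π X
  -- x is not a p-th power
  have hx : x ∉ 𝔉 := by
    rintro ⟨z, hz⟩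
    rw [frobenius_def] at hz
    obtain ⟨u, v, hv0, huv⟩ := hfrac z
    have hv1 : π v ≠ 0 := by rwa [Ne, hπ]
    have h1 : π (C X * v ^ p - u ^ p) = 0 := by
      have hz' : z = π u / π v := huv
      rw [map_sub, map_mul, map_pow, map_pow]
      change x * _ - _ = 0
      rw [← hz, hz', div_pow, div_mul_cancel₀ _ (pow_ne_zero _ hv1), sub_self]
    rw [hπ] at h1
    obtain ⟨w, hw⟩ := h1
    have h2 := congrArg (Dg g) hw
    rw [map_sub, Dg_mul, Dg_mul, Dg_self, Dg_pow_char p hpp.ne_zero, Dg_pow_char p hpp.ne_zero,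
      Dg_CX] at h2
    have h3 : g ∣ derivative g * v ^ p := ⟨Dg g w, by linear_combination h2⟩
    rcases hprime.dvd_or_dvd h3 with h4 | h4
    · refine hgy (hdlt _ ?_ h4)
      have := natDegree_derivative_lt (p := g) (by omega)
      omega
    · exact hv0 (hprime.dvd_of_dvd_pow h4)
  have hmin : minpoly 𝔉 x = X ^ p - C ⟨x ^ p, hmem x⟩ := by
    refine (minpoly.eq_of_irreducible_of_monic ?_ ?_ ?_).symm
    · refine X_pow_sub_C_irreducible_of_prime hpp fun b hb => hx ?_
      have hb' : (b : M) ^ p = x ^ p := congrArg Subtype.val hb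
      have : (b : M) = x := frobenius_inj M p (by simpa [frobenius_def] using hb')
      rw [← this]; exact b.2
    · simp only [aeval_sub, map_pow, aeval_X, aeval_C]; exact sub_self _
    · exact monic_X_pow_sub_C _ hpp.ne_zero
  have hli : LinearIndependent 𝔉 (fun i : Fin p => x ^ (i : ℕ)) := by
    have h1 := linearIndependent_pow (K := 𝔉) x
    rw [hmin, natDegree_X_pow_sub_C] at h1
    exact h1
  -- polynomials over 𝔉
  let g' : 𝔉[X][X] := g.map (mapRingHom σ)
  have hg' : g'.Monic := hg.map _
  have hg'n : g'.natDegree = n := by rw [hg.natDegree_map, hgn]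
  have hg'p : Prime g' := prime_of_irr (irreducible_map σ g hg hirr)
  let G : 𝔉[X][X] := ∑ a : Fin A, ∑ j : Fin n, monomial (j : ℕ) (monomial (a : ℕ) (⟨π (q a j) ^ p, hmem _⟩ : 𝔉))
  have hGn : G.natDegree < n := by
    refine Nat.lt_of_le_sub_one hn (natDegree_sum_le_of_forall_le _ _ fun a _ =>
      natDegree_sum_le_of_forall_le _ _ fun j _ => (natDegree_monomial_le _).trans (by omega))
  have hGA : Bdd A G := by
    refine Bdd.sum _ fun a _ => Bdd.sum _ fun j _ i => ?_
    rw [coeff_monomial]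
    split_ifs
    · exact (natDegree_monomial_le _).trans (by omega)
    · simp
  let Λ : 𝔉[X][X] →ₐ[𝔉] M := aevalAeval x y
  have hΛmon : ∀ (j a : ℕ) (b : 𝔉), Λ (monomial j (monomial a b)) = (b : M) * (x ^ a * y ^ j) := by
    intro j a b
    have : (monomial j (monomial a b) : 𝔉[X][X]) = C (C b) * (C X ^ a * X ^ j) := by
      rw [← C_mul_X_pow_eq_monomial, ← C_mul_X_pow_eq_monomial]
      simp only [map_mul, map_pow]; ring
    rw [this, map_mul, map_mul, map_pow, map_pow]
    simp only [Λ]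
    simp [aevalAeval]
    left; rfl
  have hΛg : Λ g' = 0 := by
    have hcomp : ((Λ : 𝔉[X][X] →+* M).comp (mapRingHom (mapRingHom σ))) = π := by
      apply Polynomial.ringHom_ext'
      · apply Polynomial.ringHom_ext'
        · ext w
          simp [Λ, aevalAeval]
          rfl
        · simp [Λ, aevalAeval]; rfl
      · simp [Λ, aevalAeval]; rfl
    have : Λ g' = π g := by rw [← hcomp]; rfl
    rw [this, hπ]
  have hΛG : Λ G = 0 := by
    have : Λ G = π (∑ a, ∑ j, (q a j) ^ p * (C X ^ (a : ℕ) * X ^ (j : ℕ))) := by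
      simp only [G, map_sum, hΛmon, map_mul, map_pow]
      rfl
    rw [this, hπ]; exact hdvd
  have hdiv : g' ∣ G := by
    by_contra hnd
    have := dim_count hg' hg'n hn (hgc.map σ) hg'p hnd hGn.le hGA (Λ.toLinearMap)
      (fun h => by simp [hΛg]) (fun h => by simp [hΛG]) p (fun i => C X ^ (i : ℕ))
      (by
        have : (fun i : Fin p => Λ.toLinearMap (C X ^ (i : ℕ))) = fun i : Fin p => x ^ (i : ℕ) := by
          funext i; simp [Λ, aevalAeval]
        rw [this]; exact hli)
    omega
  have hG0 : G = 0 := by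
    by_contra hne
    have := natDegree_le_of_dvd hdiv hne
    omega
  intro a j
  refine hdlt _ (hq a j) ?_
  rw [← hπ]
  have hco : (G.coeff (j : ℕ)).coeff (a : ℕ) = ⟨π (q a j) ^ p, hmem _⟩ := by
    simp only [G, finsetSum_coeff]
    rw [Finset.sum_eq_single a, Finset.sum_eq_single j]
    · simp
    · intro j' _ hne
      rw [coeff_monomial, if_neg (fun h => hne (Fin.ext h))]; simp
    · simp
    · intro a' _ hne
      refine Finset.sum_eq_zero fun j' _ => ?_
      rw [coeff_monomial]
      split_ifs
      · rw [coeff_monomial, if_neg (fun h => hne (Fin.ext h))]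
      · simp
    · simp
  rw [hG0] at hco
  have h0 : (0 : M) = π (q a j) ^ p := by
    have := congrArg Subtype.val hco
    simpa using this
  exact pow_eq_zero_iff hpp.ne_zero |>.1 h0.symm

end AxP

end

section
set_option linter.style.haveILetI false
open Polynomial

namespace AxP

section
variable {W : Type*} [Field W]

/-- evaluation at a point -/
noncomputable def ev (P : W × W) : W[X][X] →ₐ[W] W := aevalAeval P.1 P.2

theorem ev_apply (P : W × W) (h : W[X][X]) : ev P h = h.evalEval P.1 P.2 := by
  rw [ev, coe_aevalAeval_eq_evalEval]

theorem pts_count {n c N E m : ℕ} {g Φ : W[X][X]} (hg : g.Monic) (hgn : g.natDegree = n)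
    (hn : 0 < n) (hgc : Bdd c g) (hp : Prime g) (hΦ : ¬ g ∣ Φ) (hΦN : Φ.natDegree ≤ N)
    (hΦE : Bdd E Φ) (T : Finset (W × W)) (hT : ∀ P ∈ T, ev P g = 0 ∧ ev P (derivative g) ≠ 0)
    (hvan : ∀ P ∈ T, Van (Dg g) (ev P) m Φ) (hm : ∀ r < m, (r.factorial : W) ≠ 0) :
    T.card * m ≤ n * (E + N * c) := by
  classical
  have hD := Dg_mul g
  let Λ : W[X][X] →ₗ[W] (T × Fin m → W) :=
    LinearMap.pi fun x => (ev x.1.1).toLinearMap ∘ₗ ((Dg g) ^ (x.2 : ℕ))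
  have hΛ : ∀ h P r, Λ h (P, r) = ev P.1 (((Dg g) ^ (r : ℕ)) h) := fun h P r => rfl
  have hgv : ∀ P ∈ T, Van (Dg g) (ev P) m g := by
    intro P hP r hr
    rcases r with _ | r
    · simpa using (hT P hP).1
    · rw [pow_succ, Module.End.mul_apply, Dg_self, map_zero, map_zero]
  have hz : ∀ F : W[X][X], (∀ P ∈ T, Van (Dg g) (ev P) m F) → ∀ h, Λ (F * h) = 0 := by
    intro F hF h
    ext ⟨P, r⟩
    rw [hΛ]
    exact Van.mul_right (Dg g) hD (hF P.1 P.2) h r r.2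
  -- separating elements
  have hsep : ∀ P : T, ∀ r : Fin m, ∃ h, Λ h = Pi.single (P, r) 1 := by
    intro P r
    let l : W × W → W[X][X] := fun P' => if P'.1 = P.1.1 then X - C (C P'.2) else C (X - C P'.1)
    have hl1 : ∀ P', ev P' (l P') = 0 := by
      intro P'; simp only [l, ev_apply]; split_ifs
      · simp
      · rw [evalEval_C]; simp
    have hl2 : ∀ P' : W × W, P' ≠ P.1 → ev P.1 (l P') ≠ 0 := by
      intro P' hne
      simp only [l, ev_apply]
      split_ifs with h
      · simp only [evalEval_sub, evalEval_X, evalEval_C, eval_C, sub_ne_zero]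
        exact fun h' => hne (Prod.ext h h'.symm)
      · simp only [evalEval_C, eval_sub, eval_X, eval_C, sub_ne_zero]
        exact fun h' => h h'.symm
    let u : W[X][X] := ∏ P' ∈ T.erase P.1, l P' ^ m
    have hu : ev P.1 u ≠ 0 := by
      simp only [u, map_prod, map_pow]
      exact Finset.prod_ne_zero_iff.2 fun P' hP' => pow_ne_zero _ (hl2 _ (Finset.ne_of_mem_erase hP'))
    obtain ⟨h, hh⟩ := interp_one (Dg g) hD (P := ev P.1) (l := C (X - C P.1.1)) (u := u)
      (by rw [ev_apply, evalEval_C]; simp) (by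
        have : Dg g (C (X - C P.1.1)) = derivative g := by
          rw [Dg_apply, dxl_C]; simp
        rw [this]; exact (hT _ P.2).2) hu m hm (fun i => if i = r then 1 else 0)
    refine ⟨u * h, ?_⟩
    ext ⟨Q, i⟩
    rw [hΛ]
    by_cases hQ : Q = P
    · subst hQ
      rw [hh i i.2, Pi.single_apply]
      by_cases hi : i = r
      · simp [hi]
      · simp [hi, Fin.val_ne_of_ne hi]
    · rw [Pi.single_apply, if_neg (by simp [hQ])]
      refine Van.mul_right (Dg g) hD (Van.prod (Dg g) hD _ _ Q.1 ?_ (Van.pow (Dg g) hD (hl1 _) m)) h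
        i i.2
      exact Finset.mem_erase.2 ⟨fun h' => hQ (Subtype.ext h'), Q.2⟩
  choose f hf using hsep
  have hcard : Fintype.card (T × Fin m) = T.card * m := by simp
  let e := Fintype.equivFin (T × Fin m)
  rw [← hcard]
  refine dim_count hg hgn hn hgc hp hΦ hΦN hΦE Λ (hz g hgv) (hz Φ hvan) _
    (fun i => f (e.symm i).1 (e.symm i).2) ?_
  have : (fun i => Λ (f (e.symm i).1 (e.symm i).2)) = (Pi.basisFun W (T × Fin m)) ∘ e.symm := by
    funext i; simp [hf]
  rw [this]
  exact (Pi.basisFun W (T × Fin m)).linearIndependent.comp _ e.symm.injective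

theorem aux_exists {n c A B m E0 : ℕ} {g : W[X][X]} (hg : g.Monic) (hgn : g.natDegree = n)
    (hn : 0 < n) (hgc : Bdd c g) {s : W[X][X]} (hs : s.natDegree ≤ c) (hsc : Bdd c s)
    {d : W[X]} (hd : d.natDegree ≤ c)
    (hE0 : m * c + B + 2 * n * c + (m * n + n + n * c + 1) * c + 1 ≤ E0)
    (hdim : m * (n * (A + E0)) < (A * n) * (n * B)) :
    ∃ cc : (Fin A × Fin n) × (Fin n × Fin B) → W, cc ≠ 0 ∧ ∀ r < m,
      g ∣ ∑ x, cc x • (((Dg g) ^ r) (C X ^ (x.1.1 : ℕ) * X ^ (x.1.2 : ℕ)) *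
        (C X ^ (x.2.2 : ℕ) * s ^ (x.2.1 : ℕ) * C d ^ (n - x.2.1))) := by
  classical
  let term : ℕ → (Fin A × Fin n) × (Fin n × Fin B) → W[X][X] := fun r x =>
    ((Dg g) ^ r) (C X ^ (x.1.1 : ℕ) * X ^ (x.1.2 : ℕ)) *
        (C X ^ (x.2.2 : ℕ) * s ^ (x.2.1 : ℕ) * C d ^ (n - x.2.1))
  let Ψ : ℕ → ((Fin A × Fin n) × (Fin n × Fin B) → W) →ₗ[W] W[X][X] := fun r =>
    ∑ x, (LinearMap.proj x).smulRight (term r x)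
  have hΨ : ∀ r cc, Ψ r cc = ∑ x, cc x • term r x := by
    intro r cc; simp [Ψ]
  let L : ((Fin A × Fin n) × (Fin n × Fin B) → W) →ₗ[W] (Fin m → Fin n × Fin (A + E0) → W) :=
    LinearMap.pi fun r => cof n (A + E0) ∘ₗ
      ((modByMonicHom g).restrictScalars W) ∘ₗ Ψ r
  have hker : LinearMap.ker L ≠ ⊥ := by
    apply LinearMap.ker_ne_bot_of_finrank_lt
    simp only [Module.finrank_pi_fintype, Module.finrank_fintype_fun_eq_card, Fintype.card_prod,
      Fintype.card_fin, Finset.sum_const, Finset.card_univ, smul_eq_mul,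
      Module.finrank_self, mul_one]
    exact hdim
  obtain ⟨cc, hcc, hne⟩ := (Submodule.ne_bot_iff _).1 hker
  refine ⟨cc, hne, fun r hr => ?_⟩
  rw [LinearMap.mem_ker] at hcc
  have h1 : cof n (A + E0) (Ψ r cc %ₘ g) = 0 := congrFun hcc ⟨r, hr⟩
  have hmain : g ∣ Ψ r cc := by
    rw [← modByMonic_eq_zero_iff_dvd hg]
    have hbdd : Bdd (r * c + A + (B + n * c + n * c)) (Ψ r cc) := by
      rw [hΨ]
      refine Bdd.sum _ fun x _ => Bdd.smul ?_ _
      have hx1 : Bdd A (C X ^ (x.1.1 : ℕ) * X ^ (x.1.2 : ℕ) : W[X][X]) := by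
        have := ((Bdd.C (k := W) (natDegree_X_le)).pow (x.1.1 : ℕ)).mul
          ((Bdd.Y (k := W) (e := 0)).pow (x.1.2 : ℕ))
        refine this.mono ?_
        have := x.1.1.2; simp
      refine (hgc.Dg_iter hx1 r).mul (((Bdd.mono (((Bdd.C (k := W) (natDegree_X_le)).pow
        (x.2.2 : ℕ))) ?_).mul ((hsc.pow _).mono ?_)).mul (((Bdd.C hd).pow _).mono ?_))
      · have := x.2.2.2; omega
      · exact Nat.mul_le_mul_right _ (by omega)
      · exact Nat.mul_le_mul_right _ (by omega)
    have hdeg : (Ψ r cc).natDegree < g.natDegree + (m * n + n + n * c + 1) := by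
      have : (Ψ r cc).natDegree ≤ r * n + n + n * c := by
        rw [hΨ]
        refine natDegree_sum_le_of_forall_le _ _ fun x _ => (natDegree_smul_le _ _).trans ?_
        have e1 := natDegree_Dg_iter g (C X ^ (x.1.1 : ℕ) * X ^ (x.1.2 : ℕ)) r
        have e2 : (C X ^ (x.1.1 : ℕ) * X ^ (x.1.2 : ℕ) : W[X][X]).natDegree ≤ n := by
          rw [← C_pow]
          exact (natDegree_C_mul_X_pow_le _ _).trans (by omega)
        have e3 : (s ^ (x.2.1 : ℕ)).natDegree ≤ n * c :=
          natDegree_pow_le.trans (Nat.mul_le_mul (by omega) hs)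
        refine natDegree_mul_le.trans ?_
        have e4 : ((C (X ^ (x.2.2 : ℕ)) * s ^ (x.2.1 : ℕ)) * C (d ^ (n - (x.2.1 : ℕ)))).natDegree
            ≤ (s ^ (x.2.1 : ℕ)).natDegree :=
          (natDegree_mul_C_le _ _).trans (natDegree_C_mul_le _ _)
        simp only [← C_pow] at e1 e2 e4 ⊢
        rw [hgn] at e1
        omega
      have : r * n ≤ m * n := Nat.mul_le_mul_right _ hr.le
      omega
    refine cof_eq_zero ?_ ?_ h1
    · exact (mod_lt hg (by omega) _).trans_le hgn.le
    · intro i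
      refine lt_of_le_of_lt (Bdd.monic_mod hg hgc _ _ _ hbdd hdeg i) ?_
      have : r * c ≤ m * c := Nat.mul_le_mul_right _ hr.le
      nlinarith
  rw [hΨ] at hmain
  exact hmain

end
end AxP

end

section
set_option linter.style.haveILetI false
open Polynomial

namespace AxP

theorem st_one {W : Type*} [Field W] [IsAlgClosed W] (p : ℕ) [Fact p.Prime] [CharP W p]
    {n c A B m E0 : ℕ} {g : W[X][X]} (hg : g.Monic) (hgn : g.natDegree = n)
    (hn : 0 < n) (hgc : Bdd c g) (hirr : Irreducible g)
    {s : W[X][X]} (hs : s.natDegree ≤ c) (hsc : Bdd c s)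
    {d : W[X]} (hd : d.natDegree ≤ c)
    (hE0 : m * c + B + 2 * n * c + (m * n + n + n * c + 1) * c + 1 ≤ E0)
    (hdim : m * (n * (A + E0)) < (A * n) * (n * B)) (hpA : n * (A + n * c) < p) (hmp : m < p)
    (T : Finset (W × W)) (hT : ∀ P ∈ T, P.1 ^ p = P.1 ∧ g.evalEval P.1 P.2 = 0 ∧
      (derivative g).evalEval P.1 P.2 ≠ 0 ∧ d.eval P.1 ≠ 0 ∧
      d.eval P.1 * P.2 ^ p = s.evalEval P.1 P.2) :
    T.card * m ≤ n * ((A + p * B) + (n + p * n) * c) := by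
  classical
  have hpp : p.Prime := Fact.out
  rcases T.eq_empty_or_nonempty with rfl | ⟨P0, hP0⟩
  · simp
  have hgy : derivative g ≠ 0 := by
    intro h; apply (hT P0 hP0).2.2.1; rw [h]; simp
  obtain ⟨cc, hcc, hdvd⟩ := aux_exists hg hgn hn hgc hs hsc hd hE0 hdim
  choose rt hrt using fun w : W => IsAlgClosed.exists_pow_nat_eq w hpp.pos
  let q : Fin A → Fin n → W[X][X] := fun a j => pol n B fun x => rt (cc ((a, j), x))
  let Φ : W[X][X] := ∑ a, ∑ j, (q a j) ^ p * (C X ^ (a : ℕ) * X ^ (j : ℕ))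
  have hΦ : ¬ g ∣ Φ := by
    intro h
    have h0 := nonvan p hg hgn hn hgc hirr hgy hpA q (fun a j => natDegree_pol hn _) h
    apply hcc
    ext ⟨⟨a, j⟩, x⟩
    have h1 := congrArg (cof n B) (h0 a j)
    simp only [q] at h1
    rw [cof_pol, map_zero] at h1
    have h2 := congrFun h1 x
    rw [← hrt (cc _)]
    change rt (cc ((a, j), x)) = 0 at h2
    rw [h2]; simp [hpp.ne_zero]
  have hqB : ∀ a j, Bdd B (q a j) := by
    intro a j
    refine Bdd.sum _ fun x _ i => ?_
    rw [coeff_monomial]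
    split_ifs
    · exact (natDegree_monomial_le _).trans (by omega)
    · simp
  have hΦE : Bdd (A + p * B) Φ := by
    refine Bdd.sum _ fun a _ => Bdd.sum _ fun j _ => ?_
    rw [add_comm]
    refine ((hqB a j).pow p).mul ?_
    have := ((Bdd.C (k := W) (natDegree_X_le)).pow (a : ℕ)).mul
      ((Bdd.Y (k := W) (e := 0)).pow (j : ℕ))
    refine this.mono ?_
    have := a.2; simp
  have hΦN : Φ.natDegree ≤ n + p * n := by
    refine natDegree_sum_le_of_forall_le _ _ fun a _ => natDegree_sum_le_of_forall_le _ _ fun j _ => ?_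
    refine natDegree_mul_le.trans ?_
    rw [add_comm]
    refine add_le_add ?_ (natDegree_pow_le.trans (Nat.mul_le_mul_left _ (natDegree_pol hn _).le))
    rw [← C_pow]
    exact (natDegree_C_mul_X_pow_le _ _).trans (by omega)
  have hDΦ : ∀ r, ((Dg g) ^ r) Φ =
      ∑ a, ∑ j, (q a j) ^ p * ((Dg g) ^ r) (C X ^ (a : ℕ) * X ^ (j : ℕ)) := by
    intro r
    induction r with
    | zero => simp [Φ]
    | succ r ih =>
      rw [pow_succ', Module.End.mul_apply, ih, map_sum]
      refine Finset.sum_congr rfl fun a _ => ?_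
      rw [map_sum]
      refine Finset.sum_congr rfl fun j _ => ?_
      rw [Dg_mul, Dg_pow_char p hpp.ne_zero, zero_mul, zero_add, Module.End.mul_apply]
  refine pts_count hg hgn hn hgc hirr.prime hΦ hΦN hΦE T
    (fun P hP => by simpa only [ev_apply] using ⟨(hT P hP).2.1, (hT P hP).2.2.1⟩) ?_ ?_
  · intro P hP r hr
    obtain ⟨hx, hg0, -, hd0, hy⟩ := hT P hP
    have hq : ∀ a j, d.eval P.1 ^ n * ev P (q a j) ^ p = ∑ x : Fin n × Fin B, cc ((a, j), x) *
        (P.1 ^ (x.2 : ℕ) * (s.evalEval P.1 P.2) ^ (x.1 : ℕ) * d.eval P.1 ^ (n - x.1)) := by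
      intro a j
      have : ev P (q a j) = ∑ x : Fin n × Fin B, rt (cc ((a, j), x)) * P.1 ^ (x.2 : ℕ) *
          P.2 ^ (x.1 : ℕ) := by
        rw [ev_apply]
        simp only [q, pol, LinearMap.coe_mk, AddHom.coe_mk, evalEval_finsetSum]
        refine Finset.sum_congr rfl fun x _ => ?_
        simp [evalEval, eval_monomial]
      rw [this, sum_pow_char, Finset.mul_sum]
      refine Finset.sum_congr rfl fun x _ => ?_
      rw [mul_pow, mul_pow, hrt, ← pow_mul, ← pow_mul, mul_comm _ p, mul_comm _ p, pow_mul, pow_mul,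
        hx, ← hy, mul_pow]
      have : d.eval P.1 ^ n = d.eval P.1 ^ (x.1 : ℕ) * d.eval P.1 ^ (n - x.1) := by
        rw [← pow_add]; congr 1; omega
      rw [this]; ring
    have h1 : ev P (∑ x, cc x • (((Dg g) ^ r) (C X ^ (x.1.1 : ℕ) * X ^ (x.1.2 : ℕ)) *
        (C X ^ (x.2.2 : ℕ) * s ^ (x.2.1 : ℕ) * C d ^ (n - x.2.1)))) = 0 := by
      obtain ⟨w, hw⟩ := hdvd r hr
      rw [hw, map_mul, ev_apply P g, hg0, zero_mul]
    have h2 : d.eval P.1 ^ n * ev P (((Dg g) ^ r) Φ) = 0 := by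
      rw [← h1, hDΦ, map_sum, map_sum, Finset.mul_sum, Fintype.sum_prod_type, Fintype.sum_prod_type]
      refine Finset.sum_congr rfl fun a _ => ?_
      rw [map_sum, Finset.mul_sum]
      refine Finset.sum_congr rfl fun j _ => ?_
      rw [map_mul, map_pow, ← mul_assoc, hq, Finset.sum_mul]
      refine Finset.sum_congr rfl fun x _ => ?_
      dsimp only
      generalize ((Dg g) ^ r) (C X ^ (a : ℕ) * X ^ (j : ℕ)) = Z
      rw [map_smul, map_mul, map_mul, map_mul, map_pow, map_pow, map_pow, ev_apply P s,
        ev_apply P (C d), ev_apply P (C X), evalEval_C, evalEval_C, eval_X, smul_eq_mul]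
      ring
    exact (mul_eq_zero.1 h2).resolve_left (pow_ne_zero _ hd0)
  · intro r hr h
    rw [CharP.cast_eq_zero_iff W p, hpp.dvd_factorial] at h
    omega

theorem st_bound (n c K : ℕ) (hn : 0 < n) (hK : 0 < K) : ∃ p0 : ℕ, ∀ (W : Type) [Field W]
    [IsAlgClosed W] (p : ℕ) [Fact p.Prime] [CharP W p], p0 ≤ p →
    ∀ (g : W[X][X]), g.Monic → g.natDegree = n → Bdd c g → Irreducible g →
    ∀ (s : W[X][X]), s.natDegree ≤ c → Bdd c s → ∀ (d : W[X]), d.natDegree ≤ c →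
    ∀ (T : Finset (W × W)), (∀ P ∈ T, P.1 ^ p = P.1 ∧ g.evalEval P.1 P.2 = 0 ∧
      (derivative g).evalEval P.1 P.2 ≠ 0 ∧ d.eval P.1 ≠ 0 ∧
      d.eval P.1 * P.2 ^ p = s.evalEval P.1 P.2) → K * T.card ≤ (K + 1) * p := by
  let m' := 2 * K * (1 + n * c)
  let m := n * m'
  let B := m' + 1
  let E0 := m * c + B + 2 * n * c + (m * n + n + n * c + 1) * c + 1
  let A := m' * E0 + 1
  refine ⟨n * (A + n * c) + m + 2 * K * (A + n * c) + 1, ?_⟩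
  intro W _ _ p _ _ hp g hg hgn hgc hirr s hs hsc d hd T hT
  have hm' : 0 < m' := by positivity
  have h := st_one (A := A) (B := B) (m := m) (E0 := E0) p hg hgn hn hgc hirr hs hsc hd le_rfl
    (by
      have : m' * (A + E0) < A * B := by
        simp only [A, B]; nlinarith
      calc m * (n * (A + E0)) = n * n * (m' * (A + E0)) := by simp only [m]; ring
        _ < n * n * (A * B) := Nat.mul_lt_mul_of_pos_left this (by positivity)
        _ = _ := by ring) (by omega) (by omega) T hT
  have h1 : T.card * m' ≤ (A + p * B) + (n + p * n) * c := by
    refine le_of_mul_le_mul_left (a := n) ?_ hn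
    calc n * (T.card * m') = T.card * m := by simp only [m]; ring
      _ ≤ _ := h
  have h2 : 2 * K * (A + n * c) ≤ p := by omega
  refine le_of_mul_le_mul_left (a := 2 * m') ?_ (by omega)
  have h3 : p * m' = 2 * K * (1 + n * c) * p := by simp only [m']; ring
  have h4 : p ≤ p * m' := Nat.le_mul_of_pos_right _ hm'
  calc 2 * m' * (K * T.card) = 2 * K * (T.card * m') := by ring
    _ ≤ 2 * K * ((A + p * B) + (n + p * n) * c) := Nat.mul_le_mul_left _ h1
    _ = 2 * K * (A + n * c) + 2 * K * (1 + n * c) * p + 2 * K * p * m' := by simp only [B]; ring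
    _ ≤ p * m' + p * m' + 2 * K * p * m' := by rw [← h3]; omega
    _ = _ := by ring

end AxP

end

section
set_option linter.style.haveILetI false
open Polynomial

namespace AxP

/-- finite-level statement -/
theorem fl (n c : ℕ) (hn : 0 < n) : ∃ p0 : ℕ, ∀ (W : Type) [Field W]
    [IsAlgClosed W] (p : ℕ) [Fact p.Prime] [CharP W p], p0 ≤ p →
    ∀ (g : W[X][X]), g.Monic → g.natDegree = n → Bdd c g → Irreducible g →
    ∀ (s : Fin n → W[X][X]), (∀ γ, (s γ).natDegree ≤ c ∧ Bdd c (s γ)) →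
    ∀ (d : W[X]), d.natDegree ≤ c → d ≠ 0 → ∀ (e : W[X]), e.natDegree ≤ c → e ≠ 0 →
    ∀ (Δ : W[X]), Δ.natDegree ≤ c → Δ ≠ 0 →
    ∀ u v, g * u + derivative g * v = C Δ →
    (∀ x0 y0, x0 ^ p = x0 → d.eval x0 ≠ 0 → g.evalEval x0 y0 = 0 →
      ∃ γ, d.eval x0 * y0 ^ p = (s γ).evalEval x0 y0) →
    ∀ γ, ∃ x0 y0, x0 ^ p = x0 ∧ e.eval x0 ≠ 0 ∧ d.eval x0 ≠ 0 ∧ g.evalEval x0 y0 = 0 ∧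
      d.eval x0 * y0 ^ p = (s γ).evalEval x0 y0 := by
  obtain ⟨p1, hp1⟩ := st_bound n c (2 * n) hn (by omega)
  refine ⟨p1 + 6 * n * c + 1, ?_⟩
  intro W _ _ p _ _ hp g hg hgn hgc hirr s hs d hd hd0 e he he0 Δ hΔ hΔ0 u v huv H γ0
  classical
  have hpp : p.Prime := Fact.out
  by_contra! hcon
  letI : Algebra (ZMod p) W := ZMod.algebra W p
  -- the prime field
  let F : Finset W := Finset.univ.image (algebraMap (ZMod p) W)
  have hFcard : F.card = p := by
    rw [Finset.card_image_of_injective _ (algebraMap (ZMod p) W).injective, Finset.card_univ,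
      ZMod.card]
  have hF : ∀ x ∈ F, x ^ p = x := by
    intro x hx
    obtain ⟨a, -, rfl⟩ := Finset.mem_image.1 hx
    rw [← map_pow, ZMod.pow_card]
  let q : W[X] := d * e * Δ
  have hq0 : q ≠ 0 := mul_ne_zero (mul_ne_zero hd0 he0) hΔ0
  have hqd : q.natDegree ≤ 3 * c := by
    refine natDegree_mul_le.trans ?_
    have := natDegree_mul_le (p := d) (q := e)
    omega
  let F' : Finset W := F.filter fun x => q.eval x ≠ 0
  have hF' : p ≤ F'.card + 3 * c := by
    have h1 : F ⊆ F' ∪ q.roots.toFinset := by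
      intro x hx
      by_cases h : q.eval x = 0
      · exact Finset.mem_union_right _ (by simp [hq0, h])
      · exact Finset.mem_union_left _ (Finset.mem_filter.2 ⟨hx, h⟩)
    have h2 := (Finset.card_le_card h1).trans (Finset.card_union_le _ _)
    have h3 := (Multiset.toFinset_card_le q.roots).trans (card_roots' q)
    omega
  let fib : W → Finset (W × W) := fun x =>
    (g.map (evalRingHom x)).roots.toFinset.image fun y => (x, y)
  have hgm : ∀ x, (g.map (evalRingHom x)).Monic := fun x => hg.map _
  have hmem : ∀ x y, y ∈ (g.map (evalRingHom x)).roots ↔ g.evalEval x y = 0 := by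
    intro x y
    rw [mem_roots (hgm x).ne_zero, IsRoot.def, eval_map, eval₂_evalRingHom]
  have hder : ∀ x y, Δ.eval x ≠ 0 → g.evalEval x y = 0 → (derivative g).evalEval x y ≠ 0 := by
    intro x y hx hy h
    have := congrArg (evalEval x y) huv
    rw [evalEval_add, evalEval_mul, evalEval_mul, hy, h, evalEval_C] at this
    apply hx; rw [← this]; ring
  have hfib : ∀ x, Δ.eval x ≠ 0 → (fib x).card = n := by
    intro x hx
    rw [Finset.card_image_of_injective _ (fun a b h => (Prod.ext_iff.1 h).2)]
    have hnd : (g.map (evalRingHom x)).roots.Nodup := by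
      rw [nodup_roots_iff_of_splits (hgm x).ne_zero (IsAlgClosed.splits _)]
      rw [Polynomial.Separable]
      refine ⟨C (Δ.eval x)⁻¹ * u.map (evalRingHom x), C (Δ.eval x)⁻¹ * v.map (evalRingHom x), ?_⟩
      have := congrArg (Polynomial.map (evalRingHom x)) huv
      rw [Polynomial.map_add, Polynomial.map_mul, Polynomial.map_mul, map_C, coe_evalRingHom,
        ← derivative_map] at this
      calc _ = C (Δ.eval x)⁻¹ * (g.map (evalRingHom x) * u.map (evalRingHom x) +
          derivative (g.map (evalRingHom x)) * v.map (evalRingHom x)) := by ring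
        _ = 1 := by rw [this, ← C_mul, inv_mul_cancel₀ hx, C_1]
    rw [Multiset.toFinset_card_of_nodup hnd, ← (IsAlgClosed.splits _).natDegree_eq_card_roots,
      hg.natDegree_map, hgn]
  let A : Finset (W × W) := F'.biUnion fib
  have hA : A.card = F'.card * n := by
    rw [Finset.card_biUnion]
    · rw [Finset.sum_const_nat]
      intro x hx
      refine hfib x fun h => (Finset.mem_filter.1 hx).2 ?_
      simp [q, h]
    · intro x _ x' _ hne
      rw [Function.onFun, Finset.disjoint_left]
      intro P hP hP'
      obtain ⟨y, -, rfl⟩ := Finset.mem_image.1 hP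
      obtain ⟨y', -, h⟩ := Finset.mem_image.1 hP'
      exact hne (Prod.ext_iff.1 h).1.symm
  have hAmem : ∀ P ∈ A, P.1 ^ p = P.1 ∧ d.eval P.1 ≠ 0 ∧ e.eval P.1 ≠ 0 ∧ Δ.eval P.1 ≠ 0 ∧
      g.evalEval P.1 P.2 = 0 := by
    intro P hP
    obtain ⟨x, hx, hP⟩ := Finset.mem_biUnion.1 hP
    obtain ⟨y, hy, rfl⟩ := Finset.mem_image.1 hP
    obtain ⟨hx1, hx2⟩ := Finset.mem_filter.1 hx
    simp only [q, eval_mul, mul_ne_zero_iff] at hx2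
    exact ⟨hF x hx1, hx2.1.1, hx2.1.2, hx2.2, (hmem x y).1 (Multiset.mem_toFinset.1 hy)⟩
  let T : Fin n → Finset (W × W) := fun γ =>
    A.filter fun P => d.eval P.1 * P.2 ^ p = (s γ).evalEval P.1 P.2
  have hcov : A ⊆ (Finset.univ.erase γ0).biUnion T := by
    intro P hP
    obtain ⟨h1, h2, h3, h4, h5⟩ := hAmem P hP
    obtain ⟨γ, hγ⟩ := H P.1 P.2 h1 h2 h5
    refine Finset.mem_biUnion.2 ⟨γ, Finset.mem_erase.2 ⟨?_, Finset.mem_univ _⟩,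
      Finset.mem_filter.2 ⟨hP, hγ⟩⟩
    rintro rfl
    exact hcon P.1 P.2 h1 h3 h2 h5 hγ
  have hTc : ∀ γ, 2 * n * (T γ).card ≤ (2 * n + 1) * p := by
    intro γ
    refine hp1 W p (by omega) g hg hgn hgc hirr (s γ) (hs γ).1 (hs γ).2 d hd (T γ) ?_
    intro P hP
    obtain ⟨hP, hγ⟩ := Finset.mem_filter.1 hP
    obtain ⟨h1, h2, h3, h4, h5⟩ := hAmem P hP
    exact ⟨h1, h5, hder _ _ h4 h5, h2, hγ⟩
  have h1 : A.card ≤ ∑ γ ∈ Finset.univ.erase γ0, (T γ).card :=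
    (Finset.card_le_card hcov).trans Finset.card_biUnion_le
  have h2 : 2 * n * A.card ≤ (n - 1) * ((2 * n + 1) * p) := by
    calc 2 * n * A.card ≤ 2 * n * ∑ γ ∈ Finset.univ.erase γ0, (T γ).card :=
          Nat.mul_le_mul_left _ h1
      _ = ∑ γ ∈ Finset.univ.erase γ0, 2 * n * (T γ).card := by rw [Finset.mul_sum]
      _ ≤ ∑ γ ∈ Finset.univ.erase γ0, (2 * n + 1) * p := Finset.sum_le_sum fun γ _ => hTc γ
      _ = _ := by simp
  rw [hA] at h2
  obtain ⟨k, rfl⟩ : ∃ k, n = k + 1 := ⟨n - 1, by omega⟩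
  simp only [Nat.add_sub_cancel] at h2
  -- 2 n² |F'| ≤ (n - 1) (2 n + 1) p, |F'| ≥ p - 3 c
  have h3 : 2 * (k + 1) * (p * (k + 1)) ≤ 2 * (k + 1) * ((F'.card + 3 * c) * (k + 1)) :=
    Nat.mul_le_mul_left _ (Nat.mul_le_mul_right _ hF')
  have h4 : 6 * (k + 1) * c + 1 ≤ p := by omega
  nlinarith

end AxP

end

section
set_option linter.style.haveILetI false
open Polynomial

namespace AxP

/-- the fixed nonprincipal ultrafilter -/
noncomputable abbrev UF : Ultrafilter ℕ := Filter.hyperfilter ℕ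

section up
variable (W : ℕ → Type) [∀ i, Field (W i)]

/-- null sequences -/
def nullI : Ideal (∀ i, W i) where
  carrier := {x | ∀ᶠ i in (UF : Filter ℕ), x i = 0}
  add_mem' := fun {a b} ha hb => by
    filter_upwards [ha, hb] with i h1 h2
    simp [h1, h2]
  zero_mem' := Filter.Eventually.of_forall fun i => rfl
  smul_mem' := fun c x hx => by
    filter_upwards [hx] with i h
    simp [h]

theorem mem_nullI {x : ∀ i, W i} : x ∈ nullI W ↔ ∀ᶠ i in (UF : Filter ℕ), x i = 0 := Iff.rfl

instance : (nullI W).IsMaximal := by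
  refine Ideal.isMaximal_iff.2 ⟨?_, ?_⟩
  · intro h
    rw [mem_nullI] at h
    obtain ⟨i, hi⟩ := h.exists
    exact one_ne_zero hi
  · intro J x hJ hx hxJ
    classical
    have h1 : ∀ᶠ i in (UF : Filter ℕ), x i ≠ 0 := Ultrafilter.eventually_not.2 hx
    have h2 : 1 - (fun i => (x i)⁻¹) * x ∈ nullI W := by
      rw [mem_nullI]
      filter_upwards [h1] with i hi
      simp [hi]
    have h3 := J.add_mem (hJ h2) (J.mul_mem_left (fun i => (x i)⁻¹) hxJ)
    simpa using h3

/-- the ultraproduct -/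
def UP : Type := (∀ i, W i) ⧸ nullI W

noncomputable instance : Field (UP W) := Ideal.Quotient.field (nullI W)

variable {W}

/-- quotient map -/
noncomputable def qm : (∀ i, W i) →+* UP W := Ideal.Quotient.mk (nullI W)

theorem qm_surj : Function.Surjective (qm (W := W)) := Ideal.Quotient.mk_surjective

theorem qm_zero {x : ∀ i, W i} : qm x = 0 ↔ ∀ᶠ i in (UF : Filter ℕ), x i = 0 :=
  Ideal.Quotient.eq_zero_iff_mem

theorem qm_eq {x y : ∀ i, W i} : qm x = qm y ↔ ∀ᶠ i in (UF : Filter ℕ), x i = y i := by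
  rw [← sub_eq_zero, ← map_sub, qm_zero]
  simp only [Pi.sub_apply, sub_eq_zero]

theorem qm_ne {x y : ∀ i, W i} : qm x ≠ qm y ↔ ∀ᶠ i in (UF : Filter ℕ), x i ≠ y i := by
  rw [Ne, qm_eq, ← Ultrafilter.eventually_not]

theorem qm_ne_zero {x : ∀ i, W i} : qm x ≠ 0 ↔ ∀ᶠ i in (UF : Filter ℕ), x i ≠ 0 := by
  rw [Ne, qm_zero, ← Ultrafilter.eventually_not]

/-- induced map -/
noncomputable def um {W' : ℕ → Type} [∀ i, Field (W' i)] (f : ∀ i, W i →+* W' i) : UP W →+* UP W' :=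
  Ideal.Quotient.lift (nullI W) ((qm (W := W')).comp (RingHom.pi fun i => (f i).comp (Pi.evalRingHom W i)))
    (fun a ha => by
      rw [RingHom.comp_apply, qm_zero]
      filter_upwards [ha] with i hi
      change f i (a i) = 0
      rw [hi, map_zero])

theorem um_qm {W' : ℕ → Type} [∀ i, Field (W' i)] (f : ∀ i, W i →+* W' i) (x : ∀ i, W i) :
    um f (qm x) = qm fun i => f i (x i) := by
  unfold um qm
  exact Ideal.Quotient.lift_mk _ _ _

theorem choose1 {P : ∀ i, W i → Prop} (h : ∀ᶠ i in (UF : Filter ℕ), ∃ x, P i x) :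
    ∃ x : ∀ i, W i, ∀ᶠ i in (UF : Filter ℕ), P i (x i) := by
  classical
  refine ⟨fun i => if hi : ∃ x, P i x then hi.choose else 0, ?_⟩
  filter_upwards [h] with i hi
  rw [dif_pos hi]; exact hi.choose_spec

theorem choose2 {P : ∀ i, W i → W i → Prop} (h : ∀ᶠ i in (UF : Filter ℕ), ∃ x y, P i x y) :
    ∃ x y : ∀ i, W i, ∀ᶠ i in (UF : Filter ℕ), P i (x i) (y i) := by
  obtain ⟨x, hx⟩ := choose1 h
  obtain ⟨y, hy⟩ := choose1 hx
  exact ⟨x, y, hy⟩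

/-- component of a polynomial -/
noncomputable def cp (i : ℕ) (f : (∀ i, W i)[X]) : (W i)[X] := f.map (Pi.evalRingHom W i)
/-- component of a bivariate polynomial -/
noncomputable def cp2 (i : ℕ) (f : (∀ i, W i)[X][X]) : (W i)[X][X] :=
  f.map (mapRingHom (Pi.evalRingHom W i))

theorem eval_cp (i : ℕ) (f : (∀ i, W i)[X]) (x : ∀ i, W i) : (cp i f).eval (x i) = (f.eval x) i := by
  have := eval_map_apply (f := Pi.evalRingHom W i) (p := f) (x := x)
  exact this

theorem eval_qm (f : (∀ i, W i)[X]) (x : ∀ i, W i) : (f.map qm).eval (qm x) = qm (f.eval x) :=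
  eval_map_apply (f := qm) (p := f) (x := x)

theorem map_mapRingHom_evalEval' {R S : Type*} [CommRing R] [CommRing S] (σ : R →+* S) (f : R[X][X])
    (x y : R) : (f.map (mapRingHom σ)).evalEval (σ x) (σ y) = σ (f.evalEval x y) := by
  exact Polynomial.map_mapRingHom_evalEval σ f x y

theorem eval_cp2 (i : ℕ) (f : (∀ i, W i)[X][X]) (x y : ∀ i, W i) :
    (cp2 i f).evalEval (x i) (y i) = (f.evalEval x y) i :=
  map_mapRingHom_evalEval' (Pi.evalRingHom W i) f x y

theorem eval_qm2 (f : (∀ i, W i)[X][X]) (x y : ∀ i, W i) :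
    (f.map (mapRingHom qm)).evalEval (qm x) (qm y) = qm (f.evalEval x y) :=
  map_mapRingHom_evalEval' qm f x y

theorem cp_zero {f : (∀ i, W i)[X]} :
    f.map qm = 0 ↔ ∀ᶠ i in (UF : Filter ℕ), cp i f = 0 := by
  have : (∀ᶠ i in (UF : Filter ℕ), cp i f = 0) ↔
      ∀ᶠ i in (UF : Filter ℕ), ∀ k ∈ f.support, f.coeff k i = 0 := by
    refine Filter.eventually_congr (Filter.Eventually.of_forall fun i => ?_)
    rw [Polynomial.ext_iff]
    refine forall_congr' fun k => ?_
    rw [cp, coeff_map, coeff_zero, mem_support_iff]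
    refine ⟨fun h _ => h, fun h => ?_⟩
    by_cases h0 : f.coeff k = 0
    · simp [h0]
    · exact h h0
  rw [this, Filter.eventually_all_finset, Polynomial.ext_iff]
  refine forall_congr' fun k => ?_
  rw [coeff_map, coeff_zero, qm_zero, mem_support_iff]
  refine ⟨fun h _ => h, fun h => ?_⟩
  by_cases h0 : f.coeff k = 0
  · simp [h0]
  · exact h h0

theorem cp2_zero {f : (∀ i, W i)[X][X]} :
    f.map (mapRingHom qm) = 0 ↔ ∀ᶠ i in (UF : Filter ℕ), cp2 i f = 0 := by
  have : (∀ᶠ i in (UF : Filter ℕ), cp2 i f = 0) ↔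
      ∀ᶠ i in (UF : Filter ℕ), ∀ k ∈ f.support, cp i (f.coeff k) = 0 := by
    refine Filter.eventually_congr (Filter.Eventually.of_forall fun i => ?_)
    rw [Polynomial.ext_iff]
    refine forall_congr' fun k => ?_
    rw [cp2, coeff_map, coeff_zero, mem_support_iff]
    refine ⟨fun h _ => h, fun h => ?_⟩
    by_cases h0 : f.coeff k = 0
    · simp [h0]
    · exact h h0
  rw [this, Filter.eventually_all_finset, Polynomial.ext_iff]
  refine forall_congr' fun k => ?_
  rw [coeff_map, coeff_zero, coe_mapRingHom, cp_zero, mem_support_iff]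
  refine ⟨fun h _ => h, fun h => ?_⟩
  by_cases h0 : f.coeff k = 0
  · simp [h0, cp]
  · exact h h0

theorem cp_ne_zero {f : (∀ i, W i)[X]} (h : f.map qm ≠ 0) : ∀ᶠ i in (UF : Filter ℕ), cp i f ≠ 0 := by
  rw [Ne, cp_zero] at h
  exact Ultrafilter.eventually_not.2 h

theorem lift1 (f : (UP W)[X]) : ∃ F : (∀ i, W i)[X], F.map qm = f := map_surjective _ qm_surj f

theorem lift2 (f : (UP W)[X][X]) : ∃ F : (∀ i, W i)[X][X], F.map (mapRingHom qm) = f :=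
  map_surjective _ (map_surjective _ qm_surj) f

theorem lift_monic1 {f : (UP W)[X]} (hf : f.Monic) :
    ∃ F : (∀ i, W i)[X], F.map qm = f ∧ F.natDegree = f.natDegree ∧ F.Monic :=
  lifts_and_natDegree_eq_and_monic (lift1 f) hf

theorem lift_monic2 {f : (UP W)[X][X]} (hf : f.Monic) :
    ∃ F : (∀ i, W i)[X][X], F.map (mapRingHom qm) = f ∧ F.natDegree = f.natDegree ∧ F.Monic :=
  lifts_and_natDegree_eq_and_monic (lift2 f) hf

instance [∀ i, IsAlgClosed (W i)] : IsAlgClosed (UP W) := by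
  refine IsAlgClosed.of_exists_root _ fun f hf hirr => ?_
  obtain ⟨F, hF, hFd, hFm⟩ := lift_monic1 hf
  have : ∀ i, ∃ x, (cp i F).eval x = 0 := by
    intro i
    apply IsAlgClosed.exists_root
    have h1 : (cp i F).natDegree = f.natDegree := by rw [cp, hFm.natDegree_map, hFd]
    rw [Polynomial.degree_eq_natDegree (p := cp i F) (hFm.map _).ne_zero, h1]
    exact_mod_cast (Irreducible.natDegree_pos hirr).ne'
  choose x hx using this
  refine ⟨qm x, ?_⟩
  rw [← hF, eval_qm, qm_zero]
  exact Filter.Eventually.of_forall fun i => by rw [← eval_cp, hx]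

theorem exists_Bdd {k : Type*} [CommRing k] (f : k[X][X]) : ∃ c, Bdd c f := by
  refine ⟨∑ i ∈ f.support, (f.coeff i).natDegree, fun i => ?_⟩
  by_cases h : i ∈ f.support
  · exact Finset.single_le_sum (f := fun i => (f.coeff i).natDegree) (fun _ _ => Nat.zero_le _) h
  · rw [notMem_support_iff.1 h]; simp

theorem bdd_swap {k : Type*} [CommRing k] {e : ℕ} (f : k[X][X]) :
    Bdd e f ↔ (Bivariate.swap f).natDegree ≤ e := by
  have key : ∀ i j, ((Bivariate.swap f).coeff i).coeff j = (f.coeff j).coeff i := by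
    intro i j
    induction f using Polynomial.induction_on' with
    | add p q hp hq => simp [hp, hq]
    | monomial n a =>
      induction a using Polynomial.induction_on' with
      | add p q hp hq => simp only [map_add, coeff_add, hp, hq]
      | monomial m b =>
        rw [Bivariate.swap_monomial_monomial, coeff_monomial, coeff_monomial]
        split_ifs with h1 h2 h2 <;> simp [coeff_monomial, h1, h2]
  constructor
  · intro h
    rw [natDegree_le_iff_coeff_eq_zero]
    intro N hN
    ext j
    rw [key, coeff_zero]
    exact coeff_eq_zero_of_natDegree_lt (lt_of_le_of_lt (h j) hN)
  · intro h i
    rw [natDegree_le_iff_coeff_eq_zero] at h ⊢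
    intro N hN
    rw [← key, h N hN, coeff_zero]

theorem bdd_factor {k : Type*} [Field k] {e : ℕ} {f h : k[X][X]} (hne : f * h ≠ 0)
    (H : Bdd e (f * h)) : Bdd e f := by
  rw [bdd_swap] at H ⊢
  rw [map_mul, natDegree_mul] at H
  · omega
  · exact fun h' => left_ne_zero_of_mul hne ((map_eq_zero_iff _ (Bivariate.swap (R := k)).injective).1 h')
  · exact fun h' => right_ne_zero_of_mul hne ((map_eq_zero_iff _ (Bivariate.swap (R := k)).injective).1 h')

/-- bivariate polynomial with given coefficients -/
noncomputable def polR {R : Type*} [CommRing R] (n e : ℕ) (v : Fin n × Fin e → R) : R[X][X] :=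
  ∑ x, monomial (x.1 : ℕ) (monomial (x.2 : ℕ) (v x))

theorem irr_transfer {G : (∀ i, W i)[X][X]} (hG : G.Monic)
    (hirr : Irreducible (G.map (mapRingHom (qm (W := W))))) :
    ∀ᶠ i in (UF : Filter ℕ), Irreducible (cp2 i G) := by
  by_contra hcon
  rw [← Ultrafilter.eventually_not] at hcon
  obtain ⟨c, hc⟩ := exists_Bdd G
  have hGi : ∀ i, (cp2 i G).Monic := fun i => hG.map _
  have hdeg : ∀ i, (cp2 i G).natDegree = G.natDegree := fun i => hG.natDegree_map _
  have hGm := hG.map (mapRingHom (qm (W := W)))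
  have hGd : (G.map (mapRingHom (qm (W := W)))).natDegree = G.natDegree := hG.natDegree_map _
  have hpos : 0 < G.natDegree := by
    rw [← hGd]
    rcases Nat.eq_zero_or_pos (G.map (mapRingHom (qm (W := W)))).natDegree with h | h
    · exact absurd (by rw [hGm.natDegree_eq_zero.1 h]; exact isUnit_one) hirr.not_isUnit
    · exact h
  set n := G.natDegree with hn
  have h1 : ∀ᶠ i in (UF : Filter ℕ), ∃ r : Fin n, 0 < (r : ℕ) ∧ ∃ v v' : Fin (n + 1) × Fin (c + 1) → W i,
      (pol (n + 1) (c + 1) v).coeff r = 1 ∧ (∀ k, (r : ℕ) < k → (pol (n + 1) (c + 1) v).coeff k = 0) ∧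
      pol (n + 1) (c + 1) v * pol (n + 1) (c + 1) v' = cp2 i G := by
    filter_upwards [hcon] with i hi
    rw [(hGi i).irreducible_iff_natDegree'] at hi
    push Not at hi
    obtain ⟨f, h, hf, hh, hfh, hmem⟩ := hi (by
      intro h1
      have := hdeg i
      rw [h1, natDegree_one] at this
      omega)
    rw [Finset.mem_Ioc, hdeg] at hmem
    have hdd := hf.natDegree_mul hh
    rw [hfh, hdeg] at hdd
    have hb : Bdd c (f * h) := by rw [hfh]; exact hc.map _
    have hne : f * h ≠ 0 := by rw [hfh]; exact (hGi i).ne_zero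
    have hrep : ∀ f : (W i)[X][X], f.natDegree < n + 1 → Bdd c f →
        pol (n + 1) (c + 1) (cof (n + 1) (c + 1) f) = f := by
      intro f hf hbf
      rw [← sub_eq_zero]
      refine cof_eq_zero (n := n + 1) (e := c + 1) ?_ ?_ (by rw [map_sub, cof_pol, sub_self])
      · exact lt_of_le_of_lt (natDegree_sub_le _ _) (max_lt (natDegree_pol (by omega) _) hf)
      · intro j
        exact Nat.lt_succ_of_le (((bdd_pol _).sub hbf) j)
    refine ⟨⟨f.natDegree, by omega⟩, ?_, cof _ _ f, cof _ _ h, ?_⟩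
    · simp only; omega
    rw [hrep f (by omega) (bdd_factor hne hb),
      hrep h (by omega) (bdd_factor (f := h) (h := f) (by rwa [mul_comm]) (by rwa [mul_comm]))]
    exact ⟨hf, fun k hk => coeff_eq_zero_of_natDegree_lt hk, hfh⟩
  obtain ⟨r, hr⟩ := Ultrafilter.eventually_exists_iff.1 h1
  have hr0 : 0 < (r : ℕ) := hr.exists.choose_spec.1
  have h2 : ∀ᶠ i in (UF : Filter ℕ), ∃ v v' : Fin (n + 1) × Fin (c + 1) → W i,
      (pol (n + 1) (c + 1) v).coeff r = 1 ∧ (∀ k, (r : ℕ) < k → (pol (n + 1) (c + 1) v).coeff k = 0) ∧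
      pol (n + 1) (c + 1) v * pol (n + 1) (c + 1) v' = cp2 i G := hr.mono fun i hi => hi.2
  classical
  let v : Fin (n + 1) × Fin (c + 1) → ∀ i, W i := fun x i =>
    if hi : ∃ v v' : Fin (n + 1) × Fin (c + 1) → W i,
      (pol (n + 1) (c + 1) v).coeff r = 1 ∧ (∀ k, (r : ℕ) < k → (pol (n + 1) (c + 1) v).coeff k = 0) ∧
      pol (n + 1) (c + 1) v * pol (n + 1) (c + 1) v' = cp2 i G then hi.choose x else 0
  let v' : Fin (n + 1) × Fin (c + 1) → ∀ i, W i := fun x i =>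
    if hi : ∃ v v' : Fin (n + 1) × Fin (c + 1) → W i,
      (pol (n + 1) (c + 1) v).coeff r = 1 ∧ (∀ k, (r : ℕ) < k → (pol (n + 1) (c + 1) v).coeff k = 0) ∧
      pol (n + 1) (c + 1) v * pol (n + 1) (c + 1) v' = cp2 i G then hi.choose_spec.choose x else 0
  have hcpol : ∀ i (w : Fin (n + 1) × Fin (c + 1) → ∀ i, W i),
      cp2 i (polR (n + 1) (c + 1) w) = pol (n + 1) (c + 1) (fun x => w x i) := by
    intro i w
    simp only [cp2, pol, polR, LinearMap.coe_mk, AddHom.coe_mk, Polynomial.map_sum, map_monomial,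
      coe_mapRingHom]
    rfl
  have hv : ∀ᶠ i in (UF : Filter ℕ), (cp2 i (polR (n + 1) (c + 1) v)).coeff r = 1 ∧
      (∀ k, (r : ℕ) < k → (cp2 i (polR (n + 1) (c + 1) v)).coeff k = 0) ∧
      cp2 i (polR (n + 1) (c + 1) v) * cp2 i (polR (n + 1) (c + 1) v') = cp2 i G := by
    filter_upwards [h2] with i hi
    rw [hcpol, hcpol]
    have e1 : (fun x => v x i) = hi.choose := by funext x; simp only [v, dif_pos hi]
    have e2 : (fun x => v' x i) = hi.choose_spec.choose := by funext x; simp only [v', dif_pos hi]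
    rw [e1, e2]
    exact hi.choose_spec.choose_spec
  have hprod : (polR (n + 1) (c + 1) v).map (mapRingHom (qm (W := W))) *
      (polR (n + 1) (c + 1) v').map (mapRingHom (qm (W := W))) = G.map (mapRingHom qm) := by
    rw [← sub_eq_zero, ← Polynomial.map_mul, ← Polynomial.map_sub, cp2_zero]
    filter_upwards [hv] with i hi
    rw [cp2, Polynomial.map_sub, Polynomial.map_mul, sub_eq_zero]
    exact hi.2.2
  have hc1 : ((polR (n + 1) (c + 1) v).map (mapRingHom (qm (W := W)))).coeff r = 1 := by
    rw [← sub_eq_zero, coeff_map, coe_mapRingHom]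
    have : (((polR (n + 1) (c + 1) v).coeff r - 1).map (qm (W := W))) = 0 := by
      rw [cp_zero]
      filter_upwards [hv] with i hi
      rw [cp, Polynomial.map_sub, Polynomial.map_one, sub_eq_zero, ← hi.1, cp2, coeff_map,
        coe_mapRingHom]
    simpa using this
  have hc2 : ∀ k, (r : ℕ) < k → ((polR (n + 1) (c + 1) v).map (mapRingHom (qm (W := W)))).coeff k = 0 := by
    intro k hk
    rw [coeff_map, coe_mapRingHom, cp_zero]
    filter_upwards [hv] with i hi
    rw [← hi.2.1 k hk, cp2, coeff_map, coe_mapRingHom, cp]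
  have hnd : ((polR (n + 1) (c + 1) v).map (mapRingHom (qm (W := W)))).natDegree = r := by
    refine le_antisymm ?_ (le_natDegree_of_ne_zero (by rw [hc1]; exact one_ne_zero))
    rw [natDegree_le_iff_coeff_eq_zero]; exact hc2
  have hmon : ((polR (n + 1) (c + 1) v).map (mapRingHom (qm (W := W)))).Monic := by
    rw [Monic, leadingCoeff, hnd, hc1]
  have hmon' : ((polR (n + 1) (c + 1) v').map (mapRingHom (qm (W := W)))).Monic :=
    hmon.of_mul_monic_left (by rw [hprod]; exact hGm)
  have hsum := hmon.natDegree_mul hmon'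
  rw [hprod, hGd, hnd] at hsum
  rcases hirr.isUnit_or_isUnit hprod.symm with h | h
  · rw [hmon.isUnit_iff] at h
    rw [h, natDegree_one] at hnd
    omega
  · rw [hmon'.isUnit_iff] at h
    rw [h, natDegree_one] at hsum
    have := r.2
    omega

end up
end AxP

end

section
set_option linter.style.haveILetI false
open Polynomial

namespace AxP

theorem bezout {k : Type*} [Field k] [CharZero k] {g : k[X][X]} (hg : g.Monic) (hn : 0 < g.natDegree)
    (hirr : Irreducible g) : ∃ u v : k[X][X], ∃ Δ : k[X], Δ ≠ 0 ∧ g * u + derivative g * v = C Δ := by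
  let K := FractionRing k[X]
  have hirr' : Irreducible (g.map (algebraMap k[X] K)) :=
    (hg.irreducible_iff_irreducible_map_fraction_map).1 hirr
  haveI : CharZero K := charZero_of_injective_ringHom
    (f := (algebraMap k[X] K).comp (C : k →+* k[X]))
    ((IsFractionRing.injective k[X] K).comp C_injective)
  obtain ⟨a, b, hab⟩ := hirr'.separable
  let M := nonZeroDivisors k[X]
  obtain ⟨⟨β, hβ⟩, hβ2⟩ := IsLocalization.integerNormalization_map_to_map M a
  obtain ⟨⟨β', hβ'⟩, hβ2'⟩ := IsLocalization.integerNormalization_map_to_map M b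
  refine ⟨C β' * IsLocalization.integerNormalization M a, C β * IsLocalization.integerNormalization M b,
    β * β', mul_ne_zero (nonZeroDivisors.ne_zero hβ) (nonZeroDivisors.ne_zero hβ'), ?_⟩
  apply Polynomial.map_injective _ (IsFractionRing.injective k[X] K)
  rw [Polynomial.map_add, Polynomial.map_mul, Polynomial.map_mul, Polynomial.map_mul,
    Polynomial.map_mul, hβ2, hβ2', ← derivative_map, map_C, map_C, map_C]
  have e1 : ∀ (z : k[X]) (f : K[X]), z • f = C (algebraMap k[X] K z) * f := by
    intro z f
    rw [← smul_eq_C_mul, algebraMap_smul]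
  rw [e1, e1, map_mul, C_mul]
  linear_combination C (algebraMap k[X] K β) * C (algebraMap k[X] K β') * hab

section
variable {W : ℕ → Type} [∀ i, Field (W i)] (p : ℕ → ℕ)
  [∀ i, Fact (p i).Prime] [∀ i, CharP (W i) (p i)]

theorem charZero_up (hp : ∀ B, ∀ᶠ i in (UF : Filter ℕ), B ≤ p i) : CharZero (UP W) := by
  refine charZero_of_inj_zero fun n hn => ?_
  by_contra h0
  have : qm (W := W) (n : ∀ i, W i) = 0 := by rw [map_natCast]; exact hn
  rw [qm_zero] at this
  obtain ⟨i, hi, hi'⟩ := (this.and (hp (n + 1))).exists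
  rw [Pi.natCast_apply, CharP.cast_eq_zero_iff (W i) (p i)] at hi
  have := Nat.le_of_dvd (Nat.pos_of_ne_zero h0) hi
  omega

/-- the limit Frobenius -/
noncomputable def Fr (W : ℕ → Type) [∀ i, Field (W i)] (p : ℕ → ℕ)
  [∀ i, Fact (p i).Prime] [∀ i, CharP (W i) (p i)] : UP W →+* UP W := um fun i => frobenius (W i) (p i)

theorem Fr_qm (x : ∀ i, W i) : Fr W p (qm x) = qm fun i => x i ^ p i := um_qm _ _

variable [∀ i, IsAlgClosed (W i)]

theorem ax (hp : ∀ B, ∀ᶠ i in (UF : Filter ℕ), B ≤ p i) {n : ℕ} {g : (UP W)[X][X]} (hg : g.Monic)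
    (hgn : g.natDegree = n) (hn : 0 < n) (hirr : Irreducible g) (s : Fin n → (UP W)[X][X])
    {d e : (UP W)[X]} (hd : d ≠ 0) (he : e ≠ 0)
    (H : ∀ x0 y0, Fr W p x0 = x0 → d.eval x0 ≠ 0 → g.evalEval x0 y0 = 0 →
      ∃ γ, d.eval x0 * Fr W p y0 = (s γ).evalEval x0 y0) (γ : Fin n) :
    ∃ x0 y0, Fr W p x0 = x0 ∧ e.eval x0 ≠ 0 ∧ d.eval x0 ≠ 0 ∧ g.evalEval x0 y0 = 0 ∧
      d.eval x0 * Fr W p y0 = (s γ).evalEval x0 y0 := by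
  haveI := charZero_up p hp (W := W)
  obtain ⟨u, v, Δ, hΔ, hb⟩ := bezout hg (hgn ▸ hn) hirr
  obtain ⟨G, hG, hGn, hGm⟩ := lift_monic2 hg
  choose S hS using fun γ => lift2 (s γ)
  obtain ⟨D, hD⟩ := lift1 d
  obtain ⟨E, hE⟩ := lift1 e
  obtain ⟨Δ', hΔ'⟩ := lift1 Δ
  obtain ⟨u', hu⟩ := lift2 u
  obtain ⟨v', hv⟩ := lift2 v
  obtain ⟨cG, hcG⟩ := exists_Bdd G
  choose cS hcS using fun γ => exists_Bdd (S γ)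
  let c := cG + (∑ γ, (cS γ + (S γ).natDegree)) + D.natDegree + E.natDegree + Δ'.natDegree
  obtain ⟨p0, hp0⟩ := fl n c hn
  have hcSc : ∀ γ, cS γ + (S γ).natDegree ≤ c := by
    intro γ
    have := Finset.single_le_sum (f := fun γ => cS γ + (S γ).natDegree) (fun _ _ => Nat.zero_le _)
      (Finset.mem_univ γ)
    simp only [c]; omega
  have hH : ∀ᶠ i in (UF : Filter ℕ), ∀ x0 y0 : W i, x0 ^ p i = x0 → (cp i D).eval x0 ≠ 0 →
      (cp2 i G).evalEval x0 y0 = 0 →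
      ∃ γ, (cp i D).eval x0 * y0 ^ p i = (cp2 i (S γ)).evalEval x0 y0 := by
    by_contra hcon
    rw [← Ultrafilter.eventually_not] at hcon
    push Not at hcon
    obtain ⟨x, y, hxy⟩ := choose2 hcon
    obtain ⟨γ, hγ⟩ := H (qm x) (qm y) (by
        rw [Fr_qm, qm_eq]; exact hxy.mono fun i hi => hi.1) (by
        rw [← hD, eval_qm, qm_ne_zero]
        exact hxy.mono fun i hi => by rw [← eval_cp]; exact hi.2.1) (by
        rw [← hG, eval_qm2, qm_zero]
        exact hxy.mono fun i hi => by rw [← eval_cp2]; exact hi.2.2.1)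
    rw [← hD, ← hS, eval_qm, eval_qm2, Fr_qm, ← map_mul, qm_eq] at hγ
    obtain ⟨i, h1, h2⟩ := (hγ.and hxy).exists
    refine h2.2.2.2 γ ?_
    rw [eval_cp, eval_cp2, ← h1]; rfl
  have hBz : ∀ᶠ i in (UF : Filter ℕ),
      cp2 i G * cp2 i u' + derivative (cp2 i G) * cp2 i v' = C (cp i Δ') := by
    have : (G * u' + derivative G * v' - C Δ').map (mapRingHom (qm (W := W))) = 0 := by
      rw [Polynomial.map_sub, Polynomial.map_add, Polynomial.map_mul, Polynomial.map_mul,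
        ← derivative_map, hG, hu, hv, map_C, coe_mapRingHom, hΔ', hb, sub_self]
    rw [cp2_zero] at this
    filter_upwards [this] with i hi
    rw [cp2, Polynomial.map_sub, Polynomial.map_add, Polynomial.map_mul, Polynomial.map_mul,
      ← derivative_map, map_C, sub_eq_zero] at hi
    exact hi
  have hfin : ∀ᶠ i in (UF : Filter ℕ), ∃ x0 y0 : W i, x0 ^ p i = x0 ∧ (cp i E).eval x0 ≠ 0 ∧
      (cp i D).eval x0 ≠ 0 ∧ (cp2 i G).evalEval x0 y0 = 0 ∧
      (cp i D).eval x0 * y0 ^ p i = (cp2 i (S γ)).evalEval x0 y0 := by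
    filter_upwards [hH, hBz, hp p0, irr_transfer hGm (hG.symm ▸ hirr), cp_ne_zero (hD.symm ▸ hd),
      cp_ne_zero (hE.symm ▸ he), cp_ne_zero (hΔ'.symm ▸ hΔ)] with i h1 h2 h3 h4 h5 h6 h7
    refine hp0 (W i) (p i) h3 (cp2 i G) (hGm.map _) ?_ ?_ h4 (fun γ => cp2 i (S γ)) ?_ (cp i D) ?_ h5
      (cp i E) ?_ h6 (cp i Δ') ?_ h7 _ _ h2 h1 γ
    · rw [cp2, hGm.natDegree_map, hGn, hgn]
    · exact (hcG.map _).mono (by simp only [c]; omega)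
    · intro γ
      have := hcSc γ
      exact ⟨natDegree_map_le.trans (by omega), ((hcS γ).map _).mono (by omega)⟩
    · exact natDegree_map_le.trans (by simp only [c]; omega)
    · exact natDegree_map_le.trans (by simp only [c]; omega)
    · exact natDegree_map_le.trans (by simp only [c]; omega)
  obtain ⟨x, y, hxy⟩ := choose2 hfin
  refine ⟨qm x, qm y, ?_, ?_, ?_, ?_, ?_⟩
  · rw [Fr_qm, qm_eq]; exact hxy.mono fun i hi => hi.1
  · rw [← hE, eval_qm, qm_ne_zero]
    exact hxy.mono fun i hi => by rw [← eval_cp]; exact hi.2.1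
  · rw [← hD, eval_qm, qm_ne_zero]
    exact hxy.mono fun i hi => by rw [← eval_cp]; exact hi.2.2.1
  · rw [← hG, eval_qm2, qm_zero]
    exact hxy.mono fun i hi => by rw [← eval_cp2]; exact hi.2.2.2.1
  · rw [← hD, ← hS, eval_qm, eval_qm2, Fr_qm, ← map_mul, qm_eq]
    exact hxy.mono fun i hi => by
      have := hi.2.2.2.2
      rw [eval_cp, eval_cp2] at this
      exact this

end
end AxP

end

section
set_option linter.style.haveILetI false
open Polynomial

namespace AxP

section pi
variable {Ω₁ Ω₂ : Type} [Field Ω₁] [Field Ω₂]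

/-- partial isomorphisms -/
structure PI (φ : Ω₁ →+* Ω₁) (φ' : Ω₂ →+* Ω₂) (C : Type) [Field C] where
  i1 : C →+* Ω₁
  i2 : C →+* Ω₂
  t1 : C →+* C
  t2 : C →+* C
  h1 : ∀ x, φ (i1 x) = i1 (t1 x)
  h2 : ∀ x, φ' (i2 x) = i2 (t2 x)
  fin1 : ∀ x, ∃ N, 0 < N ∧ (t1 ^ N) x = x
  fin2 : ∀ x, ∃ N, 0 < N ∧ (t2 ^ N) x = x
  fix : ∀ x, t1 x = x ↔ t2 x = x

/-- symmetry -/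
def PI.symm {φ : Ω₁ →+* Ω₁} {φ' : Ω₂ →+* Ω₂} {C : Type} [Field C] (I : PI φ φ' C) : PI φ' φ C where
  i1 := I.i2
  i2 := I.i1
  t1 := I.t2
  t2 := I.t1
  h1 := I.h2
  h2 := I.h1
  fin1 := I.fin2
  fin2 := I.fin1
  fix := fun x => (I.fix x).symm

end pi

section ga
variable {C : Type} [Field C]

theorem pow_mul_fix (t : C →+* C) {N : ℕ} {x : C} (h : (t ^ N) x = x) (m : ℕ) :
    (t ^ (N * m)) x = x := by
  induction m with
  | zero => simp
  | succ m ih => rw [Nat.mul_succ, pow_add, RingHom.mul_def, RingHom.comp_apply, h, ih]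

theorem pow_mod_fix (t : C →+* C) {N : ℕ} {x : C} (h : (t ^ N) x = x) (m : ℕ) :
    (t ^ (m % N)) x = (t ^ m) x := by
  conv_rhs => rw [← Nat.mod_add_div m N]
  rw [pow_add, RingHom.mul_def, RingHom.comp_apply, pow_mul_fix t h]

theorem common_period (t : C →+* C) (fin : ∀ x, ∃ N, 0 < N ∧ (t ^ N) x = x) (S : Finset C) :
    ∃ N, 0 < N ∧ ∀ x ∈ S, (t ^ N) x = x := by
  classical
  induction S using Finset.induction_on with
  | empty => exact ⟨1, one_pos, by simp⟩
  | insert a S ha ih =>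
    obtain ⟨N, hN, h⟩ := ih
    obtain ⟨M, hM, h'⟩ := fin a
    refine ⟨N * M, by positivity, fun x hx => ?_⟩
    rcases Finset.mem_insert.1 hx with rfl | hx
    · rw [mul_comm]; exact pow_mul_fix t h' _
    · exact pow_mul_fix t (h x hx) _

theorem iter_fix {t : C →+* C} {c : C} (h : t c = c) (i : ℕ) : (t ^ i) c = c := by
  induction i with
  | zero => rfl
  | succ i ih => rw [pow_succ, RingHom.mul_def, RingHom.comp_apply, h, ih]

/-- the fixed field -/
abbrev fixF (t : C →+* C) : Subfield C := RingHom.eqLocusField t (RingHom.id C)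

theorem mem_fixF {t : C →+* C} {x : C} : x ∈ fixF t ↔ t x = x := Iff.rfl

theorem fixF_alg (t : C →+* C) (fin : ∀ x, ∃ N, 0 < N ∧ (t ^ N) x = x) :
    Algebra.IsAlgebraic (fixF t) C := by
  constructor
  intro z
  obtain ⟨r, hr, hz⟩ := fin z
  set P : C[X] := ∏ j ∈ Finset.range r, (X - Polynomial.C ((t ^ j) z)) with hP
  have hmap : P.map t = P := by
    obtain ⟨m, rfl⟩ : ∃ m', r = m' + 1 := ⟨r - 1, by omega⟩
    have h1 : ∀ j, Polynomial.map t (X - Polynomial.C ((t ^ j) z)) =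
        X - Polynomial.C ((t ^ (j + 1)) z) := by
      intro j
      rw [Polynomial.map_sub, map_X, map_C, pow_succ']
      rfl
    rw [hP, Polynomial.map_prod, Finset.prod_range_succ,
      Finset.prod_range_succ' (fun j => X - Polynomial.C ((t ^ j) z))]
    simp only [h1]
    rw [hz]; simp
  have hl : P ∈ Polynomial.lifts (fixF t).subtype := by
    rw [Polynomial.lifts_iff_coeff_lifts]
    intro k
    refine ⟨⟨P.coeff k, ?_⟩, rfl⟩
    rw [mem_fixF, ← coeff_map, hmap]
  obtain ⟨Q, hQ⟩ := hl
  have hQ : Q.map (fixF t).subtype = P := hQ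
  refine ⟨Q, ?_, ?_⟩
  · rintro rfl
    rw [Polynomial.map_zero] at hQ
    have : P.Monic := monic_prod_of_monic _ _ fun j _ => monic_X_sub_C _
    exact this.ne_zero hQ.symm
  · change aeval z Q = 0
    rw [aeval_def, ← eval_map]
    change (Q.map (fixF t).subtype).eval z = 0
    rw [hQ, hP, eval_prod]
    exact Finset.prod_eq_zero (Finset.mem_range.2 hr) (by simp)

theorem coprime_lift {i r : ℕ} (h : i.Coprime r) (hr : 0 < r) {N : ℕ} (hN : 0 < N) :
    ∃ i', i' % r = i % r ∧ i'.Coprime N := by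
  haveI : NeZero r := ⟨hr.ne'⟩
  haveI : NeZero (r * N) := ⟨by positivity⟩
  obtain ⟨u, hu⟩ := ZMod.unitsMap_surjective (Dvd.intro N rfl : r ∣ r * N) (ZMod.unitOfCoprime i h)
  refine ⟨(u : ZMod (r * N)).val, ?_, ?_⟩
  · have := congrArg Units.val hu
    rw [ZMod.unitsMap_val, ZMod.coe_unitOfCoprime] at this
    rw [← ZMod.natCast_eq_natCast_iff', ← this, ZMod.cast_eq_val]
  · have := ZMod.val_coe_unit_coprime u
    exact Nat.Coprime.coprime_mul_left_right this

theorem ga [IsAlgClosed C] [CharZero C] (t t' : C →+* C) (fix : ∀ x, t x = x ↔ t' x = x)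
    (fin : ∀ x, ∃ N, 0 < N ∧ (t ^ N) x = x) (Z : Finset C) {N : ℕ} (hN : 0 < N) :
    ∃ i, i.Coprime N ∧ ∀ z ∈ Z, t' z = (t ^ i) z := by
  classical
  haveI := fixF_alg t fin
  let k := fixF t
  let T : C →ₐ[k] C := { t with commutes' := fun x => x.2 }
  let T' : C →ₐ[k] C := { t' with commutes' := fun x => (fix _).1 x.2 }
  haveI : IsAlgClosure k C := ⟨inferInstance, inferInstance⟩
  haveI : Normal k C := IsAlgClosure.normal k C
  let L := IntermediateField.adjoin k (Z : Set C)
  haveI : FiniteDimensional k L := IntermediateField.finiteDimensional_adjoin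
    fun x _ => (Algebra.IsAlgebraic.isAlgebraic (R := k) x).isIntegral
  let M := IntermediateField.normalClosure k L C
  haveI : FiniteDimensional k M := inferInstance
  haveI : Normal k M := inferInstance
  haveI : IsGalois k M := { }
  have hLM : L ≤ M := by
    have := IntermediateField.le_normalClosure L
    exact this
  let σ : M ≃ₐ[k] M := T.restrictNormal' M
  let σ' : M ≃ₐ[k] M := T'.restrictNormal' M
  have hσ : ∀ x : M, ((σ x : M) : C) = t x := fun x => AlgHom.restrictNormal_commutes T M x
  have hσ' : ∀ x : M, ((σ' x : M) : C) = t' x := fun x => AlgHom.restrictNormal_commutes T' M x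
  have gen : ∀ ρ : M ≃ₐ[k] M, (∀ x : M, ρ x = x → t (x : C) = x) → Subgroup.zpowers ρ = ⊤ := by
    intro ρ hρ
    rw [← IntermediateField.fixingSubgroup_fixedField (Subgroup.zpowers ρ)]
    have : IntermediateField.fixedField (Subgroup.zpowers ρ) = (⊥ : IntermediateField k M) := by
      rw [eq_bot_iff]
      intro x hx
      rw [IntermediateField.mem_fixedField_iff] at hx
      have h1 := hρ x (hx ρ (Subgroup.mem_zpowers ρ))
      rw [IntermediateField.mem_bot]
      exact ⟨⟨x, h1⟩, Subtype.ext rfl⟩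
    rw [this, IntermediateField.fixingSubgroup_bot]
  have g1 : Subgroup.zpowers σ = ⊤ := gen σ fun x hx => by rw [← hσ, hx]
  have g2 : Subgroup.zpowers σ' = ⊤ := gen σ' fun x hx => by rw [fix, ← hσ', hx]
  have hm : σ' ∈ Submonoid.powers σ := by
    rw [mem_powers_iff_mem_zpowers, g1]; trivial
  obtain ⟨i, hi⟩ := hm
  have hi : σ ^ i = σ' := hi
  have hord : orderOf σ = orderOf σ' := by
    rw [← Nat.card_zpowers, ← Nat.card_zpowers, g1, g2]
  have hpos : 0 < orderOf σ := orderOf_pos σ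
  have hcop : i.Coprime (orderOf σ) := by
    rw [← hi, orderOf_pow] at hord
    have h1 := Nat.gcd_dvd_left (orderOf σ) i
    have h2 : (orderOf σ).gcd i = 1 := by
      by_contra h
      have h3 : 1 < (orderOf σ).gcd i := by
        have : 0 < (orderOf σ).gcd i := Nat.gcd_pos_of_pos_left _ hpos
        omega
      have := Nat.div_lt_self hpos h3
      omega
    rw [Nat.coprime_comm]; exact h2
  obtain ⟨i', hi', hc⟩ := coprime_lift hcop hpos hN
  refine ⟨i', hc, fun z hz => ?_⟩
  have hz' : z ∈ M := hLM (IntermediateField.subset_adjoin _ _ hz)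
  have e1 : σ ^ i' = σ' := by rw [← hi, ← pow_mod_orderOf, hi', pow_mod_orderOf]
  have e2 : ∀ (j : ℕ) (x : M), (((σ ^ j) x : M) : C) = (t ^ j) x := by
    intro j
    induction j with
    | zero => intro x; rfl
    | succ j ih => intro x; rw [pow_succ, pow_succ, AlgEquiv.mul_apply, ih, hσ]; rfl
  rw [← hσ' ⟨z, hz'⟩, ← e1, e2]

end ga
end AxP

end

section
set_option linter.style.haveILetI false
set_option linter.unusedSectionVars false
open Polynomial

namespace AxP

section ev
variable {C : Type} [Field C] {O : Type} [Field O]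

/-- evaluation at a point -/
noncomputable def evl (ι : C →+* O) (x y : O) : C[X][X] →+* O :=
  eval₂RingHom (eval₂RingHom ι x) y

theorem evl_apply (ι : C →+* O) (x y : O) (h : C[X][X]) :
    evl ι x y h = h.eval₂ (eval₂RingHom ι x) y := rfl

theorem evl_eq (ι : C →+* O) (x y : O) (h : C[X][X]) :
    evl ι x y h = (h.map (mapRingHom ι)).evalEval x y := by
  induction h using Polynomial.induction_on' with
  | add p q hp hq => rw [map_add, hp, hq, Polynomial.map_add, evalEval_add]
  | monomial n c =>
    rw [evl_apply, eval₂_monomial, map_monomial, ← C_mul_X_pow_eq_monomial, evalEval_mul,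
      evalEval_C, evalEval_pow, evalEval_X, coe_mapRingHom, eval_map]
    rfl

theorem evl_nat {φ : O →+* O} {t : C →+* C} {ι : C →+* O} (hι : ∀ x, φ (ι x) = ι (t x))
    (x y : O) (h : C[X][X]) :
    φ (evl ι x y h) = evl ι (φ x) (φ y) (h.map (mapRingHom t)) := by
  rw [evl_apply, evl_apply, hom_eval₂, eval₂_map]
  congr 1
  refine Polynomial.ringHom_ext (fun c => ?_) ?_
  · simp [hι]
  · simp

theorem pow_nat {φ : O →+* O} {t : C →+* C} {ι : C →+* O} (hι : ∀ x, φ (ι x) = ι (t x)) (i : ℕ) :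
    ∀ x, (φ ^ i) (ι x) = ι ((t ^ i) x) := by
  induction i with
  | zero => intro x; rfl
  | succ i ih =>
    intro x
    rw [pow_succ, pow_succ]
    change (φ ^ i) (φ (ι x)) = ι ((t ^ i) (t x))
    rw [hι, ih]

end ev

section ext1
variable {C : Type} [Field C] [IsAlgClosed C] [CharZero C] {O : Type} [Field O] [IsAlgClosed O]

theorem period_map (t : C →+* C) (fin : ∀ x, ∃ N, 0 < N ∧ (t ^ N) x = x) (P : C[X][X]) :
    ∃ N, 0 < N ∧ P.map (mapRingHom (t ^ N)) = P := by
  classical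
  obtain ⟨N, hN, h⟩ := common_period t fin
    (P.support.biUnion fun k => (P.coeff k).support.image fun l => (P.coeff k).coeff l)
  refine ⟨N, hN, ?_⟩
  ext k l
  rw [coeff_map, coe_mapRingHom, coeff_map]
  by_cases hk : P.coeff k = 0
  · simp [hk]
  by_cases hl : (P.coeff k).coeff l = 0
  · simp [hl]
  exact h _ (Finset.mem_biUnion.2 ⟨k, mem_support_iff.2 hk,
    Finset.mem_image.2 ⟨l, mem_support_iff.2 hl, rfl⟩⟩)

theorem map_pow_add (t : C →+* C) (i j : ℕ) (P : C[X][X]) :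
    P.map (mapRingHom (t ^ (i + j))) = (P.map (mapRingHom (t ^ j))).map (mapRingHom (t ^ i)) := by
  rw [Polynomial.map_map, mapRingHom_comp, pow_add]; rfl

/-- a `t`-invariant multiple -/
theorem inv_mult (t : C →+* C) (fin : ∀ x, ∃ N, 0 < N ∧ (t ^ N) x = x) (P : C[X][X])
    (hP : P ≠ 0) : ∃ Q : C[X][X], Q ≠ 0 ∧ P ∣ Q ∧ Q.map (mapRingHom t) = Q := by
  obtain ⟨N, hN, h⟩ := period_map t fin P
  obtain ⟨m, rfl⟩ : ∃ m', N = m' + 1 := ⟨N - 1, by omega⟩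
  refine ⟨∏ j ∈ Finset.range (m + 1), P.map (mapRingHom (t ^ j)), ?_, ?_, ?_⟩
  · rw [Finset.prod_ne_zero_iff]
    intro j _
    rw [Ne, Polynomial.map_eq_zero_iff (map_injective _ (t ^ j).injective)]
    exact hP
  · have := Finset.dvd_prod_of_mem (fun j : ℕ => P.map (mapRingHom (t ^ j))) (Finset.mem_range.2 hN)
    refine dvd_trans ?_ this
    have e : P.map (mapRingHom (t ^ 0)) = P := by
      rw [pow_zero]; ext; simp [RingHom.one_def]
    rw [e]
  · have h1 : ∀ j, Polynomial.map (mapRingHom t) (P.map (mapRingHom (t ^ j))) =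
        P.map (mapRingHom (t ^ (j + 1))) := by
      intro j
      rw [add_comm, map_pow_add, pow_one]
    rw [Polynomial.map_prod, Finset.prod_range_succ,
      Finset.prod_range_succ' (fun j => P.map (mapRingHom (t ^ j)))]
    simp only [h1]
    rw [h]
    congr 1
    rw [pow_zero]; ext; simp [RingHom.one_def]

/-- algebraic over `C(a)` -/
def AlgOver (ι : C →+* O) (a x : O) : Prop := ∃ P : C[X][X], P ≠ 0 ∧ evl ι a x P = 0

theorem ext1 (φ : O →+* O) (t : C →+* C) (ι : C →+* O) (hι : ∀ x, φ (ι x) = ι (t x))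
    (fin : ∀ x, ∃ N, 0 < N ∧ (t ^ N) x = x) (a : O) (ha : φ a = a)
    (hinj : Function.Injective (eval₂RingHom ι a)) (S : Finset O)
    (hS : ∀ x ∈ S, AlgOver ι a x) :
    ∃ (y : O) (g : C[X][X]) (M : Subfield O), g.Monic ∧ Irreducible g ∧
      (∀ h, evl ι a y h = 0 → g ∣ h) ∧ evl ι a y g = 0 ∧ (∀ x ∈ S, x ∈ M) ∧ (∀ x ∈ M, φ x ∈ M) ∧
      y ∈ M ∧ (∀ x ∈ M, ∃ e : C[X], e ≠ 0 ∧ ∃ n, x * e.eval₂ ι a = evl ι a y n) ∧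
      (∀ v, evl ι a v g = 0 → v ∈ M) := by
  classical
  letI : Algebra C[X] O := (eval₂RingHom ι a).toAlgebra
  have halg : ∀ p : C[X], algebraMap C[X] O p = p.eval₂ ι a := fun p => rfl
  have hev : ∀ v h, evl ι a v h = aeval v h := fun v h => rfl
  haveI : FaithfulSMul C[X] O := (faithfulSMul_iff_algebraMap_injective _ _).2 hinj
  let F := FractionRing C[X]
  letI : Algebra F O := FractionRing.liftAlgebra C[X] O
  haveI : IsScalarTower C[X] F O := FractionRing.isScalarTower_liftAlgebra C[X] O
  -- invariant polynomial
  choose! Px hPx0 hPx using hS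
  obtain ⟨P, hP0, hPd, hPt⟩ := inv_mult t fin (∏ x ∈ S, Px x) (Finset.prod_ne_zero_iff.2 hPx0)
  let PF : F[X] := P.map (algebraMap C[X] F)
  have hPF0 : PF ≠ 0 := by
    rwa [Ne, Polynomial.map_eq_zero_iff (FaithfulSMul.algebraMap_injective C[X] F)]
  have hroot : ∀ x, x ∈ PF.rootSet O ↔ evl ι a x P = 0 := by
    intro x
    rw [mem_rootSet, hev, aeval_map_algebraMap]
    exact ⟨fun h => h.2, fun h => ⟨hPF0, h⟩⟩
  let M := IntermediateField.adjoin F (PF.rootSet O)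
  haveI : IsSplittingField F M PF :=
    IntermediateField.adjoin_rootSet_isSplittingField (IsAlgClosed.splits _)
  haveI : FiniteDimensional F M := IsSplittingField.finiteDimensional M PF
  haveI : Normal F M := Normal.of_isSplittingField PF
  haveI : CharZero F := charZero_of_injective_algebraMap (FaithfulSMul.algebraMap_injective C[X] F)
  obtain ⟨y0, hy0⟩ := Field.exists_primitive_element F M
  have hy0a : IsAlgebraic C[X] (y0 : O) := by
    rw [IsFractionRing.isAlgebraic_iff C[X] F O]
    exact (Algebra.IsAlgebraic.isAlgebraic (R := F) y0).algebraMap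
  obtain ⟨c, hc0, hcy⟩ := hy0a.exists_integral_multiple
  set y : O := c • (y0 : O) with hy
  have hyM : y ∈ M := by
    rw [hy, ← algebraMap_smul F c (y0 : O)]
    exact M.smul_mem y0.2
  have hMy : IntermediateField.adjoin F {y} = M := by
    apply le_antisymm
    · rw [IntermediateField.adjoin_le_iff]
      rintro _ rfl
      exact hyM
    · have h1 : IntermediateField.adjoin F {(y0 : O)} = M := by
        have := congrArg (IntermediateField.map M.val) hy0
        rw [IntermediateField.adjoin_map, Set.image_singleton] at this
        rw [show (y0 : O) = M.val y0 from rfl, this, ← AlgHom.fieldRange_eq_map,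
          IntermediateField.fieldRange_val]
      rw [← h1, IntermediateField.adjoin_le_iff]
      rintro _ rfl
      have h2 : (y0 : O) = (algebraMap C[X] F c)⁻¹ • y := by
        rw [hy, ← algebraMap_smul F c (y0 : O), smul_smul, inv_mul_cancel₀, one_smul]
        rwa [Ne, FaithfulSMul.algebraMap_eq_zero_iff]
      change (y0 : O) ∈ IntermediateField.adjoin F {y}
      rw [h2]
      exact IntermediateField.smul_mem _ (IntermediateField.mem_adjoin_simple_self F y)
  have hyF : IsIntegral F y := hcy.tower_top
  have hmF : minpoly F y = (minpoly C[X] y).map (algebraMap C[X] F) :=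
    minpoly.isIntegrallyClosed_eq_field_fractions F O hcy
  refine ⟨y, minpoly C[X] y, M.toSubfield, minpoly.monic hcy, minpoly.irreducible hcy, ?_, ?_, ?_,
    ?_, hyM, ?_, ?_⟩
  · intro h hh
    exact (minpoly.isIntegrallyClosed_dvd_iff hcy h).1 hh
  · exact minpoly.aeval C[X] y
  · intro x hx
    apply IntermediateField.subset_adjoin
    rw [hroot]
    obtain ⟨Q, hQ⟩ := (Finset.dvd_prod_of_mem Px hx).trans hPd
    rw [hQ, map_mul, hPx x hx, zero_mul]
  · intro x hx
    refine IntermediateField.adjoin_induction F (p := fun x _ => φ x ∈ M) ?_ ?_ ?_ ?_ ?_ hx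
    · intro x hx
      apply IntermediateField.subset_adjoin
      rw [hroot] at hx ⊢
      have := evl_nat hι a x P
      rw [hx, map_zero, ha, hPt] at this
      exact this.symm
    · intro f
      obtain ⟨p, q, hq, rfl⟩ := IsFractionRing.div_surjective (A := C[X]) f
      have hA : ∀ p : C[X], φ (algebraMap C[X] O p) = algebraMap C[X] O (p.map t) := by
        intro p
        rw [halg, halg, hom_eval₂, eval₂_map, ha]
        congr 1
        ext c
        exact hι c
      rw [map_div₀, map_div₀, ← IsScalarTower.algebraMap_apply, ← IsScalarTower.algebraMap_apply,
        hA, hA, IsScalarTower.algebraMap_apply C[X] F O, IsScalarTower.algebraMap_apply C[X] F O,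
        ← map_div₀]
      exact M.algebraMap_mem _
    · intro x y _ _ h1 h2; rw [map_add]; exact M.add_mem h1 h2
    · intro x _ h1; rw [map_inv₀]; exact M.inv_mem h1
    · intro x y _ _ h1 h2; rw [map_mul]; exact M.mul_mem h1 h2
  · intro x hx
    have hx : x ∈ IntermediateField.adjoin F {y} := by rw [hMy]; exact hx
    rw [← IntermediateField.mem_toSubalgebra,
      IntermediateField.adjoin_simple_toSubalgebra_of_isAlgebraic hyF.isAlgebraic,
      Algebra.adjoin_singleton_eq_range_aeval] at hx
    obtain ⟨q, rfl⟩ := hx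
    obtain ⟨b, hb, hq⟩ := IsLocalization.integerNormalization_spec (nonZeroDivisors C[X]) q
    refine ⟨b, nonZeroDivisors.ne_zero hb, IsLocalization.integerNormalization (nonZeroDivisors C[X]) q, ?_⟩
    rw [hev, ← aeval_map_algebraMap F, hq, ← algebraMap_smul F b q, map_smul, algebraMap_smul, ← halg,
      Algebra.smul_def, mul_comm]
    rfl
  · intro v hv
    have h1 : Splits ((minpoly F y).map (algebraMap F M)) := by
      have := Normal.splits (F := F) (K := M) inferInstance (⟨y, hyM⟩ : M)
      rwa [IntermediateField.minpoly_eq] at this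
    have h2 : v ∈ (minpoly F y).rootSet O := by
      rw [mem_rootSet]
      refine ⟨minpoly.ne_zero hyF, ?_⟩
      rw [hmF, aeval_map_algebraMap]
      exact hv
    rw [← h1.image_rootSet M.val] at h2
    obtain ⟨w, -, rfl⟩ := h2
    exact w.2

end ext1
end AxP

end

section
set_option linter.style.haveILetI false
set_option linter.unusedSectionVars false
open Polynomial

namespace AxP

/-- the conclusion of `ax` -/
def AxProp {O : Type} [Field O] (φ : O →+* O) : Prop :=
  ∀ (n : ℕ) (g : O[X][X]), g.Monic → g.natDegree = n → 0 < n → Irreducible g →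
    ∀ (s : Fin n → O[X][X]) (d e : O[X]), d ≠ 0 → e ≠ 0 →
    (∀ x0 y0, φ x0 = x0 → d.eval x0 ≠ 0 → g.evalEval x0 y0 = 0 →
      ∃ γ, d.eval x0 * φ y0 = (s γ).evalEval x0 y0) → ∀ γ : Fin n,
    ∃ x0 y0, φ x0 = x0 ∧ e.eval x0 ≠ 0 ∧ d.eval x0 ≠ 0 ∧ g.evalEval x0 y0 = 0 ∧
      d.eval x0 * φ y0 = (s γ).evalEval x0 y0

theorem axProp_Fr {W : ℕ → Type} [∀ i, Field (W i)] [∀ i, IsAlgClosed (W i)] (p : ℕ → ℕ)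
    [∀ i, Fact (p i).Prime] [∀ i, CharP (W i) (p i)]
    (hp : ∀ B, ∀ᶠ i in (UF : Filter ℕ), B ≤ p i) : AxProp (Fr W p) := by
  intro n g hg hgn hn hirr s d e hd he H γ
  exact ax p hp hg hgn hn hirr s hd he H γ

section
variable {O : Type} [Field O]

theorem splits_fin [IsAlgClosed O] (f : O[X]) (hf : f.Monic) (n : ℕ) (hn : f.natDegree = n) :
    ∃ v : Fin n → O, f = ∏ γ, (X - C (v γ)) := by
  have h1 := IsAlgClosed.splits f
  have h2 := h1.eq_prod_roots_of_monic hf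
  have h3 := h1.natDegree_eq_card_roots
  obtain ⟨l, hl⟩ := Quot.exists_rep f.roots
  have hl : (l : Multiset O) = f.roots := hl
  rw [← hl] at h2 h3
  rw [hn, Multiset.coe_card] at h3
  subst h3
  refine ⟨l.get, h2.trans ?_⟩
  rw [Multiset.map_coe, Multiset.prod_coe, ← List.prod_ofFn]
  congr 1
  apply List.ext_get
  · simp
  · intro n h1 h2; simp

theorem pow_eq_iterate (φ : O →+* O) (i : ℕ) (x : O) : (φ ^ i) x = φ^[i] x := by
  induction i generalizing x with
  | zero => rfl
  | succ i ih => rw [pow_succ, Function.iterate_succ, Function.comp, ← ih]; rfl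

theorem coprime_fix {φ : O →+* O} {i N : ℕ} (h : i.Coprime N) {x : O} (h1 : (φ ^ i) x = x)
    (h2 : (φ ^ N) x = x) : φ x = x := by
  rw [pow_eq_iterate] at h1 h2
  have h1 : Function.IsPeriodicPt φ i x := h1
  have h2 : Function.IsPeriodicPt φ N x := h2
  have := h1.gcd h2
  rw [h] at this
  exact this

end

theorem map_mapRingHom_congr {A B : Type} [Field A] [Field B] {t t' : A →+* B} (P : A[X][X])
    (h : ∀ k l, t ((P.coeff k).coeff l) = t' ((P.coeff k).coeff l)) :
    P.map (mapRingHom t) = P.map (mapRingHom t') := by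
  ext k l
  simp [coeff_map, h]

/-- the finite set of coefficients -/
noncomputable def cfs {A : Type} [Field A] (P : A[X][X]) : Finset A := by
  classical
  exact insert 0 (P.support.biUnion fun k => (P.coeff k).support.image fun l => (P.coeff k).coeff l)

theorem mem_cfs {A : Type} [Field A] (P : A[X][X]) (k l : ℕ) : (P.coeff k).coeff l ∈ cfs P := by
  classical
  unfold cfs
  by_cases hl : (P.coeff k).coeff l = 0
  · rw [hl]; exact Finset.mem_insert_self _ _
  have hk : P.coeff k ≠ 0 := by rintro h; rw [h] at hl; simp at hl
  exact Finset.mem_insert_of_mem (Finset.mem_biUnion.2 ⟨k, mem_support_iff.2 hk,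
    Finset.mem_image.2 ⟨l, mem_support_iff.2 hl, rfl⟩⟩)

section
variable {C O₁ O₂ : Type} [Field C] [Field O₁] [Field O₂]

/-- correspondences -/
structure Corr (i1 : C →+* O₁) (i2 : C →+* O₂) (R : O₁ → O₂ → Prop) : Prop where
  func : ∀ {u v v'}, R u v → R u v' → v = v'
  add : ∀ {u v u' v'}, R u v → R u' v' → R (u + u') (v + v')
  mul : ∀ {u v u' v'}, R u v → R u' v' → R (u * u') (v * v')
  const : ∀ c, R (i1 c) (i2 c)

theorem corr_of (i1 : C →+* O₁) (i2 : C →+* O₂) (a y : O₁) (x0 y0 : O₂)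
    (hker : ∀ h, evl i1 a y h = 0 → evl i2 x0 y0 h = 0) :
    Corr i1 i2 (fun u v => ∃ n m, eval₂RingHom i2 x0 m ≠ 0 ∧
      u * eval₂RingHom i1 a m = evl i1 a y n ∧ v * eval₂RingHom i2 x0 m = evl i2 x0 y0 n) := by
  have hC1 : ∀ m, evl i1 a y (Polynomial.C m) = eval₂RingHom i1 a m := fun m => by
    rw [evl_apply, eval₂_C]
  have hC2 : ∀ m, evl i2 x0 y0 (Polynomial.C m) = eval₂RingHom i2 x0 m := fun m => by
    rw [evl_apply, eval₂_C]
  constructor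
  · rintro u v v' ⟨n, m, h0, h1, h2⟩ ⟨n', m', h0', h1', h2'⟩
    have := hker (n * Polynomial.C m' - n' * Polynomial.C m) (by
      rw [map_sub, map_mul, map_mul, hC1, hC1, ← h1, ← h1']; ring)
    rw [map_sub, map_mul, map_mul, hC2, hC2, ← h2, ← h2', sub_eq_zero] at this
    have h3 : (v * (eval₂RingHom i2 x0 m * eval₂RingHom i2 x0 m')) =
        v' * (eval₂RingHom i2 x0 m * eval₂RingHom i2 x0 m') := by linear_combination this
    exact mul_right_cancel₀ (mul_ne_zero h0 h0') h3
  · rintro u v u' v' ⟨n, m, h0, h1, h2⟩ ⟨n', m', h0', h1', h2'⟩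
    refine ⟨n * Polynomial.C m' + n' * Polynomial.C m, m * m', ?_, ?_, ?_⟩
    · rw [map_mul]; exact mul_ne_zero h0 h0'
    · rw [map_add, map_mul, map_mul, map_mul, hC1, hC1, ← h1, ← h1']; ring
    · rw [map_add, map_mul, map_mul, map_mul, hC2, hC2, ← h2, ← h2']; ring
  · rintro u v u' v' ⟨n, m, h0, h1, h2⟩ ⟨n', m', h0', h1', h2'⟩
    refine ⟨n * n', m * m', ?_, ?_, ?_⟩
    · rw [map_mul]; exact mul_ne_zero h0 h0'
    · rw [map_mul, map_mul, ← h1, ← h1']; ring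
    · rw [map_mul, map_mul, ← h2, ← h2']; ring
  · intro c
    refine ⟨Polynomial.C (Polynomial.C c), 1, by simp, ?_, ?_⟩
    · rw [hC1]; simp
    · rw [hC2]; simp

theorem ext2 [IsAlgClosed C] [CharZero C] [IsAlgClosed O₁] {φ : O₁ →+* O₁} {φ' : O₂ →+* O₂}
    (I : PI φ φ' C) (hax : AxProp φ') (a : O₁) (ha : φ a = a)
    (hinj : Function.Injective (eval₂RingHom I.i1 a)) (S : Finset O₁)
    (hS : ∀ x ∈ S, AlgOver I.i1 a x) (N : ℕ) (hN : 0 < N) (hper : ∀ x ∈ S, (φ ^ N) x = x) :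
    ∃ i R, Corr I.i1 I.i2 R ∧ ∀ x ∈ S, ∃ z, R x z ∧ R ((φ ^ i) x) (φ' z) ∧
      (φ x ≠ x → φ' z ≠ z) := by
  classical
  obtain ⟨y, g, M, hgm, hgi, hker, hgy, hSM, hφM, hyM, hM, hroots⟩ :=
    ext1 φ I.t1 I.i1 I.h1 I.fin1 a ha hinj S hS
  choose! e he0 nn hnn using hM
  -- the exponent
  obtain ⟨i, hiN, hi⟩ := ga I.t1 I.t2 I.fix I.fin1
    (cfs g ∪ S.biUnion fun x => cfs (nn x) ∪ cfs (Polynomial.C (e x))) hN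
  have hi1 : ∀ P, cfs P ⊆ (cfs g ∪ S.biUnion fun x => cfs (nn x) ∪ cfs (Polynomial.C (e x))) →
      P.map (mapRingHom I.t2) = P.map (mapRingHom (I.t1 ^ i)) := fun P hP =>
    map_mapRingHom_congr P fun k l => hi _ (hP (mem_cfs P k l))
  have hig := hi1 g Finset.subset_union_left
  have hin : ∀ x ∈ S, (nn x).map (mapRingHom I.t2) = (nn x).map (mapRingHom (I.t1 ^ i)) := by
    intro x hx
    refine hi1 _ (fun z hz => Finset.mem_union_right _ (Finset.mem_biUnion.2 ⟨x, hx, ?_⟩))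
    exact Finset.mem_union_left _ hz
  have hie : ∀ x ∈ S, (e x).map I.t2 = (e x).map (I.t1 ^ i) := by
    intro x hx
    have := hi1 (Polynomial.C (e x))
      (fun z hz => Finset.mem_union_right _ (Finset.mem_biUnion.2 ⟨x, hx,
        Finset.mem_union_right _ hz⟩))
    rw [map_C, map_C] at this
    exact C_injective this
  clear hi hi1
  have hφi : ∀ x ∈ M, (φ ^ i) x ∈ M := by
    intro x hx
    clear hig hin hie hiN
    induction i with
    | zero => exact hx
    | succ i ih => rw [pow_succ']; exact hφM _ ih
  have hφia : (φ ^ i) a = a := iter_fix ha i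
  -- conjugates
  set n := g.natDegree with hn
  have hn0 : 0 < n := by
    rw [Nat.pos_iff_ne_zero]
    intro h
    rw [hgm.natDegree_eq_zero] at h
    exact hgi.not_isUnit (h ▸ isUnit_one)
  obtain ⟨v, hv⟩ := splits_fin (g.map (eval₂RingHom I.i1 a)) (hgm.map _) n
    (hgm.natDegree_map _)
  have hevg : ∀ w, evl I.i1 a w g = ∏ γ, (w - v γ) := by
    intro w
    rw [evl_apply, ← eval_map, hv, eval_prod]; simp
  have hvM : ∀ γ, v γ ∈ M := fun γ => hroots _ (by
    rw [hevg]; exact Finset.prod_eq_zero (Finset.mem_univ γ) (sub_self _))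
  obtain ⟨γ0, hγ0⟩ : ∃ γ, v γ = y := by
    have := hgy
    rw [hevg, Finset.prod_eq_zero_iff] at this
    obtain ⟨γ, -, h⟩ := this
    exact ⟨γ, (sub_eq_zero.1 h).symm⟩
  let w : Fin n → O₁ := fun γ => (φ ^ i) (v γ)
  have hwM : ∀ γ, w γ ∈ M := fun γ => hφi _ (hvM γ)
  let d : C[X] := ∏ γ, e (w γ)
  have hd0 : d ≠ 0 := Finset.prod_ne_zero_iff.2 fun γ _ => he0 _ (hwM γ)
  let s : Fin n → C[X][X] := fun γ => nn (w γ) * Polynomial.C (∏ γ' ∈ Finset.univ.erase γ, e (w γ'))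
  have hs : ∀ γ, eval₂RingHom I.i1 a d * w γ = evl I.i1 a y (s γ) := by
    intro γ
    have : d = e (w γ) * ∏ γ' ∈ Finset.univ.erase γ, e (w γ') :=
      (Finset.mul_prod_erase _ _ (Finset.mem_univ γ)).symm
    rw [this, map_mul, map_mul, ← hnn _ (hwM γ), evl_apply _ _ _ (Polynomial.C _), eval₂_C]
    simp only [coe_eval₂RingHom]
    ring
  -- identity
  have hid1 : ((Polynomial.C (Polynomial.C d)) ^ n * (g.map (mapRingHom (I.t1 ^ i))).map Polynomial.C).map
      (evl I.i1 a y) = (∏ γ, (Polynomial.C (Polynomial.C d) * X - Polynomial.C (s γ))).map (evl I.i1 a y) := by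
    have e1 : (g.map (mapRingHom (I.t1 ^ i))).map (eval₂RingHom I.i1 a) = ∏ γ, (X - Polynomial.C (w γ)) := by
      have := congrArg (Polynomial.map (φ ^ i)) hv
      rw [Polynomial.map_prod, Polynomial.map_map] at this
      rw [Polynomial.map_map]
      convert this using 1
      · congr 1
        refine Polynomial.ringHom_ext (fun c => ?_) ?_
        · have := pow_nat I.h1 i c
          simp [-RingHom.coe_pow, this]
        · simp [-RingHom.coe_pow, hφia]
      · refine Finset.prod_congr rfl fun γ _ => ?_
        rw [Polynomial.map_sub, map_X, map_C]
    have e2 : (evl I.i1 a y).comp Polynomial.C = eval₂RingHom I.i1 a := by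
      ext c <;> simp [evl_apply]
    rw [Polynomial.map_mul, Polynomial.map_map, e2, e1, Polynomial.map_pow, Polynomial.map_prod]
    simp only [Polynomial.map_sub, Polynomial.map_mul, map_X, map_C, ← hs]
    have e3 : evl I.i1 a y (Polynomial.C d) = eval₂RingHom I.i1 a d := by
      rw [evl_apply, eval₂_C]
    rw [e3]
    have : ∀ γ, Polynomial.C (eval₂RingHom I.i1 a d) * X - Polynomial.C (eval₂RingHom I.i1 a d * w γ) =
        Polynomial.C (eval₂RingHom I.i1 a d) * (X - Polynomial.C (w γ)) := by
      intro γ; rw [Polynomial.C_mul]; ring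
    simp only [this]
    rw [Finset.prod_mul_distrib, Finset.prod_const, Finset.card_univ, Fintype.card_fin]
  have hkk : ∀ x0 y0, evl I.i2 x0 y0 g = 0 → ∀ h, evl I.i1 a y h = 0 → evl I.i2 x0 y0 h = 0 := by
    intro x0 y0 h0 h hh
    obtain ⟨q, rfl⟩ := hker h hh
    rw [map_mul, h0, zero_mul]
  have hid2 : ∀ x0 y0, evl I.i2 x0 y0 g = 0 →
      ∀ T, (eval₂RingHom I.i2 x0 d) ^ n * evl I.i2 x0 T (g.map (mapRingHom (I.t1 ^ i))) =
        ∏ γ, (eval₂RingHom I.i2 x0 d * T - evl I.i2 x0 y0 (s γ)) := by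
    intro x0 y0 h0 T
    have h1 : ((Polynomial.C (Polynomial.C d)) ^ n * (g.map (mapRingHom (I.t1 ^ i))).map Polynomial.C).map
      (evl I.i2 x0 y0) = (∏ γ, (Polynomial.C (Polynomial.C d) * X - Polynomial.C (s γ))).map (evl I.i2 x0 y0) := by
      ext k
      have := congrArg (fun f => coeff f k) hid1
      simp only [coeff_map] at this ⊢
      rw [← sub_eq_zero, ← map_sub] at this ⊢
      exact hkk x0 y0 h0 _ this
    have h2 := congrArg (Polynomial.eval T) h1
    have e2 : (evl I.i2 x0 y0).comp Polynomial.C = eval₂RingHom I.i2 x0 := by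
      ext c <;> simp [evl_apply]
    have e3 : evl I.i2 x0 y0 (Polynomial.C d) = eval₂RingHom I.i2 x0 d := by
      rw [evl_apply, eval₂_C]
    rw [Polynomial.map_mul, Polynomial.map_map (f := Polynomial.C), e2, Polynomial.map_pow, map_C, e3, Polynomial.map_prod, eval_mul,
      eval_prod, eval_pow, eval_C, eval_map] at h2
    rw [evl_apply I.i2 x0 T, h2]
    refine Finset.prod_congr rfl fun γ _ => ?_
    rw [Polynomial.map_sub, Polynomial.map_mul, map_C, map_C, map_X, e3]
    simp
  -- apply ax
  let D : C[X] := ∏ x ∈ S, (e x * ((e x).map (I.t1 ^ i) * e (((φ ^ i) x - x)⁻¹)))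
  have hD0 : D ≠ 0 := by
    refine Finset.prod_ne_zero_iff.2 fun x hx => mul_ne_zero (he0 _ (hSM x hx)) (mul_ne_zero ?_ ?_)
    · rw [Ne, Polynomial.map_eq_zero_iff (RingHom.injective _)]
      exact he0 _ (hSM x hx)
    · exact he0 _ (M.inv_mem (M.sub_mem (hφi _ (hSM x hx)) (hSM x hx)))
  have hmap0 : ∀ q : C[X], q ≠ 0 → q.map I.i2 ≠ 0 := fun q hq => by
    rwa [Ne, Polynomial.map_eq_zero_iff (RingHom.injective _)]
  have hev2 : ∀ (q : C[X]) x0, (q.map I.i2).eval x0 = eval₂RingHom I.i2 x0 q := fun q x0 => by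
    rw [eval_map]; rfl
  have hφ'a : ∀ x0, φ' x0 = x0 → ∀ q : C[X], φ' (eval₂RingHom I.i2 x0 q) =
      eval₂RingHom I.i2 x0 (q.map I.t2) := by
    intro x0 hx0 q
    rw [coe_eval₂RingHom, hom_eval₂, eval₂_map, hx0]
    congr 1
    ext c
    exact I.h2 c
  obtain ⟨x0, y0, hx0, hDx, hdx, hg0, hy0⟩ := hax n (g.map (mapRingHom I.i2)) (hgm.map _)
    (hgm.natDegree_map _) hn0 (irreducible_map I.i2 g hgm hgi) (fun γ => (s γ).map (mapRingHom I.i2))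
    (d.map I.i2) (D.map I.i2) (hmap0 _ hd0) (hmap0 _ hD0) (by
      intro x0 y0 hx0 hd hg
      rw [← evl_eq] at hg
      have h1 := evl_nat I.h2 x0 y0 g
      rw [hg, map_zero, hx0, hig] at h1
      have h2 := hid2 x0 y0 hg (φ' y0)
      rw [← h1, mul_zero, eq_comm, Finset.prod_eq_zero_iff] at h2
      obtain ⟨γ, -, h3⟩ := h2
      exact ⟨γ, by rw [hev2, ← evl_eq, sub_eq_zero.1 h3]⟩) γ0
  simp only [hev2, ← evl_eq] at hDx hdx hg0 hy0
  have hcorr := corr_of I.i1 I.i2 a y x0 y0 (hkk x0 y0 hg0)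
  refine ⟨i, _, hcorr, fun x hx => ?_⟩
  have hxM := hSM x hx
  have hD1 : eval₂RingHom I.i2 x0 (e x) ≠ 0 ∧ eval₂RingHom I.i2 x0 ((e x).map (I.t1 ^ i)) ≠ 0 ∧
      eval₂RingHom I.i2 x0 (e (((φ ^ i) x - x)⁻¹)) ≠ 0 := by
    have h1 : (e x * ((e x).map (I.t1 ^ i) * e (((φ ^ i) x - x)⁻¹))) ∣ D := Finset.dvd_prod_of_mem _ hx
    obtain ⟨q, hq⟩ := h1
    rw [hq, map_mul, map_mul, map_mul] at hDx
    have h2 := left_ne_zero_of_mul hDx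
    have h3 := right_ne_zero_of_mul h2
    exact ⟨left_ne_zero_of_mul h2, left_ne_zero_of_mul h3, right_ne_zero_of_mul h3⟩
  set R : O₁ → O₂ → Prop := fun u v => ∃ n m, eval₂RingHom I.i2 x0 m ≠ 0 ∧
      u * eval₂RingHom I.i1 a m = evl I.i1 a y n ∧ v * eval₂RingHom I.i2 x0 m = evl I.i2 x0 y0 n with hR
  have hRp : ∀ q : C[X], R (eval₂RingHom I.i1 a q) (eval₂RingHom I.i2 x0 q) := fun q =>
    ⟨Polynomial.C q, 1, by simp, by simp [evl_apply], by simp [evl_apply]⟩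
  have hRe : ∀ u v, R u v → ∀ h, R (evl I.i1 a u h) (evl I.i2 x0 v h) := by
    intro u v huv h
    induction h using Polynomial.induction_on with
    | C q =>
      rw [evl_apply, evl_apply, eval₂_C, eval₂_C]; exact hRp q
    | add p q hp hq => rw [map_add, map_add]; exact hcorr.add hp hq
    | monomial k q hq =>
      rw [pow_succ, ← mul_assoc, map_mul (evl I.i1 a u) (_ * _), map_mul (evl I.i2 x0 v) (_ * _)]
      refine hcorr.mul hq ?_
      rw [evl_apply, evl_apply, eval₂_X, eval₂_X]; exact huv
  have hRd : ∀ u v z q, R u v → eval₂RingHom I.i2 x0 q ≠ 0 → z * eval₂RingHom I.i1 a q = u →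
      R z (v / eval₂RingHom I.i2 x0 q) := by
    rintro u v z q ⟨n, m, h0, h1, h2⟩ hq hz
    refine ⟨n, q * m, by rw [map_mul]; exact mul_ne_zero hq h0, ?_, ?_⟩
    · rw [map_mul, ← mul_assoc, hz, h1]
    · rw [map_mul, ← mul_assoc, div_mul_cancel₀ _ hq, h2]
  have hRy : R y y0 := ⟨X, 1, by simp, by simp [evl_apply], by simp [evl_apply]⟩
  have hRy' : R ((φ ^ i) y) (φ' y0) := by
    refine ⟨s γ0, d, hdx, ?_, ?_⟩
    · rw [← hs, mul_comm]
      simp only [w, hγ0]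
    · rw [← hy0, mul_comm]
  have hRx : R x (evl I.i2 x0 y0 (nn x) / eval₂RingHom I.i2 x0 (e x)) :=
    hRd _ _ _ _ (hRe _ _ hRy (nn x)) hD1.1 (hnn x hxM)
  have hφx : R ((φ ^ i) x) (φ' (evl I.i2 x0 y0 (nn x) / eval₂RingHom I.i2 x0 (e x))) := by
    rw [map_div₀, hφ'a x0 hx0, hie x hx, evl_nat I.h2, hx0, hin x hx]
    refine hRd _ _ _ _ (hRe _ _ hRy' _) hD1.2.1 ?_
    have h1 := congrArg (φ ^ i) (hnn x hxM)
    rw [evl_nat (pow_nat I.h1 i), hφia, map_mul] at h1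
    rw [← h1]
    congr 1
    rw [hom_eval₂, coe_eval₂RingHom, eval₂_map, hφia]
    congr 1
    ext c
    exact (pow_nat I.h1 i c).symm
  refine ⟨_, hRx, hφx, ?_⟩
  · intro hne heq
    set z := evl I.i2 x0 y0 (nn x) / eval₂RingHom I.i2 x0 (e x)
    have hne' : (φ ^ i) x - x ≠ 0 := fun h =>
      hne (coprime_fix hiN (sub_eq_zero.1 h) (hper x hx))
    have hmM : ((φ ^ i) x - x)⁻¹ ∈ M := M.inv_mem (M.sub_mem (hφi _ hxM) hxM)
    have h1 : R ((φ ^ i) x) z := by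
      have : R ((φ ^ i) x) (φ' z) := hφx
      rwa [heq] at this
    have h2 : R ((φ ^ i) x - x) 0 := by
      have := hcorr.add h1 (hcorr.mul (hcorr.const (-1)) hRx)
      rw [map_neg, map_neg, map_one, map_one] at this
      convert this using 1 <;> ring
    have h3 := hRd _ _ _ _ (hRe _ _ hRy (nn (((φ ^ i) x - x)⁻¹))) hD1.2.2 (hnn _ hmM)
    have h4 := hcorr.mul h2 h3
    rw [mul_inv_cancel₀ hne', zero_mul] at h4
    have h5 := hcorr.const 1
    rw [map_one, map_one] at h5
    exact one_ne_zero (hcorr.func h5 h4)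

end
end AxP

end

section
set_option linter.style.haveILetI false
set_option linter.unusedSectionVars false
open Polynomial

namespace AxP

theorem sat {A : ℕ → Type} (hne : ∀ i, Nonempty (A i)) (Q : ℕ → ∀ i, A i → Prop)
    (h : ∀ n, ∀ᶠ i in (UF : Filter ℕ), ∃ f : A i, ∀ m < n, Q m i f) :
    ∃ f : ∀ i, A i, ∀ m, ∀ᶠ i in (UF : Filter ℕ), Q m i (f i) := by
  classical
  let n : ℕ → ℕ := fun i => Nat.findGreatest (fun n => ∃ f : A i, ∀ m < n, Q m i f) i
  have hn : ∀ i, ∃ f : A i, ∀ m < n i, Q m i f := fun i =>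
    Nat.findGreatest_spec (P := fun n => ∃ f : A i, ∀ m < n, Q m i f) (Nat.zero_le i)
      ⟨(hne i).some, fun m hm => absurd hm (Nat.not_lt_zero m)⟩
  choose f hf using hn
  refine ⟨f, fun m => ?_⟩
  have h1 : ∀ᶠ i in (UF : Filter ℕ), m + 1 ≤ i :=
    (Filter.eventually_ge_atTop (m + 1)).filter_mono Nat.hyperfilter_le_atTop
  filter_upwards [h (m + 1), h1] with i h2 h3
  exact hf i m (Nat.le_findGreatest h3 h2)

theorem periodic_of_finite {A : Type} (T : A → A) (hT : Function.Injective T) (s : Set A)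
    (hs : s.Finite) (h : ∀ x ∈ s, T x ∈ s) (x : A) (hx : x ∈ s) : ∃ N, 0 < N ∧ T^[N] x = x := by
  have h1 : ∀ k, T^[k] x ∈ s := by
    intro k
    induction k with
    | zero => exact hx
    | succ k ih => rw [Function.iterate_succ_apply']; exact h _ ih
  obtain ⟨k, -, l, -, hkl, he⟩ := Set.infinite_univ.exists_ne_map_eq_of_mapsTo
    (f := fun k : ℕ => T^[k] x) (t := s) (fun k _ => h1 k) hs
  wlog hlt : k < l generalizing k l
  · exact this l k hkl.symm he.symm (by omega)
  obtain ⟨m, rfl⟩ := Nat.exists_eq_add_of_lt hlt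
  refine ⟨m + 1, by omega, ?_⟩
  apply hT.iterate k
  rw [← Function.iterate_add_apply, ← add_assoc]
  exact he.symm

section
variable {C : Type} [Field C] [IsAlgClosed C] [CharZero C] {O : Type} [Field O] [IsAlgClosed O]

theorem algOver_map {φ : O →+* O} {t : C →+* C} {ι : C →+* O} (hι : ∀ x, φ (ι x) = ι (t x))
    {a : O} (ha : φ a = a) {x : O} (hx : AlgOver ι a x) : AlgOver ι a (φ x) := by
  obtain ⟨P, h0, h1⟩ := hx
  refine ⟨P.map (mapRingHom t), ?_, ?_⟩
  · rwa [Ne, Polynomial.map_eq_zero_iff (map_injective _ t.injective)]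
  · have := evl_nat hι a x P
    rw [h1, map_zero, ha] at this
    exact this.symm

theorem alg_period {φ : O →+* O} {t : C →+* C} {ι : C →+* O} (hι : ∀ x, φ (ι x) = ι (t x))
    (fin : ∀ x, ∃ N, 0 < N ∧ (t ^ N) x = x)
    {a : O} (ha : φ a = a) (hinj : Function.Injective (eval₂RingHom ι a))
    {x : O} (hx : AlgOver ι a x) : ∃ N, 0 < N ∧ (φ ^ N) x = x := by
  classical
  obtain ⟨P0, h0, h1⟩ := hx
  obtain ⟨P, hP0, hd, hP⟩ := inv_mult t fin P0 h0
  have h1 : evl ι a x P = 0 := by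
    obtain ⟨q, rfl⟩ := hd
    rw [map_mul, h1, zero_mul]
  have hP1 : P.map (eval₂RingHom ι a) ≠ 0 := by
    rwa [Ne, Polynomial.map_eq_zero_iff hinj]
  obtain ⟨N, hN, h⟩ := periodic_of_finite φ φ.injective {y | evl ι a y P = 0} (by
    refine ((P.map (eval₂RingHom ι a)).roots.toFinset.finite_toSet).subset ?_
    · intro y hy
      have hy : evl ι a y P = 0 := hy
      rw [evl_apply, ← eval_map] at hy
      simpa [hP1] using hy) (by
    intro y hy
    have hy : evl ι a y P = 0 := hy
    have := evl_nat hι a y P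
    rw [hy, map_zero, ha, hP] at this
    exact this.symm) x h1
  exact ⟨N, hN, by rwa [pow_eq_iterate]⟩

theorem exists_closure [Countable C] (ι : C →+* O) (a : O)
    (hinj : Function.Injective (eval₂RingHom ι a)) :
    ∃ K : Subfield O, (∀ x, x ∈ K ↔ AlgOver ι a x) ∧ IsAlgClosed K ∧ Countable K := by
  letI : Algebra C[X] O := (eval₂RingHom ι a).toAlgebra
  haveI : FaithfulSMul C[X] O := (faithfulSMul_iff_algebraMap_injective _ _).2 hinj
  let F := FractionRing C[X]
  letI : Algebra F O := FractionRing.liftAlgebra C[X] O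
  haveI : IsScalarTower C[X] F O := FractionRing.isScalarTower_liftAlgebra C[X] O
  refine ⟨(algebraicClosure F O).toSubfield, ?_, ?_, ?_⟩
  · intro x
    change x ∈ algebraicClosure F O ↔ _
    rw [mem_algebraicClosure_iff, ← IsFractionRing.isAlgebraic_iff C[X] F O]
    rfl
  · have : IsAlgClosure F (algebraicClosure F O) := inferInstance
    exact this.isAlgClosed
  · change Countable (algebraicClosure F O)
    rw [← Cardinal.mk_le_aleph0_iff]
    refine (Algebra.IsAlgebraic.cardinalMk_le_max F (algebraicClosure F O)).trans (max_le ?_ le_rfl)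
    have h1 : Cardinal.mk C[X] ≤ Cardinal.aleph0 :=
      (Polynomial.cardinalMk_le_max).trans (max_le (Cardinal.mk_le_aleph0_iff.2 inferInstance) le_rfl)
    exact (FractionRing.cardinalMk C[X]).le.trans h1

theorem inj_of_notMem (ι : C →+* O) (a : O) (h : ∀ c, ι c ≠ a) :
    Function.Injective (eval₂RingHom ι a) := by
  rw [injective_iff_map_eq_zero]
  intro P hP
  by_contra h0
  have h1 := (IsAlgClosed.splits P).eq_prod_roots
  rw [h1] at hP
  rw [map_mul, mul_eq_zero] at hP
  rcases hP with hP | hP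
  · simp [h0] at hP
  · rw [map_multiset_prod, Multiset.prod_eq_zero_iff] at hP
    simp only [Multiset.map_map, Multiset.mem_map, Function.comp] at hP
    obtain ⟨c, -, hc⟩ := hP
    simp only [coe_eval₂RingHom, eval₂_sub, eval₂_X, eval₂_C, sub_eq_zero] at hc
    exact h c hc.symm

end

section forth
variable {C : Type} [Field C] [IsAlgClosed C] [CharZero C] [Countable C]
  {O : Type} [Field O] [IsAlgClosed O]
  {W : ℕ → Type} [∀ i, Field (W i)] [∀ i, IsAlgClosed (W i)] (p : ℕ → ℕ)
    [∀ i, Fact (p i).Prime] [∀ i, CharP (W i) (p i)]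

theorem Fr_eq_iff {x : ∀ i, W i} {y : ∀ i, W i} :
    Fr W p (qm x) = qm y ↔ ∀ᶠ i in (UF : Filter ℕ), x i ^ p i = y i := by
  rw [Fr_qm, qm_eq]

theorem forth (hp : ∀ B, ∀ᶠ i in (UF : Filter ℕ), B ≤ p i) {φ : O →+* O} (I : PI φ (Fr W p) C)
    (a : O) (ha : φ a = a) :
    ∃ (C1 : Type) (_ : Field C1) (_ : IsAlgClosed C1) (_ : CharZero C1) (_ : Countable C1)
      (I1 : PI φ (Fr W p) C1) (j : C →+* C1) (b : C1), (∀ x, I1.i1 (j x) = I.i1 x) ∧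
      (∀ x, I1.i2 (j x) = I.i2 x) ∧ I1.i1 b = a := by
  classical
  by_cases hmem : ∃ c, I.i1 c = a
  · obtain ⟨c, hc⟩ := hmem
    exact ⟨C, inferInstance, inferInstance, inferInstance, inferInstance, I, RingHom.id C, c,
      fun _ => rfl, fun _ => rfl, hc⟩
  push Not at hmem
  have hinj := inj_of_notMem I.i1 a hmem
  obtain ⟨K, hK, hKa, hKc⟩ := exists_closure I.i1 a hinj
  have hφK : ∀ x ∈ K, φ x ∈ K := fun x hx => (hK _).2 (algOver_map I.h1 ha ((hK x).1 hx))
  have hCK : ∀ c, I.i1 c ∈ K := fun c => (hK _).2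
    ⟨X - Polynomial.C (Polynomial.C c), X_sub_C_ne_zero _, by simp [evl_apply]⟩
  have haK : a ∈ K := (hK _).2
    ⟨X - Polynomial.C X, X_sub_C_ne_zero _, by simp [evl_apply]⟩
  let t1 : K →+* K := (φ.comp K.subtype).codRestrict K fun x => hφK x x.2
  let j : C →+* K := I.i1.codRestrict K hCK
  have ht1 : ∀ x : K, ((t1 x : K) : O) = φ x := fun x => rfl
  have ht1p : ∀ (k : ℕ) (x : K), (((t1 ^ k) x : K) : O) = (φ ^ k) x := fun k x =>
    (pow_nat (ι := K.subtype) (fun x => (ht1 x).symm) k x).symm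
  have hper : ∀ x : K, ∃ N, 0 < N ∧ (t1 ^ N) x = x := by
    intro x
    obtain ⟨N, hN, h⟩ := alg_period I.h1 I.fin1 ha hinj ((hK x).1 x.2)
    exact ⟨N, hN, Subtype.ext ((ht1p N x).trans h)⟩
  choose Nx hNx0 hNx using hper
  -- lifts of constants
  choose cc hcc using fun c : C => qm_surj (I.i2 c)
  haveI : Nonempty (K × K × C) := ⟨0, 0, 0⟩
  obtain ⟨en, hen⟩ := exists_surjective_nat (K × K × C)
  -- conditions
  let Q : ℕ → ∀ i, (K → W i) → Prop := fun m i f =>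
    f ((en m).1 + (en m).2.1) = f (en m).1 + f (en m).2.1 ∧
    f ((en m).1 * (en m).2.1) = f (en m).1 * f (en m).2.1 ∧
    f (j (en m).2.2) = cc (en m).2.2 i ∧
    (∃ k < Nx (en m).1, f (en m).1 ^ p i = f ((t1 ^ k) (en m).1)) ∧
    (t1 (en m).1 ≠ (en m).1 → f (en m).1 ^ p i ≠ f (en m).1)
  have hfs : ∀ n, ∀ᶠ i in (UF : Filter ℕ), ∃ f : K → W i, ∀ m < n, Q m i f := by
    intro n
    -- finite set
    let S : Finset O := (Finset.range n).biUnion fun m =>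
      {((en m).1 : O), ((en m).2.1 : O)}
    have hSK : ∀ x ∈ S, x ∈ K := by
      intro x hx
      obtain ⟨m, -, hx⟩ := Finset.mem_biUnion.1 hx
      rcases Finset.mem_insert.1 hx with rfl | hx
      · exact (en m).1.2
      · rw [Finset.mem_singleton] at hx; rw [hx]; exact (en m).2.1.2
    obtain ⟨N, hN0, hN⟩ : ∃ N, 0 < N ∧ ∀ x ∈ S, (φ ^ N) x = x := by
      obtain ⟨N, hN, h⟩ := common_period t1 (fun x => ⟨Nx x, hNx0 x, hNx x⟩) (S.subtype (· ∈ K))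
      refine ⟨N, hN, fun x hx => ?_⟩
      have := h ⟨x, hSK x hx⟩ (Finset.mem_subtype.2 hx)
      rw [← ht1p N ⟨x, hSK x hx⟩, this]
    obtain ⟨l, R, hR, hRS⟩ := ext2 I (axProp_Fr p hp) a ha hinj S (fun x hx => (hK x).1 (hSK x hx)) N hN0 hN
    let f : K → UP W := fun x => if h : ∃ z, R x z then h.choose else 0
    have hf : ∀ (x : K) z, R x z → f x = z := by
      intro x z h
      have hex : ∃ z, R x z := ⟨z, h⟩
      have : f x = hex.choose := dif_pos hex
      rw [this]
      exact hR.func hex.choose_spec h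
    choose F hF using fun x : K => qm_surj (f x)
    have hev : ∀ m ∈ Finset.range n, ∀ᶠ i in (UF : Filter ℕ), Q m i (fun x => F x i) := by
      intro m hm
      have hx : ((en m).1 : O) ∈ S := Finset.mem_biUnion.2 ⟨m, hm, Finset.mem_insert_self _ _⟩
      have hy : ((en m).2.1 : O) ∈ S := Finset.mem_biUnion.2 ⟨m, hm,
        Finset.mem_insert_of_mem (Finset.mem_singleton_self _)⟩
      obtain ⟨z, hz1, hz2, hz3⟩ := hRS _ hx
      obtain ⟨w, hw1, -, -⟩ := hRS _ hy
      set x := (en m).1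
      set y := (en m).2.1
      have e1 : f (x + y) = f x + f y := by
        rw [hf _ _ hz1, hf _ _ hw1]; exact hf _ _ (hR.add hz1 hw1)
      have e2 : f (x * y) = f x * f y := by
        rw [hf _ _ hz1, hf _ _ hw1]; exact hf _ _ (hR.mul hz1 hw1)
      have e3 : f (j (en m).2.2) = I.i2 (en m).2.2 := hf _ _ (hR.const _)
      have e4 : Fr W p (f x) = f ((t1 ^ (l % Nx x)) x) := by
        rw [pow_mod_fix t1 (hNx x), hf _ _ hz1]
        refine (hf _ _ ?_).symm
        rw [ht1p]; exact hz2
      have e5 : t1 x ≠ x → Fr W p (f x) ≠ f x := by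
        intro h
        rw [hf _ _ hz1]
        exact hz3 fun h' => h (Subtype.ext h')
      simp only [← hF, ← hcc, ← map_add, ← map_mul] at e1 e2 e3 e4 e5
      rw [qm_eq] at e1 e2 e3
      rw [Fr_eq_iff] at e4
      have e5' : t1 x ≠ x → ∀ᶠ i in (UF : Filter ℕ), F x i ^ p i ≠ F x i := by
        intro h
        have := e5 h
        rwa [Fr_qm, qm_ne] at this
      have e6 : ∀ᶠ i in (UF : Filter ℕ), t1 x ≠ x → F x i ^ p i ≠ F x i := by
        by_cases h : t1 x = x
        · exact Filter.Eventually.of_forall fun i h' => absurd h h'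
        · filter_upwards [e5' h] with i hi _ using hi
      filter_upwards [e1, e2, e3, e4, e6] with i h1 h2 h3 h4 h5
      exact ⟨h1, h2, h3, ⟨_, Nat.mod_lt _ (hNx0 x), h4⟩, h5⟩
    have := (Filter.eventually_all_finset _).2 hev
    filter_upwards [this] with i hi
    exact ⟨fun x => F x i, fun m hm => hi m (Finset.mem_range.2 hm)⟩
  obtain ⟨fi, hfi⟩ := sat (A := fun i => K → W i) (fun i => ⟨0⟩) Q hfs
  let f : K → UP W := fun x => qm fun i => fi i x
  have hfadd : ∀ x y, f (x + y) = f x + f y := by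
    intro x y
    obtain ⟨m, hm⟩ := hen (x, y, 0)
    have := hfi m
    simp only [Q, hm] at this
    simp only [f, ← map_add, qm_eq]
    filter_upwards [this] with i h using h.1
  have hfmul : ∀ x y, f (x * y) = f x * f y := by
    intro x y
    obtain ⟨m, hm⟩ := hen (x, y, 0)
    have := hfi m
    simp only [Q, hm] at this
    simp only [f, ← map_mul, qm_eq]
    filter_upwards [this] with i h using h.2.1
  have hfc : ∀ c, f (j c) = I.i2 c := by
    intro c
    obtain ⟨m, hm⟩ := hen (0, 0, c)
    have := hfi m
    simp only [Q, hm] at this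
    rw [← hcc]
    simp only [f, qm_eq]
    filter_upwards [this] with i h using h.2.2.1
  have hff : ∀ x, ∃ k, Fr W p (f x) = f ((t1 ^ k) x) := by
    intro x
    obtain ⟨m, hm⟩ := hen (x, 0, 0)
    have := hfi m
    simp only [Q, hm] at this
    have h2 : ∀ᶠ i in (UF : Filter ℕ), ∃ k ∈ Set.Iio (Nx x), fi i x ^ p i = fi i ((t1 ^ k) x) := by
      filter_upwards [this] with i h using h.2.2.2.1
    rw [Ultrafilter.eventually_exists_mem_iff (Set.finite_Iio _)] at h2
    obtain ⟨k, -, hk⟩ := h2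
    exact ⟨k, (Fr_eq_iff p).2 hk⟩
  have hfx : ∀ x, t1 x ≠ x → Fr W p (f x) ≠ f x := by
    intro x hx
    obtain ⟨m, hm⟩ := hen (x, 0, 0)
    have := hfi m
    simp only [Q, hm] at this
    simp only [f, Fr_qm, qm_ne]
    filter_upwards [this] with i h using h.2.2.2.2 hx
  let fh : K →+* UP W :=
    { toFun := f
      map_one' := by have := hfc 1; rwa [map_one, map_one] at this
      map_zero' := by have := hfc 0; rwa [map_zero, map_zero] at this
      map_add' := hfadd
      map_mul' := hfmul }
  have hfh : Function.Injective f := fh.injective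
  choose kx hkx using hff
  let t2f : K → K := fun x => (t1 ^ (kx x)) x
  have ht2 : ∀ x, Fr W p (f x) = f (t2f x) := hkx
  let t2 : K →+* K :=
    { toFun := t2f
      map_one' := hfh (by rw [← ht2]; change Fr W p (fh 1) = fh 1; rw [map_one, map_one])
      map_zero' := hfh (by rw [← ht2]; change Fr W p (fh 0) = fh 0; rw [map_zero, map_zero])
      map_add' := fun x y => hfh (by rw [← ht2, hfadd, map_add, hfadd, ht2, ht2])
      map_mul' := fun x y => hfh (by rw [← ht2, hfmul, map_mul, hfmul, ht2, ht2]) }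
  refine ⟨K, inferInstance, hKa, charZero_of_injective_ringHom j.injective, hKc,
    { i1 := K.subtype, i2 := fh, t1 := t1, t2 := t2, h1 := fun x => rfl, h2 := ht2,
      fin1 := fun x => ⟨Nx x, hNx0 x, hNx x⟩, fin2 := ?_, fix := ?_ }, j, ⟨a, haK⟩, fun x => rfl, hfc, rfl⟩
  · intro x
    obtain ⟨N, hN, h⟩ := periodic_of_finite t2 t2.injective ((fun k => (t1 ^ k) x) '' Set.Iio (Nx x))
      ((Set.finite_Iio _).image _) (by
        rintro _ ⟨k, -, rfl⟩
        refine ⟨(kx ((t1 ^ k) x) + k) % Nx x, Nat.mod_lt _ (hNx0 x), ?_⟩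
        simp only
        rw [pow_mod_fix t1 (hNx x), pow_add]
        rfl) x ⟨0, hNx0 x, rfl⟩
    exact ⟨N, hN, by rw [pow_eq_iterate]; exact h⟩
  · intro x
    constructor
    · intro h
      exact iter_fix h _
    · intro h
      by_contra h'
      refine hfx x h' ?_
      rw [ht2]
      exact congrArg f h

end forth
end AxP

end

section
set_option linter.style.haveILetI false
set_option linter.unusedSectionVars false
open Polynomial

namespace AxP
open FirstOrder FirstOrder.Language

/-- the empty assignment -/
def e0 (R : Type) : Empty → R := fun e => e.elim

/-- realization of a term in a ring -/
def TR (R : Type) [Ring R] {α : Type} (t : Language.ring.Term α) (v : α → R) : R :=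
  letI := Ring.compatibleRingOfRing R
  t.realize v

/-- realization of a bounded formula in a ring -/
def RZ (R : Type) [Ring R] {n : ℕ} (ψ : Language.ring.BoundedFormula Empty n) (x : Fin n → R) : Prop :=
  letI := Ring.compatibleRingOfRing R
  ψ.Realize (e0 R) x

theorem RZ_equal (R : Type) [Ring R] {n : ℕ} (t₁ t₂ : Language.ring.Term (Empty ⊕ Fin n))
    (x : Fin n → R) : RZ R (t₁.bdEqual t₂) x ↔ TR R t₁ (Sum.elim (e0 _) x) = TR R t₂ (Sum.elim (e0 _) x) :=
  Iff.rfl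

theorem realize_hom {R S : Type} [Ring R] [Ring S] (f : R →+* S) {α : Type}
    (t : Language.ring.Term α) (v : α → R) :
    f (TR R t v) = TR S t (fun a => f (v a)) := by
  unfold TR
  letI := Ring.compatibleRingOfRing R
  letI := Ring.compatibleRingOfRing S
  induction t with
  | var a => rfl
  | func g ts ih =>
    simp only [Term.realize_func]
    cases g with
    | add => exact (map_add f _ _).trans (congrArg₂ _ (ih 0) (ih 1))
    | mul => exact (map_mul f _ _).trans (congrArg₂ _ (ih 0) (ih 1))
    | neg => exact (map_neg f _).trans (congrArg _ (ih 0))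
    | zero => exact map_zero f
    | one => exact map_one f

section
variable {W : ℕ → Type} [∀ i, Field (W i)] [∀ i, IsAlgClosed (W i)] (p : ℕ → ℕ)
  [∀ i, Fact (p i).Prime] [∀ i, CharP (W i) (p i)]

/-- the diagonal embedding of the ultraproduct of prime fields -/
noncomputable def zm (W : ℕ → Type) [∀ i, Field (W i)] (p : ℕ → ℕ)
    [∀ i, Fact (p i).Prime] [∀ i, CharP (W i) (p i)] (y : ∀ i, ZMod (p i)) : UP W :=
  qm fun i => ZMod.castHom (dvd_refl (p i)) (W i) (y i)

theorem Fr_zm (y : ∀ i, ZMod (p i)) : Fr W p (zm W p y) = zm W p y := by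
  rw [zm, Fr_qm]
  congr 1
  funext i
  rw [← map_pow, ZMod.pow_card]

theorem zm_surj {z : UP W} (h : Fr W p z = z) : ∃ y, zm W p y = z := by
  obtain ⟨x, rfl⟩ := qm_surj z
  rw [Fr_qm, qm_eq] at h
  have : ∀ i, ∃ y : ZMod (p i), x i ^ p i = x i → ZMod.castHom (dvd_refl (p i)) (W i) y = x i := by
    intro i
    by_cases hx : x i ^ p i = x i
    · have h1 := (Subfield.mem_bot_iff_pow_eq_self (F := W i) (p := p i)).2 hx
      rw [← ZMod.fieldRange_castHom_eq_bot (p i)] at h1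
      obtain ⟨y, hy⟩ := h1
      exact ⟨y, fun _ => hy⟩
    · exact ⟨0, fun h => absurd h hx⟩
  choose y hy using this
  refine ⟨y, ?_⟩
  rw [zm, qm_eq]
  filter_upwards [h] with i hi using hy i hi

theorem eq_iff {C : Type} [Field C] (ι : C →+* UP W) {n : ℕ}
    (t₁ t₂ : Language.ring.Term (Empty ⊕ Fin n)) (b : Fin n → C) (x : Fin n → ∀ i, ZMod (p i))
    (hx : ∀ k, zm W p (x k) = ι (b k)) :
    (∀ᶠ i in (UF : Filter ℕ), RZ (ZMod (p i)) (t₁.bdEqual t₂) fun k => x k i) ↔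
      RZ C (t₁.bdEqual t₂) b := by
  have key : ∀ t : Language.ring.Term (Empty ⊕ Fin n),
      ι (TR C t (Sum.elim (e0 _) b)) =
        zm W p (fun i => TR (ZMod (p i)) t (Sum.elim (e0 _) fun k => x k i)) := by
    intro t
    rw [realize_hom]
    let f : ∀ i, ZMod (p i) →+* W i := fun i => ZMod.castHom (dvd_refl (p i)) (W i)
    have h1 : ∀ i, (ZMod.castHom (dvd_refl (p i)) (W i)) (TR (ZMod (p i)) t (Sum.elim (e0 _) fun k => x k i)) = 
          Pi.evalRingHom W i (TR (∀ i, W i) t (Sum.elim (e0 _) fun k => fun i => f i (x k i))) := by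
      intro i
      rw [realize_hom, realize_hom]
      congr 1
      funext a
      rcases a with a | a
      · exact a.elim
      · rfl
    rw [zm]
    simp only [h1]
    change _ = qm (TR (∀ i, W i) t (Sum.elim (e0 _) fun k => fun i => f i (x k i)))
    rw [realize_hom]
    congr 1
    funext a
    rcases a with a | a
    · exact a.elim
    · exact (hx a).symm
  have e : RZ C (t₁.bdEqual t₂) b ↔ ι (TR C t₁ (Sum.elim (e0 _) b))
     = ι (TR C t₂ (Sum.elim (e0 _) b)) :=
    (RZ_equal C _ _ _).trans ι.injective.eq_iff.symm
  rw [e, key, key, zm, zm, qm_eq]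
  apply Filter.eventually_congr
  filter_upwards with i
  rw [(ZMod.castHom (dvd_refl (p i)) (W i)).injective.eq_iff]
  exact RZ_equal (ZMod (p i)) t₁ t₂ (fun k => x k i)

theorem all_iff {n : ℕ} (θ : Language.ring.BoundedFormula Empty (n + 1)) (x : Fin n → ∀ i, ZMod (p i)) :
    (∀ᶠ i in (UF : Filter ℕ), RZ (ZMod (p i)) θ.all fun k => x k i) ↔
      ∀ y : ∀ i, ZMod (p i), ∀ᶠ i in (UF : Filter ℕ), RZ (ZMod (p i)) θ
        fun k => (Fin.snoc (α := fun _ => ∀ i, ZMod (p i)) x y : Fin (n + 1) → ∀ i, ZMod (p i)) k i := by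
  have hs : ∀ (y : ∀ i, ZMod (p i)) i,
    (fun k => (Fin.snoc (α := fun _ => ∀ i, ZMod (p i)) x y : Fin (n + 1) → ∀ i, ZMod (p i)) k i) =
      Fin.snoc (α := fun _ => ZMod (p i)) (fun k => x k i) (y i) := by
    intro y i
    funext k
    refine Fin.lastCases ?_ (fun k => ?_) k
    · simp
    · simp
  constructor
  · intro h y
    filter_upwards [h] with i hi
    rw [hs]
    exact hi (y i)
  · intro h
    by_contra hc
    rw [← Ultrafilter.eventually_not] at hc
    have : ∀ i, ∃ y : ZMod (p i), (¬ RZ (ZMod (p i)) θ.all fun k => x k i) →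
        ¬ RZ (ZMod (p i)) θ (Fin.snoc (α := fun _ => ZMod (p i)) (fun k => x k i) y) := by
      intro i
      by_contra hcc
      push Not at hcc
      exact (hcc 0).1 fun y => (hcc y).2
    choose y hy using this
    obtain ⟨i, h1, h2⟩ := (hc.and (h y)).exists
    rw [hs] at h2
    exact hy i h1 h2

end

section
variable {W W' : ℕ → Type} [∀ i, Field (W i)] [∀ i, IsAlgClosed (W i)] (p : ℕ → ℕ)
  [∀ i, Fact (p i).Prime] [∀ i, CharP (W i) (p i)]
  [∀ i, Field (W' i)] [∀ i, IsAlgClosed (W' i)] (p' : ℕ → ℕ)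
  [∀ i, Fact (p' i).Prime] [∀ i, CharP (W' i) (p' i)]

theorem step (hp' : ∀ B, ∀ᶠ i in (UF : Filter ℕ), B ≤ p' i) {n : ℕ} 
    {C : Type} [Field C] [IsAlgClosed C] [CharZero C] [Countable C]
    (I : PI (Fr W p) (Fr W' p') C) (b : Fin n → C)
    (x : Fin n → ∀ i, ZMod (p i)) (x' : Fin n → ∀ i, ZMod (p' i))
    (hx : ∀ k, zm W p (x k) = I.i1 (b k)) (hx' : ∀ k, zm W' p' (x' k) = I.i2 (b k))
    (y : ∀ i, ZMod (p i)) :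
    ∃ (C1 : Type) (_ : Field C1) (_ : IsAlgClosed C1) (_ : CharZero C1) (_ : Countable C1)
      (I1 : PI (Fr W p) (Fr W' p') C1) (b1 : Fin (n + 1) → C1) (y' : ∀ i, ZMod (p' i)),
      (∀ k, zm W p ((Fin.snoc (α := fun _ => ∀ i, ZMod (p i)) x y : Fin (n + 1) → ∀ i, ZMod (p i)) k) 
        = I1.i1 (b1 k)) ∧
      (∀ k, zm W' p' ((Fin.snoc (α := fun _ => ∀ i, ZMod (p' i)) x' y' : Fin (n + 1) → ∀ i, ZMod (p' i)) k) 
        = I1.i2 (b1 k)) := by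
  obtain ⟨C1, i1, i2, i3, i4, I1, j, b0, h1, h2, h3⟩ := forth p' hp' I (zm W p y) (Fr_zm p y)
  have h4 : I1.t1 b0 = b0 := by
    apply I1.i1.injective
    rw [← I1.h1, h3, Fr_zm]
  have h5 : Fr W' p' (I1.i2 b0) = I1.i2 b0 := by rw [I1.h2, (I1.fix _).1 h4]
  obtain ⟨y', hy'⟩ := zm_surj p' h5
  refine ⟨C1, i1, i2, i3, i4, I1, Fin.snoc (α := fun _ => C1) (fun k => j (b k)) b0, y', ?_, ?_⟩
  · intro k
    refine Fin.lastCases ?_ (fun k => ?_) k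
    · simp [h3]
    · simp [h1, hx]
  · intro k
    refine Fin.lastCases ?_ (fun k => ?_) k
    · simp [hy']
    · simp [h2, hx']

theorem formula_iff (hp : ∀ B, ∀ᶠ i in (UF : Filter ℕ), B ≤ p i)
    (hp' : ∀ B, ∀ᶠ i in (UF : Filter ℕ), B ≤ p' i) {n : ℕ} 
    (ψ : Language.ring.BoundedFormula Empty n) :
    ∀ (C : Type) [Field C] [IsAlgClosed C] [CharZero C] [Countable C]
      (I : PI (Fr W p) (Fr W' p') C) (b : Fin n → C)
      (x : Fin n → ∀ i, ZMod (p i)) (x' : Fin n → ∀ i, ZMod (p' i)),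
      (∀ k, zm W p (x k) = I.i1 (b k)) → (∀ k, zm W' p' (x' k) = I.i2 (b k)) →
      ((∀ᶠ i in (UF : Filter ℕ), RZ (ZMod (p i)) ψ fun k => x k i) ↔
        ∀ᶠ i in (UF : Filter ℕ), RZ (ZMod (p' i)) ψ fun k => x' k i) := by
  induction ψ with
  | falsum => intros; exact Iff.rfl
  | equal t₁ t₂ =>
    intro C _ _ _ _ I b x x' hx hx'
    exact (eq_iff p I.i1 t₁ t₂ b x hx).trans (eq_iff p' I.i2 t₁ t₂ b x' hx').symm
  | rel R => exact R.elim
  | imp f g ihf ihg =>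
    intro C _ _ _ _ I b x x' hx hx'
    have e : ∀ (p : ℕ → ℕ) (x : ∀ i, _ → ZMod (p i)), (∀ᶠ i in (UF : Filter ℕ), RZ (ZMod (p i)) (f.imp g) (x i)) ↔
      ((∀ᶠ i in (UF : Filter ℕ), RZ (ZMod (p i)) f (x i)) → 
        ∀ᶠ i in (UF : Filter ℕ), RZ (ZMod (p i)) g (x i)) := fun p x => Ultrafilter.eventually_imp
    rw [e, e, ihf C I b x x' hx hx', ihg C I b x x' hx hx']
  | all θ ih =>
    intro C _ _ _ _ I b x x' hx hx'
    rw [all_iff, all_iff]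
    constructor
    · intro h y'
      obtain ⟨C1, i1, i2, i3, i4, I1, b1, y, h1, h2⟩ := step p' p hp I.symm b x' x hx' hx y'
      exact (ih C1 I1.symm b1 _ _ h2 h1).1 (h y)
    · intro h y
      obtain ⟨C1, i1, i2, i3, i4, I1, b1, y', h1, h2⟩ := step p p' hp' I b x x' hx hx' y
      exact (ih C1 I1 b1 _ _ h1 h2).2 (h y')

theorem RZ_sentence (R : Type) [Ring R] (ρ : Language.ring.Sentence) (x : Fin 0 → R) :
    RZ R ρ x ↔ (letI := Ring.compatibleRingOfRing R; R ⊨ ρ) := by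
  unfold RZ Sentence.Realize Formula.Realize
  rw [Subsingleton.elim x default, Subsingleton.elim (e0 R) default]

theorem RZ_zmod (q : ℕ) (ρ : Language.ring.Sentence) (x : Fin 0 → ZMod q) :
    RZ (ZMod q) ρ x ↔ (letI := Ring.compatibleRingOfRing (ZMod q); (ZMod q) ⊨ ρ) := 
  RZ_sentence _ _ _

theorem sentence_iff (hp : ∀ B, ∀ᶠ i in (UF : Filter ℕ), B ≤ p i)
    (hp' : ∀ B, ∀ᶠ i in (UF : Filter ℕ), B ≤ p' i) (ρ : Language.ring.Sentence)
    (C : Type) [Field C] [IsAlgClosed C] [CharZero C] [Countable C]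
    (I : PI (Fr W p) (Fr W' p') C) (P : ℕ → Prop) 
    (hP : ∀ q : ℕ, q.Prime → 
      ((letI := Ring.compatibleRingOfRing (ZMod q); (ZMod q) ⊨ ρ) ↔ P q)) :
    (∀ᶠ i in (UF : Filter ℕ), P (p i)) ↔ ∀ᶠ i in (UF : Filter ℕ), P (p' i) := by
  have h := formula_iff p p' hp hp' ρ C I Fin.elim0 (fun k => k.elim0) (fun k => k.elim0)
    (fun k => k.elim0) (fun k => k.elim0)
  refine (Filter.eventually_congr (Filter.Eventually.of_forall fun i => ?_)).trans
    (h.trans (Filter.eventually_congr (Filter.Eventually.of_forall fun i => ?_)))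
  · exact (hP _ (Fact.out)).symm.trans (RZ_zmod (p i) ρ _).symm
  · exact (RZ_zmod (p' i) ρ _).trans (hP _ (Fact.out))

end
end AxP

end

section
set_option linter.style.haveILetI false
set_option linter.unusedSectionVars false
open Polynomial

namespace AxP

/-- the algebraic numbers -/
abbrev Qb : Type := AlgebraicClosure ℚ

instance instAlgQb : Algebra.IsAlgebraic ℚ Qb := by
  convert! AlgebraicClosure.isAlgebraic ℚ

instance instClQb : IsAlgClosure ℚ Qb := ⟨inferInstance, inferInstance⟩

instance instNormalQb : Normal ℚ Qb := IsAlgClosure.normal _ _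

section
variable {W : ℕ → Type} [∀ i, Field (W i)] [∀ i, IsAlgClosed (W i)] (p : ℕ → ℕ)
  [∀ i, Fact (p i).Prime] [∀ i, CharP (W i) (p i)]

open Classical in
theorem init_hom (hp : ∀ B, ∀ᶠ i in (UF : Filter ℕ), B ≤ p i) (E : IntermediateField ℚ Qb)
    (Em : ℕ → IntermediateField ℚ Qb) (hcov : ∀ x ∈ E, ∀ᶠ m in (UF : Filter ℕ), x ∈ Em m)
    (f : ∀ m, integralClosure ℤ (Em m) →+* ZMod (p m)) :
    ∃ h : E →+* UP W, ∀ x, Fr W p (h x) = h x := by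
  haveI := charZero_up (W := W) p hp
  let R := integralClosure ℤ E
  have hintg : ∀ (x : R) m (h : ((x : E) : Qb) ∈ Em m), IsIntegral ℤ (⟨((x : E) : Qb), h⟩ : Em m) := by
    intro x m h
    have h1 : IsIntegral ℤ (x : E) := x.2
    have h2 : IsIntegral ℤ ((x : E) : Qb) := h1.map (E.val.restrictScalars ℤ)
    exact (isIntegral_algHom_iff ((Em m).val.restrictScalars ℤ) (Em m).val.injective).1 h2
  let g0 : R → ∀ m, ZMod (p m) := fun x m =>
    if h : ((x : E) : Qb) ∈ Em m then f m ⟨⟨_, h⟩, hintg x m h⟩ else 0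
  let c : ∀ m, ZMod (p m) →+* W m := fun m => ZMod.castHom (dvd_refl (p m)) (W m)
  let g : R →+* UP W :=
    { toFun := fun x => zm W p (g0 x)
      map_one' := by
        rw [zm, ← map_one qm, qm_eq]
        filter_upwards [hcov 1 E.one_mem] with m hm
        have hm' : (((1 : R) : E) : Qb) ∈ Em m := hm
        simp only [g0, dif_pos hm']
        have : f m ⟨⟨_, hm'⟩, hintg 1 m hm'⟩ = 1 := by
          rw [← map_one (f m)]; rfl
        rw [this, map_one]; rfl
      map_mul' := by
        intro x y
        simp only [zm]
        rw [← map_mul qm, qm_eq]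
        filter_upwards [hcov _ (x : E).2, hcov _ (y : E).2, hcov _ ((x * y : R) : E).2] with m h1 h2 h3
        simp only [g0, dif_pos h1, dif_pos h2, dif_pos h3, Pi.mul_apply]
        rw [← map_mul, ← map_mul]; rfl
      map_zero' := by
        rw [zm, ← map_zero qm, qm_eq]
        filter_upwards [hcov 0 E.zero_mem] with m hm
        have hm' : (((0 : R) : E) : Qb) ∈ Em m := hm
        simp only [g0, dif_pos hm']
        have : f m ⟨⟨_, hm'⟩, hintg 0 m hm'⟩ = 0 := by
          rw [← map_zero (f m)]; rfl
        rw [this, map_zero]; rfl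
      map_add' := by
        intro x y
        simp only [zm]
        rw [← map_add qm, qm_eq]
        filter_upwards [hcov _ (x : E).2, hcov _ (y : E).2, hcov _ ((x + y : R) : E).2] with m h1 h2 h3
        simp only [g0, dif_pos h1, dif_pos h2, dif_pos h3, Pi.add_apply]
        rw [← map_add, ← map_add]; rfl }
  have hg : Function.Injective g := by
    rw [RingHom.injective_iff_ker_eq_bot]
    apply Ideal.eq_bot_of_comap_eq_bot (R := ℤ)
    rw [eq_bot_iff]
    intro n hn
    rw [Ideal.mem_comap, RingHom.mem_ker, eq_intCast, map_intCast, Int.cast_eq_zero] at hn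
    exact hn
  haveI : Algebra.IsAlgebraic ℚ E := Algebra.IsAlgebraic.tower_bot ℚ E Qb
  haveI : Algebra.IsAlgebraic ℤ E := (IsFractionRing.comap_isAlgebraic_iff (A := ℤ) (K := ℚ) (C := E)).2 inferInstance
  haveI : IsFractionRing R E := integralClosure.isFractionRing_of_algebraic (A := ℤ) (L := E)
    (fun x hx => by simpa using hx)
  refine ⟨IsFractionRing.lift hg, fun x => ?_⟩
  have : (Fr W p).comp (IsFractionRing.lift hg : E →+* UP W) = IsFractionRing.lift hg := by
    apply IsLocalization.ringHom_ext (nonZeroDivisors R)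
    ext r
    simp only [RingHom.comp_apply, IsFractionRing.lift_algebraMap]
    exact Fr_zm p _
  exact RingHom.congr_fun this x

/-- data on one side -/
theorem init_side (hp : ∀ B, ∀ᶠ i in (UF : Filter ℕ), B ≤ p i) (E : IntermediateField ℚ Qb)
    (s5 : Qb) (hs5 : s5 ^ 2 = 5) (hmax : ∀ E' : IntermediateField ℚ Qb, s5 ∉ E' → E ≤ E' → E' = E)
    (h5 : ∀ i, ∀ x : ZMod (p i), x ^ 2 ≠ 5)
    (h : E →+* UP W) (hh : ∀ x, Fr W p (h x) = h x) :
    ∃ (i1 : Qb →+* UP W) (t1 : Qb →+* Qb), (∀ x, Fr W p (i1 x) = i1 (t1 x)) ∧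
      (∀ x, ∃ N, 0 < N ∧ (t1 ^ N) x = x) ∧ ∀ x, t1 x = x ↔ x ∈ E := by
  haveI := charZero_up (W := W) p hp
  letI : Algebra E (UP W) := h.toAlgebra
  obtain ⟨i1, hi1⟩ : ∃ i1 : Qb →+* UP W, ∀ x : E, i1 x = h x := by
    haveI : Algebra.IsAlgebraic E Qb := Algebra.IsAlgebraic.tower_top (K := ℚ) E
    let l : Qb →ₐ[E] UP W := IsAlgClosed.lift
    exact ⟨l, fun x => l.commutes x⟩
  letI : Algebra Qb (UP W) := i1.toAlgebra
  haveI : IsScalarTower ℚ Qb (UP W) := IsScalarTower.of_algebraMap_eq' (Subsingleton.elim _ _)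
  let φ : UP W →ₐ[ℚ] UP W := (Fr W p).toRatAlgHom
  let t : Qb →ₐ[ℚ] Qb := φ.restrictNormal Qb
  have ht : ∀ x, Fr W p (i1 x) = i1 (t x) := fun x => (φ.restrictNormal_commutes Qb x).symm
  refine ⟨i1, t, ht, ?_, ?_⟩
  · intro x
    have hx0 : minpoly ℚ x ≠ 0 := minpoly.ne_zero (Algebra.IsIntegral.isIntegral x)
    obtain ⟨N, hN, h1⟩ := periodic_of_finite t t.injective ((minpoly ℚ x).rootSet Qb)
      (rootSet_finite _ _) (fun y hy => by
        rw [mem_rootSet_of_ne hx0] at hy ⊢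
        rw [aeval_algHom_apply, hy, map_zero]) x (by
        rw [mem_rootSet_of_ne hx0]; exact minpoly.aeval _ _)
    refine ⟨N, hN, ?_⟩
    rw [RingHom.coe_pow]
    exact h1
  · let E' : IntermediateField ℚ Qb := AlgHom.equalizer t (AlgHom.id ℚ Qb) |>.toIntermediateField (by
      intro x hx
      simp only [AlgHom.mem_equalizer, AlgHom.coe_id, id] at hx ⊢
      rw [map_inv₀, hx])
    have hE' : ∀ x, x ∈ E' ↔ t x = x := fun x => Iff.rfl
    have : E' = E := by
      apply hmax
      · rw [hE']
        intro hc
        have h1 := ht s5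
        rw [hc] at h1
        obtain ⟨y, hy⟩ := zm_surj p h1
        have h2 : zm W p y ^ 2 = 5 := by rw [hy, ← map_pow, hs5, map_ofNat]
        rw [zm, ← map_pow, ← map_ofNat qm, qm_eq] at h2
        obtain ⟨i, hi⟩ := h2.exists
        apply h5 i (y i)
        apply (ZMod.castHom (dvd_refl (p i)) (W i)).injective
        rw [map_pow, map_ofNat]
        exact hi
      · intro x hx
        rw [hE']
        apply i1.injective
        rw [← ht]
        have := hi1 ⟨x, hx⟩
        simp only at this
        rw [this, hh]
    intro x
    rw [← this, hE']
    exact Iff.rfl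

end

theorem n2sq : ¬ IsSquare ((2 : ℕ) : ZMod 5) := by decide

theorem n3sq : ¬ IsSquare ((3 : ℕ) : ZMod 5) := by decide

theorem five_nonres {q : ℕ} [Fact q.Prime] (hq : 2 < q) (h : q % 5 = 2 ∨ q % 5 = 3) (x : ZMod q) : x ^ 2 ≠ 5 := by
  haveI : Fact (Nat.Prime 5) := ⟨by norm_num⟩
  intro hx
  have h1 := ZMod.exists_sq_eq_prime_iff_of_mod_four_eq_one (p := 5) (q := q) (by norm_num) (by omega)
  have h2 : IsSquare ((5 : ℕ) : ZMod q) := ⟨x, by rw [← sq, hx]; rfl⟩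
  have h3 := h1.2 h2
  rw [← Nat.mod_add_div q 5] at h3
  have e : ((q % 5 + 5 * (q / 5) : ℕ) : ZMod 5) = ((q % 5 : ℕ) : ZMod 5) := by
    push_cast
    have : (5 : ZMod 5) = 0 := rfl
    rw [this]; ring
  rw [e] at h3
  rcases h with h | h <;> rw [h] at h3
  · exact n2sq h3
  · exact n3sq h3

theorem exists_max (s5 : Qb) (hs : ∀ r : ℚ, algebraMap ℚ Qb r ≠ s5) : ∃ E : IntermediateField ℚ Qb, s5 ∉ E ∧
    ∀ E' : IntermediateField ℚ Qb, s5 ∉ E' → E ≤ E' → E' = E := by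
  obtain ⟨E, -, hE⟩ := zorn_le_nonempty₀ {K : IntermediateField ℚ Qb | s5 ∉ K} (by
    intro c hc hchain y hy
    refine ⟨sSup c, ?_, fun z hz => le_sSup hz⟩
    rw [Set.mem_ofPred_eq]
    intro hmem
    haveI : Nonempty c := ⟨⟨y, hy⟩⟩
    rw [sSup_eq_iSup', ← SetLike.mem_coe, IntermediateField.coe_iSup_of_directed
      hchain.directed] at hmem
    obtain ⟨K, hK⟩ := Set.mem_iUnion.1 hmem
    exact hc K.2 hK) ⊥ (by
      rw [Set.mem_ofPred_eq, IntermediateField.mem_bot]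
      rintro ⟨r, hr⟩
      exact hs r hr)
  exact ⟨E, hE.1, fun E' h1 h2 => le_antisymm (hE.2 h1 h2) h2⟩

/-- the arithmetic input (Part C) -/
def ArithInput : Prop := ∀ (E : Type) [Field E] [NumberField E], (∀ x : E, x ^ 2 ≠ 5) →
  ∀ (B r : ℕ), (r = 2 ∨ r = 3) → ∃ q, B ≤ q ∧ q.Prime ∧ q % 5 = r ∧
    Nonempty (NumberField.RingOfIntegers E →+* ZMod q)

theorem final (H : ArithInput) : ¬ ∃ ρ : FirstOrder.Language.ring.Sentence, ∀ p : ℕ, p.Prime →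
        ((letI := FirstOrder.Ring.compatibleRingOfRing (ZMod p); FirstOrder.Language.Sentence.Realize (ZMod p) ρ) ↔ p % 5 = 2) := by
  rintro ⟨ρ, hρ⟩
  obtain ⟨s5, hs5⟩ := IsAlgClosed.exists_pow_nat_eq (5 : Qb) (n := 2) (by norm_num)
  have hsr : ∀ r : ℚ, algebraMap ℚ Qb r ≠ s5 := by
    intro r hr
    have h1 : r ^ 2 = 5 := by
      apply (algebraMap ℚ Qb).injective
      rw [map_pow, hr, hs5, map_ofNat]
    have : IsSquare (5 : ℚ) := ⟨r, by rw [← h1, sq]⟩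
    rw [Rat.isSquare_iff] at this
    have h2 := this.1
    revert h2
    norm_num
  obtain ⟨E, hE, hmax⟩ := exists_max s5 hsr
  haveI : Countable Qb := by
    have := Algebra.IsAlgebraic.cardinalMk_le_max ℚ Qb
    rw [← Cardinal.mk_le_aleph0_iff]
    exact this.trans (by simp)
  obtain ⟨e, he⟩ := exists_surjective_nat E
  let Em : ℕ → IntermediateField ℚ Qb := fun m =>
    IntermediateField.adjoin ℚ ((fun k => (e k : Qb)) '' Set.Iic m)
  have hEmE : ∀ m, Em m ≤ E := by
    intro m
    rw [IntermediateField.adjoin_le_iff]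
    rintro _ ⟨k, -, rfl⟩
    exact (e k).2
  have hcov : ∀ x ∈ E, ∀ᶠ m in (UF : Filter ℕ), x ∈ Em m := by
    intro x hx
    obtain ⟨k, hk⟩ := he ⟨x, hx⟩
    have h1 : ∀ᶠ m in (UF : Filter ℕ), k ≤ m :=
      (Filter.eventually_ge_atTop k).filter_mono Nat.hyperfilter_le_atTop
    filter_upwards [h1] with m hm
    apply IntermediateField.subset_adjoin
    exact ⟨k, hm, by simp [hk]⟩
  have hnf : ∀ m, NumberField (Em m) := by
    intro m
    haveI : FiniteDimensional ℚ (Em m) := by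
      haveI : Finite ((fun k => (e k : Qb)) '' Set.Iic m) := ((Set.finite_Iic m).image _)
      exact IntermediateField.finiteDimensional_adjoin fun x _ => Algebra.IsIntegral.isIntegral x
    exact {}
  have key : ∀ r, (r = 2 ∨ r = 3) → ∃ p : ℕ → ℕ, ∀ m, m + 3 ≤ p m ∧ (p m).Prime ∧ p m % 5 = r ∧
      Nonempty (integralClosure ℤ (Em m) →+* ZMod (p m)) := by
    intro r hr
    have : ∀ m, ∃ q, m + 3 ≤ q ∧ q.Prime ∧ q % 5 = r ∧
      Nonempty (integralClosure ℤ (Em m) →+* ZMod q) := by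
      intro m
      haveI := hnf m
      refine H (Em m) (fun x hx => ?_) (m + 3) r hr
      have h1 : (x : Qb) ^ 2 = s5 ^ 2 := by
        rw [hs5]
        exact congrArg (fun z : Em m => (z : Qb)) hx
      rcases sq_eq_sq_iff_eq_or_eq_neg.1 h1 with h2 | h2
      · exact hE (h2 ▸ hEmE m x.2)
      · exact hE (by rw [← neg_neg s5, ← h2]; exact E.neg_mem (hEmE m x.2))
    choose p hp using this
    exact ⟨p, hp⟩
  obtain ⟨p, hp⟩ := key 2 (Or.inl rfl)
  obtain ⟨p', hp'⟩ := key 3 (Or.inr rfl)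
  haveI : ∀ i, Fact (p i).Prime := fun i => ⟨(hp i).2.1⟩
  haveI : ∀ i, Fact (p' i).Prime := fun i => ⟨(hp' i).2.1⟩
  have big : ∀ q : ℕ → ℕ, (∀ m, m ≤ q m) → ∀ B, ∀ᶠ i in (UF : Filter ℕ), B ≤ q i := by
    intro q hq B
    have h1 : ∀ᶠ m in (UF : Filter ℕ), B ≤ m :=
      (Filter.eventually_ge_atTop B).filter_mono Nat.hyperfilter_le_atTop
    filter_upwards [h1] with i hi using hi.trans (hq i)
  have bp := big p fun m => (Nat.le_add_right m 3).trans (hp m).1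
  have bp' := big p' fun m => (Nat.le_add_right m 3).trans (hp' m).1
  let W : ℕ → Type := fun i => AlgebraicClosure (ZMod (p i))
  let W' : ℕ → Type := fun i => AlgebraicClosure (ZMod (p' i))
  haveI : ∀ i, CharP (W i) (p i) := fun i => charP_of_injective_algebraMap
    (algebraMap (ZMod (p i)) (W i)).injective (p i)
  haveI : ∀ i, CharP (W' i) (p' i) := fun i => charP_of_injective_algebraMap
    (algebraMap (ZMod (p' i)) (W' i)).injective (p' i)
  obtain ⟨h, hh⟩ := init_hom (W := W) p bp E Em hcov fun m => (hp m).2.2.2.some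
  obtain ⟨h', hh'⟩ := init_hom (W := W') p' bp' E Em hcov fun m => (hp' m).2.2.2.some
  obtain ⟨i1, t1, a1, a2, a3⟩ := init_side p bp E s5 hs5 hmax
    (fun i => five_nonres (by have := (hp i).1; omega) (Or.inl (hp i).2.2.1)) h hh
  obtain ⟨i2, t2, b1, b2, b3⟩ := init_side p' bp' E s5 hs5 hmax
    (fun i => five_nonres (by have := (hp' i).1; omega) (Or.inr (hp' i).2.2.1)) h' hh'
  let I : PI (Fr W p) (Fr W' p') Qb := ⟨i1, i2, t1, t2, a1, b1, a2, b2, fun x => (a3 x).trans (b3 x).symm⟩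
  have fin := (sentence_iff p p' bp bp' ρ Qb I (fun q => q % 5 = 2) hρ).1
    (Filter.Eventually.of_forall fun i => (hp i).2.2.1)
  obtain ⟨i, hi⟩ := fin.exists
  have := (hp' i).2.2.1
  omega

end AxP

end

section
set_option linter.style.haveILetI false
set_option linter.unusedSectionVars false
open Polynomial
namespace AxP
open NumberField IsDedekindDomain Filter Topology

section euler
variable {R : Type} [CommRing R] [IsDedekindDomain R]

open Classical in
theorem euler_step (f : Ideal R →*₀ ℂ) (hf : Summable fun I => ‖f I‖)
    (S : Finset (HeightOneSpectrum R)) :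
    (∑' I : Ideal R, if ∀ v ∈ S, ¬ v.asIdeal ∣ I then f I else 0) =
      (∑' I, f I) * ∏ v ∈ S, (1 - f v.asIdeal) := by
  induction S using Finset.induction_on with
  | empty => simp
  | insert w S hw ih =>
    rw [Finset.prod_insert hw, mul_left_comm, ← ih]
    have hf' := hf.of_norm
    have hsum : ∀ T : Finset (HeightOneSpectrum R),
        Summable fun I : Ideal R => if ∀ v ∈ T, ¬ v.asIdeal ∣ I then f I else 0 := by
      intro T
      refine Summable.of_norm_bounded hf (fun I => ?_)
      split_ifs <;> simp
    have hinj : Function.Injective (fun J : Ideal R => w.asIdeal * J) := by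
      intro a b h
      exact mul_left_cancel₀ w.ne_bot h
    have key : (fun I : Ideal R => if ∀ v ∈ S, ¬ v.asIdeal ∣ I then f I else 0) =
        fun I => (if ∀ v ∈ insert w S, ¬ v.asIdeal ∣ I then f I else 0) +
          (if w.asIdeal ∣ I ∧ ∀ v ∈ S, ¬ v.asIdeal ∣ I then f I else 0) := by
      funext I
      by_cases h1 : ∀ v ∈ S, ¬ v.asIdeal ∣ I <;> by_cases h2 : w.asIdeal ∣ I <;>
        simp [h1, h2]
    have h2 : (∑' I : Ideal R, if w.asIdeal ∣ I ∧ ∀ v ∈ S, ¬ v.asIdeal ∣ I then f I else 0) =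
        f w.asIdeal * ∑' I : Ideal R, if ∀ v ∈ S, ¬ v.asIdeal ∣ I then f I else 0 := by
      rw [← tsum_mul_left, ← hinj.tsum_eq]
      · refine tsum_congr fun J => ?_
        have : (w.asIdeal ∣ w.asIdeal * J ∧ ∀ v ∈ S, ¬ v.asIdeal ∣ w.asIdeal * J) ↔
            ∀ v ∈ S, ¬ v.asIdeal ∣ J := by
          constructor
          · rintro ⟨-, h⟩ v hv hd
            exact h v hv (dvd_mul_of_dvd_right hd _)
          · refine fun h => ⟨dvd_mul_right _ _, fun v hv hd => ?_⟩
            have hp : Prime v.asIdeal := v.prime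
            rcases hp.dvd_or_dvd hd with h' | h'
            · have : v.asIdeal = w.asIdeal := by
                have hle : w.asIdeal ≤ v.asIdeal := Ideal.dvd_iff_le.mp h'
                haveI := w.isPrime
                have hm : w.asIdeal.IsMaximal := w.isMaximal
                exact (hm.eq_of_le v.isPrime.ne_top hle).symm
              have : v = w := HeightOneSpectrum.ext this
              exact hw (this ▸ hv)
            · exact h v hv h'
        simp only [this, map_mul]
        split_ifs <;> simp
      · intro I hI
        simp only [Function.mem_support, ne_eq, ite_eq_right_iff, Classical.not_imp] at hI
        obtain ⟨J, rfl⟩ := hI.1.1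
        exact ⟨J, rfl⟩
    have hs2 : Summable (fun I : Ideal R => if w.asIdeal ∣ I ∧ ∀ v ∈ S, ¬ v.asIdeal ∣ I then f I else 0) := by
      refine Summable.of_norm_bounded hf (fun I => ?_)
      split_ifs <;> simp
    have := congrArg tsum key
    rw [(hsum _).tsum_add hs2, h2] at this
    linear_combination (norm := ring_nf) -this
    

open Classical in
theorem euler_tendsto (f : Ideal R →*₀ ℂ) (hf : Summable fun I => ‖f I‖) :
    Tendsto (fun S : Finset (HeightOneSpectrum R) => (∑' I, f I) * ∏ v ∈ S, (1 - f v.asIdeal))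
      atTop (𝓝 1) := by
  have h1 : (1 : ℂ) = ∑' I : Ideal R, if I = 1 then f I else 0 := by
    rw [tsum_ite_eq, map_one]
  refine Tendsto.congr (fun S => euler_step f hf S) ?_
  conv => rhs; rw [h1]
  refine tendsto_tsum_of_dominated_convergence hf ?_ ?_
  · intro I
    by_cases hI : I = 1
    · subst hI
      refine tendsto_const_nhds.congr fun S => ?_
      rw [if_pos rfl, if_pos]
      intro v _ hd
      exact v.prime.not_isUnit (isUnit_of_dvd_one hd)
    · rw [if_neg hI]
      by_cases h0 : I = 0
      · subst h0
        simp only [map_zero, ite_self]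
        exact tendsto_const_nhds
      obtain ⟨M, hM, hle⟩ := Ideal.exists_le_maximal I (by simpa using hI)
      have hMb : M ≠ ⊥ := fun h => h0 (by rw [h] at hle; simpa using hle)
      let v : HeightOneSpectrum R := ⟨M, hM.isPrime, hMb⟩
      refine tendsto_const_nhds.congr' ?_
      filter_upwards [eventually_ge_atTop {v}] with S hS
      rw [if_neg]
      intro h
      exact h v (hS (Finset.mem_singleton_self v)) (Ideal.dvd_iff_le.mpr hle)
  · refine Eventually.of_forall fun S I => ?_
    split_ifs <;> simp

/-- Euler product in logarithmic form. -/
theorem euler_log (f : Ideal R →*₀ ℂ) (hf : Summable fun I => ‖f I‖)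
    (h1 : ∀ v : HeightOneSpectrum R, ‖f v.asIdeal‖ < 1) :
    (∑' I, f I) * Complex.exp (∑' v : HeightOneSpectrum R, Complex.log (1 - f v.asIdeal)) = 1 := by
  have hinj : Function.Injective (fun v : HeightOneSpectrum R => v.asIdeal) :=
    fun a b h => HeightOneSpectrum.ext h
  have hs : Summable fun v : HeightOneSpectrum R => f v.asIdeal := (hf.comp_injective hinj).of_norm
  have hl : Summable fun v : HeightOneSpectrum R => Complex.log (1 - f v.asIdeal) := by
    simpa [sub_eq_add_neg] using Complex.summable_log_one_add_of_summable hs.neg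
  have h2 := (Complex.continuous_exp.tendsto _).comp hl.hasSum
  refine tendsto_nhds_unique ?_ (euler_tendsto f hf)
  refine Tendsto.const_mul _ (h2.congr fun S => ?_)
  simp only [Function.comp_apply]
  rw [Complex.exp_sum]
  refine Finset.prod_congr rfl fun v _ => Complex.exp_log ?_
  intro h
  have := h1 v
  rw [← sub_eq_zero.mp h] at this
  simp at this
end euler

section nf
variable (K : Type) [Field K] [NumberField K]

theorem sum_card_div : Tendsto (fun n : ℕ ↦ (∑ k ∈ Finset.Icc 1 n,
    (Nat.card {I : Ideal (𝓞 K) // Ideal.absNorm I = k} : ℝ)) / n) atTop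
    (𝓝 (dedekindZeta_residue K)) := by
  refine ((Ideal.tendsto_norm_le_div_atTop₀ K).comp tendsto_natCast_atTop_atTop).congr fun n ↦ ?_
  simp only [Function.comp_apply, Nat.cast_le, ← Nat.cast_sum]
  congr
  rw [← add_left_inj 1, ← Ideal.card_norm_le_eq_card_norm_le_add_one,
    show Finset.Icc 1 n = Finset.Ioc 0 n from Finset.Icc_succ_left_eq_Ioc _ _,
    show 1 = Nat.card {I : Ideal (𝓞 K) // Ideal.absNorm I = 0} by simp [Ideal.absNorm_eq_zero_iff],
    Finset.sum_Ioc_add_eq_sum_Icc (n.zero_le),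
    ← Finset.card_preimage_eq_sum_card_image_eq (fun k _ ↦ Ideal.finite_setOfPred_absNorm_eq k)]
  simp [Set.coe_eq_subtype]

theorem dz_summable {σ : ℝ} (hσ : 1 < σ) :
    LSeriesSummable (fun n ↦ ((Nat.card {I : Ideal (𝓞 K) // Ideal.absNorm I = n} : ℝ) : ℂ)) σ := by
  refine LSeriesSummable_of_sum_norm_bigO_and_nonneg (r := 1) ?_ (fun _ => Nat.cast_nonneg _)
    zero_le_one (by simpa using hσ)
  have h := (sum_card_div K).isBigO_one ℝ
  have h2 := h.mul (Asymptotics.isBigO_refl (fun n : ℕ => (n : ℝ)) atTop)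
  refine (h2.congr' ?_ ?_)
  · filter_upwards [eventually_ne_atTop 0] with n hn
    field_simp
  · filter_upwards with n
    simp

theorem ideal_hasSum {σ : ℝ} (hσ : 1 < σ) :
    HasSum (fun I : Ideal (𝓞 K) => (Ideal.absNorm I : ℝ) ^ (-σ)) (dedekindZeta K σ).re := by
  have h := dz_summable K hσ
  have h1 : HasSum (fun n : ℕ => (Nat.card {I : Ideal (𝓞 K) // Ideal.absNorm I = n} : ℝ) * (n : ℝ) ^ (-σ))
      (dedekindZeta K σ).re := by
    have h2 := Complex.hasSum_re h.hasSum
    convert! h2 using 2 with n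
    rcases eq_or_ne n 0 with rfl | hn
    · simp [Real.zero_rpow (show -σ ≠ 0 by linarith)]
    · rw [LSeries.term_of_ne_zero hn, Real.rpow_neg (by positivity)]
      have : ((n : ℂ) ^ (σ : ℂ)) = (((n : ℝ) ^ σ : ℝ) : ℂ) := by
        rw [Complex.ofReal_cpow (by positivity)]; simp
      rw [this]
      norm_cast
  let e := Equiv.sigmaFiberEquiv (fun I : Ideal (𝓞 K) => Ideal.absNorm I)
  rw [← e.hasSum_iff]
  have hfin : ∀ n, Finite {I : Ideal (𝓞 K) // Ideal.absNorm I = n} := fun n =>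
    (Ideal.finite_setOfPred_absNorm_eq n).to_subtype
  have hfib : ∀ n, HasSum (fun I : {I : Ideal (𝓞 K) // Ideal.absNorm I = n} =>
      (Ideal.absNorm I.1 : ℝ) ^ (-σ))
      ((Nat.card {I : Ideal (𝓞 K) // Ideal.absNorm I = n} : ℝ) * (n : ℝ) ^ (-σ)) := by
    intro n
    haveI := Fintype.ofFinite {I : Ideal (𝓞 K) // Ideal.absNorm I = n}
    have hh := hasSum_fintype (fun I : {I : Ideal (𝓞 K) // Ideal.absNorm I = n} =>
      (Ideal.absNorm I.1 : ℝ) ^ (-σ))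
    convert! hh using 1
    rw [Finset.sum_congr rfl (g := fun _ => (n : ℝ) ^ (-σ)) (fun I _ => by rw [I.2])]
    simp
  refine HasSum.sigma_of_hasSum h1 hfib ?_
  rw [summable_sigma_of_nonneg]
  · refine ⟨fun n => (hfib n).summable, ?_⟩
    refine h1.summable.congr fun n => ?_
    exact ((hfib n).tsum_eq).symm
  · intro x
    simp only [Function.comp]
    positivity

theorem ideal_summable {σ : ℝ} (hσ : 1 < σ) :
    Summable (fun I : Ideal (𝓞 K) => (Ideal.absNorm I : ℝ) ^ (-σ)) := (ideal_hasSum K hσ).summable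

theorem ideal_tsum_residue : Tendsto (fun σ : ℝ => (σ - 1) * ∑' I : Ideal (𝓞 K),
    (Ideal.absNorm I : ℝ) ^ (-σ)) (𝓝[>] 1) (𝓝 (dedekindZeta_residue K)) := by
  have h := (Complex.continuous_re.tendsto _).comp (tendsto_sub_one_mul_dedekindZeta_nhdsGT K)
  rw [Complex.ofReal_re] at h
  refine h.congr' ?_
  filter_upwards [self_mem_nhdsWithin] with σ hσ
  rw [(ideal_hasSum K hσ).tsum_eq]
  have : ((σ : ℂ) - 1) = ((σ - 1 : ℝ) : ℂ) := by push_cast; rfl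
  simp only [Function.comp]
  rw [this, Complex.re_ofReal_mul]

end nf
end AxP

end

section
set_option linter.style.haveILetI false
set_option linter.unusedSectionVars false
open Polynomial
namespace AxP
open NumberField IsDedekindDomain Filter Topology

section nf
variable (K : Type) [Field K] [NumberField K]

/-- norm of a prime -/
noncomputable def nv {K : Type} [Field K] [NumberField K] (v : HeightOneSpectrum (𝓞 K)) : ℕ :=
  Ideal.absNorm v.asIdeal

theorem two_le_nv {K : Type} [Field K] [NumberField K] (v : HeightOneSpectrum (𝓞 K)) :
    2 ≤ nv v := by
  have h1 : nv v ≠ 0 := by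
    unfold nv; rw [Ne, Ideal.absNorm_eq_zero_iff]; exact v.ne_bot
  have h2 : nv v ≠ 1 := by
    unfold nv; rw [Ne, Ideal.absNorm_eq_one_iff]; exact v.isPrime.ne_top
  omega

theorem nv_summable {σ : ℝ} (hσ : 1 < σ) :
    Summable (fun v : HeightOneSpectrum (𝓞 K) => (nv v : ℝ) ^ (-σ)) :=
  (ideal_summable K hσ).comp_injective (i := fun v : HeightOneSpectrum (𝓞 K) => v.asIdeal)
    (fun _ _ h => HeightOneSpectrum.ext h)

theorem nv_eq (v : HeightOneSpectrum (𝓞 K)) : ∃ k ≠ 0, nv v = (nv v).minFac ^ k := by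
  haveI := v.isMaximal
  obtain ⟨p, k, hk, -, hp, h⟩ := Ideal.exists_prime_and_absNorm_eq_pow v.asIdeal
  have h' : nv v = p ^ k := h
  refine ⟨k, hk.ne', ?_⟩
  rw [h', Nat.Prime.pow_minFac hp hk.ne']

theorem minFac_mem (v : HeightOneSpectrum (𝓞 K)) : (((nv v).minFac : ℕ) : 𝓞 K) ∈ v.asIdeal := by
  obtain ⟨k, hk, h⟩ := nv_eq K v
  have := Ideal.absNorm_mem v.asIdeal
  change ((nv v : ℕ) : 𝓞 K) ∈ _ at this
  rw [h, Nat.cast_pow] at this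
  exact v.isPrime.mem_of_pow_mem _ this

theorem card_fiber (T : Finset (HeightOneSpectrum (𝓞 K))) (p : ℕ) (hp : 2 ≤ p)
    (hT : ∀ v ∈ T, (nv v).minFac = p) : T.card ≤ Module.finrank ℤ (𝓞 K) := by
  classical
  have h1 : (∏ v ∈ T, v.asIdeal) ∣ Ideal.span {(p : 𝓞 K)} := by
    have := Finset.prod_primes_dvd (s := T.image fun v => v.asIdeal) (Ideal.span {(p : 𝓞 K)}) ?_ ?_
    · rwa [Finset.prod_image (fun a _ b _ h => HeightOneSpectrum.ext h)] at this
    · intro a ha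
      obtain ⟨v, hv, rfl⟩ := Finset.mem_image.mp ha
      exact v.prime
    · intro a ha
      obtain ⟨v, hv, rfl⟩ := Finset.mem_image.mp ha
      rw [Ideal.dvd_iff_le, Ideal.span_singleton_le_iff_mem, ← hT v hv]
      exact minFac_mem K v
  have h2 : (∏ v ∈ T, nv v) ∣ p ^ Module.finrank ℤ (𝓞 K) := by
    rw [← Ideal.absNorm_span_natCast, show (∏ v ∈ T, nv v) = Ideal.absNorm (∏ v ∈ T, v.asIdeal) by
      rw [map_prod]; rfl]
    exact map_dvd _ h1
  have h3 : p ^ T.card ≤ ∏ v ∈ T, nv v := by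
    rw [← Finset.prod_const]
    refine Finset.prod_le_prod' fun v hv => ?_
    rw [← hT v hv]
    exact Nat.minFac_le (by have := two_le_nv v; omega)
  have h4 := h3.trans (Nat.le_of_dvd (by positivity) h2)
  exact (Nat.pow_le_pow_iff_right hp).mp h4

theorem summable_minFac : Summable (fun v : HeightOneSpectrum (𝓞 K) =>
    (((nv v).minFac : ℝ) ^ 2)⁻¹) := by
  classical
  have hs : Summable fun k : ℕ => ((k : ℝ) ^ 2)⁻¹ := Real.summable_nat_pow_inv.mpr (by norm_num)
  refine summable_of_sum_le (c := Module.finrank ℤ (𝓞 K) * ∑' k : ℕ, ((k : ℝ) ^ 2)⁻¹)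
    (fun v => by positivity) (fun T => ?_)
  rw [Finset.sum_comp (fun k : ℕ => ((k : ℝ) ^ 2)⁻¹) (fun v : HeightOneSpectrum (𝓞 K) => (nv v).minFac)]
  calc _ ≤ ∑ b ∈ T.image (fun v => (nv v).minFac), (Module.finrank ℤ (𝓞 K) : ℝ) * ((b : ℝ) ^ 2)⁻¹ := by
        refine Finset.sum_le_sum fun b hb => ?_
        obtain ⟨v, hv, rfl⟩ := Finset.mem_image.mp hb
        rw [nsmul_eq_mul]
        gcongr
        refine card_fiber K _ (nv v).minFac ?_ (fun w hw => (Finset.mem_filter.mp hw).2)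
        exact (Nat.minFac_prime (by have := two_le_nv v; omega)).two_le
    _ = Module.finrank ℤ (𝓞 K) * ∑ b ∈ T.image (fun v => (nv v).minFac), ((b : ℝ) ^ 2)⁻¹ := by
        rw [Finset.mul_sum]
    _ ≤ _ := by
        gcongr
        exact hs.sum_le_tsum _ (fun _ _ => by positivity)

open Classical in
/-- primes of degree at least two contribute a bounded amount -/
theorem deg2_bound : ∃ C : ℝ, ∀ σ : ℝ, 1 < σ →
    (∑' v : HeightOneSpectrum (𝓞 K), if (nv v).Prime then 0 else (nv v : ℝ) ^ (-σ)) ≤ C := by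
  refine ⟨∑' v : HeightOneSpectrum (𝓞 K), (((nv v).minFac : ℝ) ^ 2)⁻¹, fun σ hσ => ?_⟩
  refine Summable.tsum_le_tsum (fun v => ?_) ?_ (summable_minFac K)
  · split_ifs with h
    · positivity
    · obtain ⟨k, hk, hv⟩ := nv_eq K v
      have hp := (Nat.minFac_prime (n := nv v) (by have := two_le_nv v; omega))
      have hk2 : 2 ≤ k := by
        by_contra hk2
        have : k = 1 := by omega
        subst this
        rw [pow_one] at hv
        exact h (hv ▸ hp)
      rw [Real.rpow_neg (by positivity)]
      refine inv_anti₀ (by have := hp.pos; positivity) ?_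
      have h1 : (1 : ℝ) ≤ nv v := by exact_mod_cast (by have := two_le_nv v; omega)
      calc ((nv v).minFac : ℝ) ^ 2 ≤ ((nv v).minFac : ℝ) ^ k := by
            refine pow_le_pow_right₀ (by exact_mod_cast hp.one_lt.le) hk2
        _ = (nv v : ℝ) := by exact_mod_cast hv.symm
        _ = (nv v : ℝ) ^ (1 : ℝ) := by simp
        _ ≤ _ := Real.rpow_le_rpow_of_exponent_le h1 hσ.le
  · refine Summable.of_nonneg_of_le (fun v => by split_ifs <;> positivity) (fun v => ?_) (nv_summable K hσ)
    split_ifs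
    · positivity
    · exact le_rfl

/-- the multiplicative function `χ(N I) N I ^ (-s)` -/
noncomputable def fch {N : ℕ} (χ : DirichletCharacter ℂ N) (s : ℂ) (hs : s ≠ 0) :
    Ideal (𝓞 K) →*₀ ℂ where
  toFun I := χ (Ideal.absNorm I : ℕ) * (Ideal.absNorm I : ℂ) ^ (-s)
  map_zero' := by simp [hs]
  map_one' := by simp
  map_mul' I J := by
    rw [map_mul, Nat.cast_mul, map_mul, Nat.cast_mul, Complex.natCast_mul_natCast_cpow]
    ring

theorem fch_norm {N : ℕ} (χ : DirichletCharacter ℂ N) (s : ℂ) (hs : 0 < s.re) (hs' : s ≠ 0) (I : Ideal (𝓞 K)) :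
    ‖fch K χ s hs' I‖ ≤ (Ideal.absNorm I : ℝ) ^ (-s.re) := by
  change ‖χ (Ideal.absNorm I : ℕ) * (Ideal.absNorm I : ℂ) ^ (-s)‖ ≤ _
  rw [norm_mul]
  have h1 := DirichletCharacter.norm_le_one χ (Ideal.absNorm I : ℕ)
  have h2 : ‖(Ideal.absNorm I : ℂ) ^ (-s)‖ = (Ideal.absNorm I : ℝ) ^ (-s.re) := by
    rcases Nat.eq_zero_or_pos (Ideal.absNorm I) with h | h
    · rw [h]; simp [hs', Real.zero_rpow (show -s.re ≠ 0 by linarith)]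
    · rw [Complex.norm_natCast_cpow_of_pos h]; simp
  rw [h2]
  exact mul_le_of_le_one_left (by positivity) h1

theorem fch_summable {N : ℕ} (χ : DirichletCharacter ℂ N) (s : ℂ) (hs : 1 < s.re) (hs' : s ≠ 0) :
    Summable fun I => ‖fch K χ s hs' I‖ :=
  Summable.of_nonneg_of_le (fun _ => norm_nonneg _) (fun I => fch_norm K χ s (by linarith) hs' I)
    (ideal_summable K hs)

theorem fch_half {N : ℕ} (χ : DirichletCharacter ℂ N) (s : ℂ) (hs : 1 < s.re) (hs' : s ≠ 0)
    (v : HeightOneSpectrum (𝓞 K)) : ‖fch K χ s hs' v.asIdeal‖ ≤ 1 / 2 := by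
  refine (fch_norm K χ s (by linarith) hs' _).trans ?_
  have h2 : (2 : ℝ) ≤ nv v := by exact_mod_cast two_le_nv v
  rw [Real.rpow_neg (by positivity), one_div]
  refine inv_anti₀ (by norm_num) ?_
  calc (2 : ℝ) ≤ nv v := h2
    _ = (nv v : ℝ) ^ (1 : ℝ) := by simp
    _ ≤ _ := Real.rpow_le_rpow_of_exponent_le (by linarith) hs.le

theorem fch_log_summable {N : ℕ} (χ : DirichletCharacter ℂ N) (s : ℂ) (hs : 1 < s.re) (hs' : s ≠ 0) :
    Summable fun v : HeightOneSpectrum (𝓞 K) => Complex.log (1 - fch K χ s hs' v.asIdeal) := by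
  have hinj : Function.Injective (fun v : HeightOneSpectrum (𝓞 K) => v.asIdeal) :=
    fun a b h => HeightOneSpectrum.ext h
  have hs := ((fch_summable K χ s hs hs').comp_injective hinj).of_norm
  simpa [sub_eq_add_neg] using! Complex.summable_log_one_add_of_summable hs.neg

theorem fch_prime_summable {N : ℕ} (χ : DirichletCharacter ℂ N) (s : ℂ) (hs : 1 < s.re) (hs' : s ≠ 0) :
    Summable fun v : HeightOneSpectrum (𝓞 K) => fch K χ s hs' v.asIdeal :=
  ((fch_summable K χ s hs hs').comp_injective (fun _ _ h => HeightOneSpectrum.ext h)).of_norm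

theorem fch_log_bound : ∃ C : ℝ, ∀ {N : ℕ} (χ : DirichletCharacter ℂ N) (s : ℂ) (_ : 1 < s.re) (hs' : s ≠ 0),
    ‖(∑' v : HeightOneSpectrum (𝓞 K), Complex.log (1 - fch K χ s hs' v.asIdeal)) +
      ∑' v : HeightOneSpectrum (𝓞 K), fch K χ s hs' v.asIdeal‖ ≤ C := by
  refine ⟨∑' v : HeightOneSpectrum (𝓞 K), (nv v : ℝ) ^ (-(2 : ℝ)), fun χ s hs hs' => ?_⟩
  rw [← (fch_log_summable K χ s hs hs').tsum_add (fch_prime_summable K χ s hs hs')]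
  refine tsum_of_norm_bounded (nv_summable K (by norm_num)).hasSum (fun v => ?_)
  set z := fch K χ s hs' v.asIdeal with hz
  have h1 : ‖z‖ ≤ 1 / 2 := fch_half K χ s hs hs' v
  have h2 := Complex.norm_log_one_add_sub_self_le (z := -z) (by rw [norm_neg]; linarith)
  rw [norm_neg] at h2
  have h3 : ‖z‖ ≤ (nv v : ℝ) ^ (-(1:ℝ)) := by
    refine (fch_norm K χ s (by linarith) hs' _).trans ?_
    have : (1:ℝ) ≤ nv v := by have := two_le_nv v; exact_mod_cast (by omega)
    exact Real.rpow_le_rpow_of_exponent_le this (by linarith)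
  have h4 : (1 - ‖z‖)⁻¹ ≤ 2 := by
    rw [inv_le_comm₀ (by linarith) (by norm_num)]; linarith
  calc ‖Complex.log (1 - z) + z‖ = ‖Complex.log (1 + -z) - -z‖ := by rw [sub_neg_eq_add, sub_eq_add_neg]
    _ ≤ ‖z‖ ^ 2 * (1 - ‖z‖)⁻¹ / 2 := h2
    _ ≤ ‖z‖ ^ 2 * 2 / 2 := by gcongr
    _ = ‖z‖ ^ 2 := by ring
    _ ≤ ((nv v : ℝ) ^ (-(1:ℝ))) ^ 2 := by gcongr
    _ = _ := by
      rw [← Real.rpow_natCast, ← Real.rpow_mul (by positivity)]; norm_num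

theorem fch_euler {N : ℕ} (χ : DirichletCharacter ℂ N) (s : ℂ) (hs : 1 < s.re) (hs' : s ≠ 0) :
    (∑' I, fch K χ s hs' I) * Complex.exp (∑' v : HeightOneSpectrum (𝓞 K),
      Complex.log (1 - fch K χ s hs' v.asIdeal)) = 1 :=
  euler_log _ (fch_summable K χ s hs hs') (fun v => (fch_half K χ s hs hs' v).trans_lt (by norm_num))

/-- the sum over primes behaves like `-log (σ - 1)` -/
theorem prime_sum_log : ∃ C : ℝ, ∀ᶠ σ in 𝓝[>] (1 : ℝ),
    |(∑' v : HeightOneSpectrum (𝓞 K), (nv v : ℝ) ^ (-σ)) + Real.log (σ - 1)| ≤ C := by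
  obtain ⟨C, hC⟩ := fch_log_bound K
  have hρ := dedekindZeta_residue_pos K
  set ρ := dedekindZeta_residue K
  refine ⟨C + (|Real.log ρ| + 1), ?_⟩
  have hlog := (Real.continuousAt_log hρ.ne').tendsto.comp (ideal_tsum_residue K)
  have hev : ∀ᶠ σ in 𝓝[>] (1 : ℝ), |Real.log ((σ - 1) * ∑' I : Ideal (𝓞 K),
    (Ideal.absNorm I : ℝ) ^ (-σ)) - Real.log ρ| < 1 := by
    have := (Metric.tendsto_nhds.mp hlog) 1 one_pos
    simpa [Real.dist_eq] using this
  filter_upwards [hev, self_mem_nhdsWithin] with σ h1 hσ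
  have hσ1 : (1:ℝ) < σ := hσ
  have hs' : (σ : ℂ) ≠ 0 := by exact_mod_cast (by linarith : σ ≠ 0)
  have hs : 1 < (σ : ℂ).re := by simpa using hσ1
  have hf : ∀ I : Ideal (𝓞 K), fch K (1 : DirichletCharacter ℂ 1) σ hs' I =
      (((Ideal.absNorm I : ℝ) ^ (-σ) : ℝ) : ℂ) := by
    intro I
    change (1 : DirichletCharacter ℂ 1) (Ideal.absNorm I : ℕ) * (Ideal.absNorm I : ℂ) ^ (-(σ : ℂ)) = _
    rw [MulChar.one_apply (isUnit_of_subsingleton _), one_mul, Complex.ofReal_cpow (by positivity)]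
    push_cast; rfl
  have e := fch_euler K (1 : DirichletCharacter ℂ 1) σ hs hs'
  have b := hC (1 : DirichletCharacter ℂ 1) σ hs hs'
  set ℓ := ∑' v : HeightOneSpectrum (𝓞 K),
      Complex.log (1 - fch K (1 : DirichletCharacter ℂ 1) σ hs' v.asIdeal)
  simp only [hf] at e b
  rw [← Complex.ofReal_tsum] at e b
  set Z := ∑' I : Ideal (𝓞 K), (Ideal.absNorm I : ℝ) ^ (-σ)
  change ‖ℓ + ((∑' v : HeightOneSpectrum (𝓞 K), (nv v : ℝ) ^ (-σ) : ℝ) : ℂ)‖ ≤ C at b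
  set P := ∑' v : HeightOneSpectrum (𝓞 K), (nv v : ℝ) ^ (-σ)
  have hZ0 : 0 ≤ Z := tsum_nonneg fun _ => by positivity
  have e2 := congrArg (fun z => ‖z‖) e
  simp only [norm_mul, Complex.norm_real, Complex.norm_exp, norm_one, Real.norm_eq_abs, abs_of_nonneg hZ0] at e2
  have hZ : Z ≠ 0 := by rintro h; rw [h] at e2; simp at e2
  have e3 := congrArg Real.log e2
  rw [Real.log_mul hZ (Real.exp_ne_zero _), Real.log_exp, Real.log_one] at e3
  rw [Real.log_mul (by linarith) hZ] at h1
  have b2 := (Complex.abs_re_le_norm _).trans b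
  simp only [Complex.add_re, Complex.ofReal_re] at b2
  rw [abs_le] at b2
  rw [abs_lt] at h1
  have := abs_le.mp (le_refl |Real.log ρ|)
  rw [abs_le]
  constructor <;> linarith

end nf
end AxP

end

section
set_option linter.style.haveILetI false
set_option linter.unusedSectionVars false
open Polynomial
namespace AxP
open NumberField IsDedekindDomain Filter Topology

section homs
variable {K : Type} [Field K] [NumberField K]

theorem hom_surj {R : Type} [CommRing R] {p : ℕ} (g : R →+* ZMod p) : Function.Surjective g := by
  intro x
  obtain ⟨k, rfl⟩ := ZMod.intCast_surjective x
  exact ⟨k, by simp⟩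

/-- prime from hom -/
noncomputable def vOfHom {p : ℕ} [hp : Fact p.Prime] (g : 𝓞 K →+* ZMod p) : HeightOneSpectrum (𝓞 K) where
  asIdeal := RingHom.ker g
  isPrime := RingHom.ker_isPrime g
  ne_bot := by
    intro h
    have h1 : ((p : ℕ) : 𝓞 K) ∈ RingHom.ker g := by simp [RingHom.mem_ker]
    rw [h, Ideal.mem_bot] at h1
    exact hp.out.ne_zero (by exact_mod_cast h1)

theorem nv_vOfHom {p : ℕ} [hp : Fact p.Prime] (g : 𝓞 K →+* ZMod p) : nv (vOfHom g) = p := by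
  change Nat.card (𝓞 K ⧸ RingHom.ker g) = p
  rw [Nat.card_congr (RingHom.quotientKerEquivOfSurjective (hom_surj g)).toEquiv, Nat.card_zmod]

theorem homOfV (v : HeightOneSpectrum (𝓞 K)) {p : ℕ} (hp : p.Prime) (h : nv v = p) :
    ∃ g : 𝓞 K →+* ZMod p, RingHom.ker g = v.asIdeal := by
  have hc : Nat.card (𝓞 K ⧸ v.asIdeal) = p := h
  haveI : Finite (𝓞 K ⧸ v.asIdeal) := Nat.finite_of_card_ne_zero (by rw [hc]; exact hp.ne_zero)
  haveI := Fintype.ofFinite (𝓞 K ⧸ v.asIdeal)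
  let e := ZMod.ringEquivOfPrime (𝓞 K ⧸ v.asIdeal) hp (by rw [← Nat.card_eq_fintype_card]; exact hc)
  refine ⟨e.symm.toRingHom.comp (Ideal.Quotient.mk _), ?_⟩
  ext x
  simp [RingHom.mem_ker, Ideal.Quotient.eq_zero_iff_mem]
end homs

section ext
variable {K K' : Type} [Field K] [NumberField K] [Field K'] [NumberField K'] [Algebra K K']

theorem ext_indep (hK : ∀ x : K, x ^ 2 ≠ 5) (s : K') (hs : s ^ 2 = 5) (a b : K)
    (h : algebraMap K K' a + algebraMap K K' b * s = 0) : a = 0 ∧ b = 0 := by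
  have hb : b = 0 := by
    by_contra hb
    have hb' : algebraMap K K' b ≠ 0 := by simpa using hb
    apply hK (-a / b)
    apply (algebraMap K K').injective
    rw [map_pow, map_div₀, map_neg, map_ofNat, ← hs]
    congr 1
    field_simp
    linear_combination -h
  subst hb
  simp at h
  exact ⟨h, rfl⟩

/-- embedding of the small ring of integers in the big field -/
noncomputable def iK (K K' : Type) [Field K] [NumberField K] [Field K'] [NumberField K'] [Algebra K K'] :
    𝓞 K →+* K' := (algebraMap K K').comp (algebraMap (𝓞 K) K)
/-- embedding of the big ring of integers in the big field -/
noncomputable def jK (K' : Type) [Field K'] [NumberField K'] : 𝓞 K' →+* K' := algebraMap (𝓞 K') K'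

theorem ext_indep' (hK : ∀ x : K, x ^ 2 ≠ 5) (s : K') (hs : s ^ 2 = 5) (a b a' b' : 𝓞 K)
    (h : iK K K' a + iK K K' b * s = iK K K' a' + iK K K' b' * s) :
    a = a' ∧ b = b' := by
  have h' : algebraMap K K' a + algebraMap K K' b * s = algebraMap K K' a' + algebraMap K K' b' * s := h
  have := ext_indep hK s hs ((a : K) - a') ((b : K) - b') (by rw [map_sub, map_sub]; linear_combination h')
  exact ⟨RingOfIntegers.ext (sub_eq_zero.mp this.1), RingOfIntegers.ext (sub_eq_zero.mp this.2)⟩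

theorem ext_TU (s : K') (hs : s ^ 2 = 5) (hx : ∀ x : K', ∃ a b : K, x = algebraMap K K' a + algebraMap K K' b * s)
    (τ : K' →ₐ[K] K') (hτ : τ s = -s) (x : 𝓞 K') :
    ∃ T U : 𝓞 K, 10 * jK K' x = 5 * iK K K' T + iK K K' U * s := by
  obtain ⟨a, b, hab⟩ := hx (jK K' x)
  have hxi : IsIntegral ℤ (jK K' x) := x.isIntegral_coe
  have hsi : IsIntegral ℤ s := by
    refine IsIntegral.of_pow (n := 2) (by norm_num) ?_
    rw [hs]; simpa using isIntegral_algebraMap (R := ℤ) (A := K') (x := 5)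
  have hti : IsIntegral ℤ (τ (jK K' x)) := hxi.map (τ.restrictScalars ℤ)
  have e : τ (jK K' x) = algebraMap K K' a - algebraMap K K' b * s := by
    rw [hab]; simp [hτ, sub_eq_add_neg]
  have h1 : IsIntegral ℤ (2 * a) := by
    rw [← isIntegral_algebraMap_iff (algebraMap K K').injective]
    convert! hxi.add hti using 1
    rw [e, hab, map_mul, map_ofNat]; ring
  have h2 : IsIntegral ℤ (10 * b) := by
    rw [← isIntegral_algebraMap_iff (algebraMap K K').injective]
    convert! (hxi.sub hti).mul hsi using 1
    rw [e, hab, map_mul, map_ofNat]; linear_combination (-2 * algebraMap K K' b) * hs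
  refine ⟨⟨2 * a, h1⟩, ⟨10 * b, h2⟩, ?_⟩
  have e1 : iK K K' ⟨2 * a, h1⟩ = algebraMap K K' (2 * a) := rfl
  have e2 : iK K K' ⟨10 * b, h2⟩ = algebraMap K K' (10 * b) := rfl
  rw [hab, e1, e2, map_mul, map_mul, map_ofNat, map_ofNat]
  ring

theorem ext_hom (hK : ∀ x : K, x ^ 2 ≠ 5) (s : 𝓞 K') (hs : jK K' s ^ 2 = 5)
    (hx : ∀ x : K', ∃ a b : K, x = algebraMap K K' a + algebraMap K K' b * jK K' s)
    (τ : K' →ₐ[K] K') (hτ : τ (jK K' s) = -jK K' s) {p : ℕ} [Fact p.Prime] (h10 : (10 : ZMod p) ≠ 0)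
    (h : 𝓞 K →+* ZMod p) (t : ZMod p) (ht : t ^ 2 = 5) :
    ∃ g : 𝓞 K' →+* ZMod p, g s = t ∧ ∀ a : 𝓞 K, g (algebraMap (𝓞 K) (𝓞 K') a) = h a := by
  choose T U hTU using ext_TU (K := K) (jK K' s) hs hx τ hτ
  have huniq : ∀ (x : 𝓞 K') (a b : 𝓞 K),
      10 * jK K' x = iK K K' a + iK K K' b * jK K' s → 5 * T x = a ∧ U x = b := by
    intro x a b hab
    refine ext_indep' (K' := K') hK (jK K' s) hs _ _ _ _ ?_
    rw [map_mul, map_ofNat]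
    exact ((hTU x).symm.trans hab)
  let G : 𝓞 K' → ZMod p := fun x => (h (5 * T x) + h (U x) * t) / 10
  have hG : ∀ (x : 𝓞 K') (a b : 𝓞 K),
      10 * jK K' x = iK K K' a + iK K K' b * jK K' s → G x = (h a + h b * t) / 10 := by
    intro x a b hab
    obtain ⟨h1, h2⟩ := huniq x a b hab
    simp only [G, h1, h2]
  have hGa : ∀ a : 𝓞 K, G (algebraMap (𝓞 K) (𝓞 K') a) = h a := by
    intro a
    rw [hG _ (10 * a) 0]
    · simp only [map_mul, map_ofNat, map_zero]; field_simp; ring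
    · have : jK K' (algebraMap (𝓞 K) (𝓞 K') a) = iK K K' a := rfl
      rw [this, map_mul, map_ofNat, map_zero]; ring
  have h1 : G 1 = 1 := by rw [← map_one (algebraMap (𝓞 K) (𝓞 K')), hGa, map_one]
  have h0 : G 0 = 0 := by rw [← map_zero (algebraMap (𝓞 K) (𝓞 K')), hGa, map_zero]
  have hadd : ∀ x y, G (x + y) = G x + G y := by
    intro x y
    rw [hG (x + y) (5 * T x + 5 * T y) (U x + U y)]
    · simp only [G, map_add, map_mul]; ring
    · simp only [map_add, map_mul, map_ofNat]
      linear_combination hTU x + hTU y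
  have hmul : ∀ x y, G (x * y) = G x * G y := by
    intro x y
    have e1 := hTU x
    have e2 := hTU y
    have e3 := hTU (x * y)
    have e4 : 10 * (5 * T (x * y)) = 25 * T x * T y + 5 * U x * U y ∧
        10 * U (x * y) = 5 * T x * U y + 5 * T y * U x := by
      refine ext_indep' hK (jK K' s) hs _ _ _ _ ?_
      simp only [map_add, map_mul, map_ofNat] at *
      linear_combination (-10) * e3 + 10 * jK K' y * e1 + (5 * iK K K' (T x) + iK K K' (U x) * jK K' s) * e2 + (iK K K' (U x) * iK K K' (U y)) * hs
    have f1 := congrArg h e4.1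
    have f2 := congrArg h e4.2
    simp only [map_add, map_mul, map_ofNat] at f1 f2
    change (h (5 * T (x * y)) + h (U (x * y)) * t) / 10 =
      ((h (5 * T x) + h (U x) * t) / 10) * ((h (5 * T y) + h (U y) * t) / 10)
    simp only [map_mul, map_ofNat]
    field_simp
    linear_combination f1 + t * f2 - (h (U x) * h (U y)) * ht
  refine ⟨{ toFun := G, map_one' := h1, map_zero' := h0, map_add' := hadd, map_mul' := hmul }, ?_, hGa⟩
  change G s = t
  rw [hG s 0 10]
  · simp only [map_zero, map_ofNat, zero_add]; field_simp
  · rw [map_zero, map_ofNat, zero_add]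

theorem five_res {p : ℕ} [hp : Fact p.Prime] (h : p % 5 = 1 ∨ p % 5 = 4) : ∃ t : ZMod p, t ^ 2 = 5 := by
  haveI : Fact (Nat.Prime 5) := ⟨by norm_num⟩
  have hp2 : p ≠ 2 := by rintro rfl; omega
  have key := ZMod.exists_sq_eq_prime_iff_of_mod_four_eq_one (p := 5) (q := p) (by norm_num) hp2
  have h1 : IsSquare (p : ZMod 5) := by
    have : (p : ZMod 5) = ((p % 5 : ℕ) : ZMod 5) := by simp
    rw [this]
    rcases h with h | h <;> rw [h]
    · exact ⟨1, by norm_num⟩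
    · exact ⟨2, by norm_num⟩
  have h2 : IsSquare ((5 : ℕ) : ZMod p) := by
    exact key.mp h1
  obtain ⟨t, ht⟩ := h2
  exact ⟨t, by rw [sq, ← ht]; simp⟩

theorem two_five_ne {p : ℕ} [hp : Fact p.Prime] (h : p % 5 = 1 ∨ p % 5 = 4) :
    (2 : ZMod p) ≠ 0 ∧ (5 : ZMod p) ≠ 0 := by
  have hp2 : p ≠ 2 := by rintro rfl; omega
  have hp5 : p ≠ 5 := by rintro rfl; omega
  constructor
  · intro h0
    have : ((2 : ℕ) : ZMod p) = 0 := by exact_mod_cast h0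
    rw [ZMod.natCast_eq_zero_iff] at this
    exact hp2 ((Nat.prime_dvd_prime_iff_eq hp.out (by norm_num)).mp this)
  · intro h0
    have : ((5 : ℕ) : ZMod p) = 0 := by exact_mod_cast h0
    rw [ZMod.natCast_eq_zero_iff] at this
    exact hp5 ((Nat.prime_dvd_prime_iff_eq hp.out (by norm_num)).mp this)

theorem ext_pair (hK : ∀ x : K, x ^ 2 ≠ 5) (s : 𝓞 K') (hs : jK K' s ^ 2 = 5)
    (hx : ∀ x : K', ∃ a b : K, x = algebraMap K K' a + algebraMap K K' b * jK K' s)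
    (τ : K' →ₐ[K] K') (hτ : τ (jK K' s) = -jK K' s) (v : HeightOneSpectrum (𝓞 K)) (hv : (nv v).Prime)
    (h5 : nv v % 5 = 1 ∨ nv v % 5 = 4) :
    ∃ w : Bool → HeightOneSpectrum (𝓞 K'), w.Injective ∧ ∀ b, nv (w b) = nv v ∧
      ∀ a : 𝓞 K, algebraMap (𝓞 K) (𝓞 K') a ∈ (w b).asIdeal ↔ a ∈ v.asIdeal := by
  haveI : Fact (nv v).Prime := ⟨hv⟩
  obtain ⟨h, hh⟩ := homOfV v hv rfl
  obtain ⟨t, ht⟩ := five_res h5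
  obtain ⟨h2, h5'⟩ := two_five_ne h5
  have h10 : (10 : ZMod (nv v)) ≠ 0 := by
    rw [show (10 : ZMod (nv v)) = 2 * 5 by norm_num]; exact mul_ne_zero h2 h5'
  have : ∀ b : Bool, ∃ g : 𝓞 K' →+* ZMod (nv v), g s = (if b then t else -t) ∧
      ∀ a : 𝓞 K, g (algebraMap (𝓞 K) (𝓞 K') a) = h a := fun b =>
    ext_hom hK s hs hx τ hτ h10 h _ (by split_ifs <;> simp [ht])
  choose g hg1 hg2 using this
  have hne : (vOfHom (g true)) ≠ vOfHom (g false) := by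
    intro he
    obtain ⟨k, hk⟩ := ZMod.intCast_surjective t
    have e1 : s - (k : 𝓞 K') ∈ (vOfHom (g true)).asIdeal := by
      change _ ∈ RingHom.ker _
      simp [RingHom.mem_ker, hg1, hk]
    rw [he] at e1
    change _ ∈ RingHom.ker _ at e1
    rw [RingHom.mem_ker, map_sub, hg1, map_intCast, hk] at e1
    have e2 : 2 * t = 0 := by
      simp at e1
      linear_combination -e1
    have : t = 0 := by simpa [h2] using e2
    apply h5'
    rw [← ht, this]; simp
  refine ⟨fun b => vOfHom (g b), ?_, fun b => ⟨nv_vOfHom _, fun a => ?_⟩⟩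
  · intro b b' hb
    cases b <;> cases b'
    · rfl
    · exact absurd hb.symm hne
    · exact absurd hb hne
    · rfl
  · change _ ∈ RingHom.ker _ ↔ _
    rw [RingHom.mem_ker, hg2, ← hh, RingHom.mem_ker]

open Classical in
theorem ext_ineq (hK : ∀ x : K, x ^ 2 ≠ 5) (s : 𝓞 K') (hs : jK K' s ^ 2 = 5)
    (hx : ∀ x : K', ∃ a b : K, x = algebraMap K K' a + algebraMap K K' b * jK K' s)
    (τ : K' →ₐ[K] K') (hτ : τ (jK K' s) = -jK K' s) (σ : ℝ) (hσ : 1 < σ) :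
    2 * (∑' v : HeightOneSpectrum (𝓞 K), if (nv v).Prime ∧ (nv v % 5 = 1 ∨ nv v % 5 = 4) then
      (nv v : ℝ) ^ (-σ) else 0) ≤ ∑' w : HeightOneSpectrum (𝓞 K'), (nv w : ℝ) ^ (-σ) := by
  let S : Set (HeightOneSpectrum (𝓞 K)) := {v | (nv v).Prime ∧ (nv v % 5 = 1 ∨ nv v % 5 = 4)}
  have h1 : (∑' v : HeightOneSpectrum (𝓞 K), if (nv v).Prime ∧ (nv v % 5 = 1 ∨ nv v % 5 = 4) then
      (nv v : ℝ) ^ (-σ) else 0) = ∑' v : S, (nv v.1 : ℝ) ^ (-σ) := by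
    rw [tsum_subtype S (fun v => (nv v : ℝ) ^ (-σ))]
    refine tsum_congr fun v => ?_
    simp only [Set.indicator, S, Set.mem_ofPred_eq]
  rw [h1]
  have := fun v : S => ext_pair hK s hs hx τ hτ v.1 v.2.1 v.2.2
  choose w hw1 hw2 using this
  let Φ : S × Bool → HeightOneSpectrum (𝓞 K') := fun x => w x.1 x.2
  have hΦ : Φ.Injective := by
    rintro ⟨v, b⟩ ⟨v', b'⟩ h
    have hvv : v = v' := by
      apply Subtype.ext
      apply HeightOneSpectrum.ext
      ext a
      rw [← (hw2 v b).2 a, ← (hw2 v' b').2 a]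
      have : (w v b) = w v' b' := h
      rw [this]
    subst hvv
    have hb : b = b' := hw1 v h
    rw [hb]
  have hsS : Summable (fun v : S => (nv v.1 : ℝ) ^ (-σ)) := (nv_summable K hσ).subtype S
  have hsum : Summable (fun x : S × Bool => (nv x.1.1 : ℝ) ^ (-σ)) := by
    have := (nv_summable K' hσ).comp_injective hΦ
    refine this.congr fun x => ?_
    simp only [Function.comp, Φ, (hw2 x.1 x.2).1]
  have h2 : ∑' x : S × Bool, (nv x.1.1 : ℝ) ^ (-σ) = 2 * ∑' v : S, (nv v.1 : ℝ) ^ (-σ) := by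
    rw [hsum.tsum_prod, ← tsum_mul_left]
    refine tsum_congr fun v => ?_
    simp
  rw [← h2]
  have h3 := hsum.tsum_le_tsum_of_inj Φ hΦ (g := fun w : HeightOneSpectrum (𝓞 K') => (nv w : ℝ) ^ (-σ))
    (fun w _ => by positivity) (fun x => by simp only [Φ, (hw2 x.1 x.2).1]; exact le_rfl) (nv_summable K' hσ)
  exact h3

end ext

section main
variable {K : Type} [Field K] [NumberField K]

open Classical in
theorem ext_ineq' (hK : ∀ x : K, x ^ 2 ≠ 5) : ∃ C : ℝ, ∀ᶠ σ in 𝓝[>] (1 : ℝ),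
    2 * (∑' v : HeightOneSpectrum (𝓞 K), if (nv v).Prime ∧ (nv v % 5 = 1 ∨ nv v % 5 = 4) then
      (nv v : ℝ) ^ (-σ) else 0) ≤ C - Real.log (σ - 1) := by
  have hirr : Irreducible (X ^ 2 - C 5 : K[X]) := X_pow_sub_C_irreducible_of_prime Nat.prime_two hK
  haveI : Fact (Irreducible (X ^ 2 - C 5 : K[X])) := ⟨hirr⟩
  let K' := AdjoinRoot (X ^ 2 - C 5 : K[X])
  have hmon : (X ^ 2 - C 5 : K[X]).Monic := monic_X_pow_sub_C _ (by norm_num)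
  haveI : Module.Finite K K' := hmon.finite_adjoinRoot
  haveI : NumberField K' := NumberField.of_module_finite K K'
  let s0 : K' := AdjoinRoot.root _
  have hs0 : s0 ^ 2 = 5 := by
    have := AdjoinRoot.eval₂_root (X ^ 2 - C 5 : K[X])
    rw [eval₂_sub, eval₂_pow, eval₂_X, eval₂_C] at this
    have h5 : AdjoinRoot.of (X ^ 2 - C 5 : K[X]) 5 = 5 := map_ofNat _ 5
    exact (sub_eq_zero.mp this).trans h5
  have hsi : IsIntegral ℤ s0 := by
    refine IsIntegral.of_pow (n := 2) (by norm_num) ?_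
    rw [hs0]; simpa using isIntegral_algebraMap (R := ℤ) (A := K') (x := 5)
  let s : 𝓞 K' := ⟨s0, hsi⟩
  have hss : jK K' s = s0 := rfl
  let τ : K' →ₐ[K] K' := AdjoinRoot.liftAlgHom _ (Algebra.ofId K K') (-s0) (by
    rw [eval₂_sub, eval₂_pow, eval₂_X, eval₂_C, neg_sq, hs0]; exact sub_eq_zero.mpr (map_ofNat (Algebra.ofId K K') 5).symm)
  have hτ : τ s0 = - s0 := AdjoinRoot.liftAlgHom_root ..
  obtain ⟨C1, hC1⟩ := prime_sum_log K'
  refine ⟨C1, ?_⟩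
  filter_upwards [hC1, self_mem_nhdsWithin] with σ h1 hσ
  have h2 := ext_ineq (K := K) (K' := K') hK s (by rw [hss, hs0]) ?_ τ (by rw [hss, hτ]) σ hσ
  · have := (abs_le.mp h1).2
    linarith
  · intro x
    obtain ⟨f, rfl⟩ := AdjoinRoot.mk_surjective x
    have h3 : (f %ₘ (X ^ 2 - C 5)).natDegree ≤ 1 := by
      have := natDegree_modByMonic_lt f hmon (by
        intro h; have := congrArg natDegree h; rw [natDegree_X_pow_sub_C] at this; simp at this)
      rw [natDegree_X_pow_sub_C] at this
      omega
    obtain ⟨b, a, hab⟩ := exists_eq_X_add_C_of_natDegree_le_one h3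
    refine ⟨a, b, ?_⟩
    have h4 : AdjoinRoot.mk (X ^ 2 - C 5 : K[X]) f = AdjoinRoot.mk _ (f %ₘ (X ^ 2 - C 5)) := by
      conv_lhs => rw [← modByMonic_add_div f (X ^ 2 - C 5 : K[X])]
      simp
    rw [h4, hab, hss]
    simp [add_comm, s0]
    rfl

open Classical in
/-- degree one primes with norm `2, 3` mod `5` diverge -/
theorem inert_diverge (hK : ∀ x : K, x ^ 2 ≠ 5) (M : ℝ) : ∀ᶠ σ in 𝓝[>] (1 : ℝ),
    M ≤ ∑' v : HeightOneSpectrum (𝓞 K), if (nv v).Prime ∧ (nv v % 5 = 2 ∨ nv v % 5 = 3) then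
      (nv v : ℝ) ^ (-σ) else 0 := by
  obtain ⟨C1, h1⟩ := ext_ineq' hK
  obtain ⟨C2, h2⟩ := prime_sum_log K
  obtain ⟨C3, h3⟩ := deg2_bound K
  have hlog : Tendsto (fun σ : ℝ => Real.log (σ - 1)) (𝓝[>] 1) atBot := by
    refine Real.tendsto_log_nhdsGT_zero.comp ?_
    refine tendsto_nhdsWithin_iff.mpr ⟨?_, ?_⟩
    · have : Tendsto (fun σ : ℝ => σ - 1) (𝓝 1) (𝓝 (1 - 1)) := (continuous_id.sub continuous_const).tendsto 1
      rw [sub_self] at this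
      exact this.mono_left nhdsWithin_le_nhds
    · filter_upwards [self_mem_nhdsWithin] with σ hσ
      simpa using hσ
  have hb := hlog.eventually (eventually_le_atBot (-(2 * M + 2 * C2 + C1 + 2 * C3 +
    2 * (25 * ∑' v : HeightOneSpectrum (𝓞 K), (nv v : ℝ) ^ (-(2 : ℝ))))))
  filter_upwards [h1, h2, hb, self_mem_nhdsWithin] with σ h1 h2 hb hσ
  have hσ1 : 1 < σ := hσ
  have h3 := h3 σ hσ1
  have hS := nv_summable K hσ1
  have hsub : ∀ P : HeightOneSpectrum (𝓞 K) → Prop, ∀ [DecidablePred P], Summable (fun v : HeightOneSpectrum (𝓞 K) => if P v then (nv v : ℝ) ^ (-σ) else 0) := by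
    intro P _
    refine Summable.of_nonneg_of_le (fun v => by split_ifs <;> positivity) (fun v => ?_) hS
    split_ifs
    · exact le_rfl
    · positivity
  have hsub2 : Summable (fun v : HeightOneSpectrum (𝓞 K) => if (nv v).Prime then 0 else (nv v : ℝ) ^ (-σ)) := by
    refine Summable.of_nonneg_of_le (fun v => by split_ifs <;> positivity) (fun v => ?_) hS
    split_ifs
    · positivity
    · exact le_rfl
  have hS2 := nv_summable K (σ := 2) (by norm_num)
  have key : (∑' v : HeightOneSpectrum (𝓞 K), (nv v : ℝ) ^ (-σ)) ≤
      (((∑' v : HeightOneSpectrum (𝓞 K), if (nv v).Prime ∧ (nv v % 5 = 1 ∨ nv v % 5 = 4) then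
        (nv v : ℝ) ^ (-σ) else 0) +
      ∑' v : HeightOneSpectrum (𝓞 K), if (nv v).Prime ∧ (nv v % 5 = 2 ∨ nv v % 5 = 3) then
        (nv v : ℝ) ^ (-σ) else 0) +
      ∑' v : HeightOneSpectrum (𝓞 K), if (nv v).Prime then 0 else (nv v : ℝ) ^ (-σ)) +
      ∑' v : HeightOneSpectrum (𝓞 K), 25 * (nv v : ℝ) ^ (-(2 : ℝ)) := by
    have hA := hsub (fun v => (nv v).Prime ∧ (nv v % 5 = 1 ∨ nv v % 5 = 4))
    have hB := hsub (fun v => (nv v).Prime ∧ (nv v % 5 = 2 ∨ nv v % 5 = 3))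
    rw [← Summable.tsum_add hA hB, ← Summable.tsum_add (hA.add hB) hsub2,
      ← Summable.tsum_add ((hA.add hB).add hsub2) (hS2.mul_left 25)]
    refine Summable.tsum_le_tsum (fun v => ?_) hS
      (((hA.add hB).add hsub2).add (hS2.mul_left 25))
    have hp0 : (0 : ℝ) ≤ 25 * (nv v : ℝ) ^ (-(2 : ℝ)) := by positivity
    have hp1 : (0 : ℝ) ≤ (nv v : ℝ) ^ (-σ) := by positivity
    by_cases hv : (nv v).Prime
    · by_cases hA : nv v % 5 = 1 ∨ nv v % 5 = 4
      · rw [if_pos ⟨hv, hA⟩, if_pos hv]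
        split_ifs <;> linarith
      · by_cases hB : nv v % 5 = 2 ∨ nv v % 5 = 3
        · rw [if_pos (c := (nv v).Prime ∧ (nv v % 5 = 2 ∨ nv v % 5 = 3)) ⟨hv, hB⟩, if_pos hv]
          split_ifs <;> linarith
        · have h0 : 5 ∣ nv v := by omega
          have h5 : nv v = 5 := ((Nat.prime_dvd_prime_iff_eq (by norm_num) hv).mp h0).symm
          have e1 : (25 : ℝ) * (nv v : ℝ) ^ (-(2 : ℝ)) = 1 := by
            rw [h5, Real.rpow_neg (by norm_num)]; norm_num
          have e2 : (nv v : ℝ) ^ (-σ) ≤ 1 :=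
            Real.rpow_le_one_of_one_le_of_nonpos (by rw [h5]; norm_num) (by linarith)
          rw [e1]
          split_ifs <;> linarith
    · rw [if_neg hv, if_neg (fun h => hv h.1), if_neg (fun h => hv h.1)]
      linarith
  rw [tsum_mul_left] at key
  have := (abs_le.mp h2).1
  linarith
end main
end AxP

end

section
set_option linter.style.haveILetI false
set_option linter.unusedSectionVars false
open Polynomial
namespace AxP
open NumberField Filter Topology
open NumberField.Units NumberField.InfinitePlace

/-! ### tent functions -/

noncomputable def tent (t : ℝ) : ℝ := max 0 (1 - |t|)

theorem tent_nonneg (t : ℝ) : 0 ≤ tent t := le_max_left _ _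
theorem tent_le_one (t : ℝ) : tent t ≤ 1 := max_le (by norm_num) (by linarith [abs_nonneg t])
theorem tent_ne (t : ℝ) (h : tent t ≠ 0) : |t| ≤ 1 := by
  by_contra h'
  exact h (max_eq_left (by linarith))
theorem tent_lip (t u : ℝ) : |tent t - tent u| ≤ |t - u| := by
  have := abs_max_sub_max_le_abs (1 - |t|) (1 - |u|) 0
  unfold tent
  rw [max_comm 0, max_comm 0]
  refine this.trans ?_
  rw [show 1 - |t| - (1 - |u|) = |u| - |t| by ring, abs_sub_comm t u]
  exact abs_abs_sub_abs_le_abs_sub u t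

theorem tent_sum (x : ℝ) : ∑ m ∈ ({-⌊x⌋, -⌊x⌋ - 1} : Finset ℤ), tent (x + m) = 1 := by
  have h1 := Int.floor_le x
  have h2 := Int.lt_floor_add_one x
  rw [Finset.sum_pair (by omega)]
  push_cast
  unfold tent
  rw [abs_of_nonneg (by linarith), abs_of_neg (a := x + (-↑⌊x⌋ - 1)) (by linarith),
    max_eq_right (by linarith), max_eq_right (by linarith)]
  ring

theorem tent_zero (x : ℝ) (m : ℤ) (hm : m ∉ ({-⌊x⌋, -⌊x⌋ - 1} : Finset ℤ)) : tent (x + m) = 0 := by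
  have h1 := Int.floor_le x
  have h2 := Int.lt_floor_add_one x
  simp only [Finset.mem_insert, Finset.mem_singleton, not_or] at hm
  apply max_eq_left
  rcases lt_or_ge m (-⌊x⌋) with h | h
  · have : m ≤ -⌊x⌋ - 2 := by omega
    have : (m : ℝ) ≤ -⌊x⌋ - 2 := by exact_mod_cast this
    rw [abs_of_neg (by linarith)]; linarith
  · have : -⌊x⌋ + 1 ≤ m := by omega
    have : -(⌊x⌋ : ℝ) + 1 ≤ m := by exact_mod_cast this
    rw [abs_of_nonneg (by linarith)]; linarith

theorem prod_tent_hasSum {ι : Type} [Fintype ι] (x : ι → ℝ) :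
    HasSum (fun m : ι → ℤ => ∏ i, tent (x i + m i)) 1 := by
  classical
  have h : ∑ m ∈ Fintype.piFinset (fun i => ({-⌊x i⌋, -⌊x i⌋ - 1} : Finset ℤ)),
      ∏ i, tent (x i + m i) = 1 := by
    rw [← Finset.prod_univ_sum (fun i => ({-⌊x i⌋, -⌊x i⌋ - 1} : Finset ℤ)) (fun i m => tent (x i + m))]
    exact Finset.prod_eq_one fun i _ => tent_sum _
  rw [← h]
  refine hasSum_sum_of_ne_finset_zero fun m hm => ?_
  rw [Fintype.mem_piFinset] at hm
  push Not at hm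
  obtain ⟨i, hi⟩ := hm
  exact Finset.prod_eq_zero (Finset.mem_univ i) (tent_zero _ _ hi)

theorem prod_lip {ι : Type} [Fintype ι] (f g : ι → ℝ) (hf : ∀ i, 0 ≤ f i ∧ f i ≤ 1) (hg : ∀ i, 0 ≤ g i ∧ g i ≤ 1) :
    |∏ i, f i - ∏ i, g i| ≤ ∑ i, |f i - g i| := by
  classical
  have : ∀ s : Finset ι, |∏ i ∈ s, f i - ∏ i ∈ s, g i| ≤ ∑ i ∈ s, |f i - g i| := by
    intro s
    induction s using Finset.induction_on with
    | empty => simp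
    | insert a s ha ih =>
      rw [Finset.prod_insert ha, Finset.prod_insert ha, Finset.sum_insert ha]
      have e : f a * ∏ i ∈ s, f i - g a * ∏ i ∈ s, g i
        = (f a - g a) * ∏ i ∈ s, f i + g a * (∏ i ∈ s, f i - ∏ i ∈ s, g i) := by ring
      rw [e]
      refine (abs_add_le _ _).trans (add_le_add ?_ ?_)
      · rw [abs_mul]
        refine mul_le_of_le_one_right (abs_nonneg _) ?_
        rw [abs_of_nonneg (Finset.prod_nonneg fun i _ => (hf i).1)]
        exact Finset.prod_le_one (fun i _ => (hf i).1) (fun i _ => (hf i).2)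
      · rw [abs_mul, abs_of_nonneg (hg a).1]
        exact (mul_le_of_le_one_left (abs_nonneg _) (hg a).2).trans ih
  exact this _

theorem hasSum_bij {A B U : Type} (Φ : A × B → U) (hΦ : Φ.Bijective) (f : U → ℝ) (g : B → ℝ) (hg : ∀ b, 0 ≤ g b)
    (h1 : HasSum g 1) (c : ℝ) (h2 : HasSum (fun _ : A => (1 : ℝ)) c) (h : ∀ x, f (Φ x) = 1 * g x.2) : HasSum f c := by
  have h3 := h2.mul h1 (h2.summable.mul_of_nonneg h1.summable (fun _ => zero_le_one) hg)
  rw [mul_one] at h3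
  rw [← (Equiv.ofBijective _ hΦ).hasSum_iff]
  exact h3.congr_fun h

section W
open scoped Classical
variable (K : Type) [Field K] [NumberField K]
open NumberField.mixedEmbedding NumberField.Units.dirichletUnitTheorem

noncomputable def lm (α : 𝓞 K) : logSpace K := logMap (mixedEmbedding K (α : K))

noncomputable def uB : Module.Basis (Fin (rank K)) ℝ (logSpace K) :=
  (basisUnitLattice K).ofZLatticeBasis ℝ (unitLattice K)

noncomputable def xc (α : 𝓞 K) (i : Fin (rank K)) : ℝ := (uB K).repr (lm K α) i

noncomputable def WW (α : 𝓞 K) : ℝ := if α = 0 then 0 else ∏ i, tent (xc K α i)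

theorem norm_me_ne {α : 𝓞 K} (h : α ≠ 0) : mixedEmbedding.norm (mixedEmbedding K (α : K)) ≠ 0 := by
  rw [mixedEmbedding.norm_eq_norm]
  have : Algebra.norm ℚ (α : K) ≠ 0 := Algebra.norm_ne_zero_iff.mpr (by simpa using h)
  simpa using this

theorem lm_unit (u : (𝓞 K)ˣ) {α : 𝓞 K} (h : α ≠ 0) :
    lm K (u * α) = logEmbedding K (Additive.ofMul u) + lm K α := by
  have := logMap_unit_smul u (norm_me_ne K h)
  rw [unitSMul_smul, ← map_mul] at this
  exact this

theorem logE (m : Fin (rank K) → ℤ) (ζ : torsion K) :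
    logEmbedding K (Additive.ofMul ((ζ : (𝓞 K)ˣ) * ∏ i, (fundSystem K i) ^ (m i))) =
      ∑ i, (m i : ℝ) • uB K i := by
  have h1 : logEmbedding K (Additive.ofMul (ζ : (𝓞 K)ˣ)) = 0 := logEmbedding_eq_zero_iff.mpr ζ.2
  rw [ofMul_mul, map_add, h1, zero_add, ofMul_prod, map_sum]
  refine Finset.sum_congr rfl fun i _ => ?_
  rw [ofMul_zpow, map_zsmul, logEmbedding_fundSystem, uB, Module.Basis.ofZLatticeBasis_apply]
  exact (Int.cast_smul_eq_zsmul ℝ _ _).symm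

theorem xc_unit (m : Fin (rank K) → ℤ) (ζ : torsion K) {α : 𝓞 K} (h : α ≠ 0) (i : Fin (rank K)) :
    xc K ((((ζ : (𝓞 K)ˣ) * ∏ i, (fundSystem K i) ^ (m i) : (𝓞 K)ˣ) : 𝓞 K) * α) i = xc K α i + m i := by
  unfold xc
  rw [lm_unit K _ h, logE, map_add, Finsupp.add_apply, add_comm]
  congr 1
  exact Module.Basis.repr_sum_self (uB K) (fun i => (m i : ℝ)) ▸ rfl

noncomputable def uPhi (x : torsion K × (Fin (rank K) → ℤ)) : (𝓞 K)ˣ :=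
  (x.1 : (𝓞 K)ˣ) * ∏ i, (fundSystem K i) ^ (x.2 i)

theorem uPhi_bij : (uPhi K).Bijective := by
  rw [Function.bijective_iff_existsUnique]
  intro x
  obtain ⟨y, hy, hu⟩ := exist_unique_eq_mul_prod K x
  exact ⟨y, hy.symm, fun z hz => hu z hz.symm⟩

theorem WW_uPhi {α : 𝓞 K} (h : α ≠ 0) (x : torsion K × (Fin (rank K) → ℤ)) :
    WW K ((uPhi K x : (𝓞 K)ˣ) * α) = 1 * ∏ i, tent (xc K α i + x.2 i) := by
  have h0 : ((uPhi K x : (𝓞 K)ˣ) : 𝓞 K) * α ≠ 0 := mul_ne_zero (Units.ne_zero _) h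
  rw [WW, if_neg h0, one_mul]
  refine Finset.prod_congr rfl fun i _ => ?_
  unfold uPhi
  rw [xc_unit K x.2 x.1 h]

theorem one_hasSum : HasSum (fun _ : torsion K => (1 : ℝ)) (Nat.card (torsion K)) := by
  haveI : Fintype (torsion K) := Fintype.ofFinite _
  have := hasSum_fintype (fun _ : torsion K => (1 : ℝ))
  simpa using this

theorem WW_hasSum {α : 𝓞 K} (h : α ≠ 0) :
    HasSum (fun u : (𝓞 K)ˣ => WW K (u * α)) (Nat.card (torsion K)) :=
  hasSum_bij (uPhi K) (uPhi_bij K) _ (fun m : Fin (rank K) → ℤ => ∏ i, tent (xc K α i + m i))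
    (fun m => Finset.prod_nonneg fun i _ => tent_nonneg _) (prod_tent_hasSum (xc K α))
    _ (one_hasSum K) (fun x => WW_uPhi K h x)

theorem WW_nonneg (α : 𝓞 K) : 0 ≤ WW K α := by
  unfold WW; split_ifs
  · exact le_rfl
  · exact Finset.prod_nonneg fun i _ => tent_nonneg _
theorem WW_le_one (α : 𝓞 K) : WW K α ≤ 1 := by
  unfold WW; split_ifs
  · norm_num
  · exact Finset.prod_le_one (fun i _ => tent_nonneg _) fun i _ => tent_le_one _
theorem WW_zero : WW K 0 = 0 := by simp [WW]

theorem WW_six (α : 𝓞 K) : WW K (6 * α) = WW K α := by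
  by_cases h : α = 0
  · simp [h]
  have h6 : 6 * α ≠ 0 := mul_ne_zero (by norm_num) h
  rw [WW, WW, if_neg h6, if_neg h]
  have : lm K (6 * α) = lm K α := by
    have := logMap_real_smul (norm_me_ne K h) (c := 6) (by norm_num)
    rw [lm, lm, ← this]
    congr 1
    have e : ((6 * α : 𝓞 K) : K) = (6 : K) * (α : K) := by
      have : ((6 : 𝓞 K) : K) = 6 := map_ofNat (algebraMap (𝓞 K) K) 6
      rw [← this]; exact map_mul (algebraMap (𝓞 K) K) 6 α
    rw [e, map_mul, map_ofNat]
    ext w <;> simp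
  unfold xc
  rw [this]

end W
end AxP

end

section
set_option linter.style.haveILetI false
set_option linter.unusedSectionVars false
open Polynomial
namespace AxP
open NumberField Filter Topology
open NumberField.Units NumberField.InfinitePlace

section W
variable (K : Type) [Field K] [NumberField K]
open NumberField.mixedEmbedding NumberField.Units.dirichletUnitTheorem
open scoped Classical

noncomputable def ell (α : 𝓞 K) : ℝ := (∑ w : InfinitePlace K, (mult w : ℝ) * Real.log (w (α : K))) / Module.finrank ℚ K

theorem place_pos {α : 𝓞 K} (h : α ≠ 0) (w : InfinitePlace K) : 0 < w (α : K) := by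
  rw [InfinitePlace.pos_iff]
  simpa using h

theorem lm_apply {α : 𝓞 K} (h : α ≠ 0) (w : {w : InfinitePlace K // w ≠ w₀}) :
    lm K α w = mult w.1 * (Real.log (w.1 (α : K)) - ell K α) := by
  rw [lm, logMap_apply, normAtPlace_apply, mixedEmbedding.norm_apply, Real.log_prod, ell, div_eq_mul_inv]
  · simp only [Real.log_pow, normAtPlace_apply]
  · intro w _
    rw [normAtPlace_apply]
    exact pow_ne_zero _ (place_pos K h w).ne'

theorem sum_mult_log (α : 𝓞 K) :
    ∑ w : InfinitePlace K, (mult w : ℝ) * (Real.log (w (α : K)) - ell K α) = 0 := by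
  simp_rw [mul_sub]
  rw [Finset.sum_sub_distrib, ← Finset.sum_mul]
  have h1 : ∑ w : InfinitePlace K, (mult w : ℝ) = Module.finrank ℚ K := by
    rw [← InfinitePlace.sum_mult_eq]; push_cast; rfl
  have h2 : (Module.finrank ℚ K : ℝ) ≠ 0 := by exact_mod_cast Module.finrank_pos.ne'
  rw [h1, ell, mul_div_cancel₀ _ h2, sub_self]

theorem one_le_mult' (w : InfinitePlace K) : (1 : ℝ) ≤ mult w := by
  exact_mod_cast Nat.one_le_iff_ne_zero.mpr mult_ne_zero

theorem WW_bal : ∃ C : ℝ, 0 < C ∧ ∀ α : 𝓞 K, WW K α ≠ 0 → ∀ w w' : InfinitePlace K,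
    w (α : K) ≤ C * w' (α : K) := by
  let C0 : ℝ := ∑ i, ‖uB K i‖
  have hC0 : 0 ≤ C0 := Finset.sum_nonneg fun i _ => norm_nonneg _
  let N : ℝ := Fintype.card {w : InfinitePlace K // w ≠ w₀}
  let C1 : ℝ := (N + 1) * C0
  refine ⟨Real.exp (2 * C1), Real.exp_pos _, fun α hW => ?_⟩
  have hα : α ≠ 0 := by rintro rfl; exact hW (WW_zero K)
  rw [WW, if_neg hα] at hW
  have hx : ∀ i, |xc K α i| ≤ 1 := fun i => tent_ne _ fun h0 => hW (Finset.prod_eq_zero (Finset.mem_univ i) h0)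
  have h1 : ‖lm K α‖ ≤ C0 := by
    rw [← (uB K).sum_repr (lm K α)]
    refine (norm_sum_le _ _).trans (Finset.sum_le_sum fun i _ => ?_)
    rw [_root_.norm_smul, Real.norm_eq_abs]
    exact mul_le_of_le_one_left (norm_nonneg _) (hx i)
  have h2 : ∀ w : {w : InfinitePlace K // w ≠ w₀}, |(mult w.1 : ℝ) * (Real.log (w.1 (α : K)) - ell K α)| ≤ C0 := by
    intro w
    rw [← lm_apply K hα]
    exact (norm_le_pi_norm (lm K α) w).trans h1
  have h3 : |(mult (w₀ : InfinitePlace K) : ℝ) * (Real.log ((w₀ : InfinitePlace K) (α : K)) - ell K α)| ≤ N * C0 := by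
    have := sum_mult_log K α
    rw [Fintype.sum_eq_add_sum_subtype_ne _ (w₀ : InfinitePlace K)] at this
    rw [eq_neg_of_add_eq_zero_left this, abs_neg]
    refine (Finset.abs_sum_le_sum_abs _ _).trans ((Finset.sum_le_sum fun w _ => h2 w).trans ?_)
    simp [N]
  have h4 : ∀ w : InfinitePlace K, |Real.log (w (α : K)) - ell K α| ≤ C1 := by
    intro w
    have hN : 0 ≤ N := Nat.cast_nonneg _
    have : |(mult w : ℝ) * (Real.log (w (α : K)) - ell K α)| ≤ C1 := by
      by_cases hw : w = w₀
      · rw [hw]; refine h3.trans ?_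
        simp only [C1]; nlinarith
      · refine (h2 ⟨w, hw⟩).trans ?_
        simp only [C1]; nlinarith
    refine le_trans ?_ this
    rw [abs_mul, Nat.abs_cast]
    exact le_mul_of_one_le_left (abs_nonneg _) (one_le_mult' K w)
  intro w w'
  have e1 := (abs_le.mp (h4 w)).2
  have e2 := (abs_le.mp (h4 w')).1
  rw [← Real.exp_log (place_pos K hα w), ← Real.exp_log (place_pos K hα w'), ← Real.exp_add]
  exact Real.exp_le_exp.mpr (by linarith)

theorem log_close {a b ε : ℝ} (ha : 0 < a) (hε : ε ≤ 1 / 2) (h : |b - a| ≤ ε * a) :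
    |Real.log b - Real.log a| ≤ 2 * ε := by
  have h' := abs_le.mp h
  have hb : a / 2 ≤ b := by nlinarith
  have hb0 : 0 < b := by linarith
  rw [← Real.log_div hb0.ne' ha.ne', abs_le]
  have e0 : 0 ≤ ε := by
    by_contra h0
    have : ε * a < 0 := mul_neg_of_neg_of_pos (by linarith) ha
    linarith [abs_nonneg (b - a)]
  constructor
  · have := Real.log_le_sub_one_of_pos (div_pos ha hb0)
    have e : Real.log (b / a) = - Real.log (a / b) := by rw [← Real.log_inv, inv_div]
    have : a / b - 1 ≤ 2 * ε := by
      rw [div_sub_one hb0.ne', div_le_iff₀ hb0]; nlinarith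
    linarith
  · have := Real.log_le_sub_one_of_pos (div_pos hb0 ha)
    have : b / a - 1 ≤ ε := by
      rw [div_sub_one ha.ne', div_le_iff₀ ha]; linarith
    linarith

theorem WW_lip : ∃ C : ℝ, 0 < C ∧ ∀ α β : 𝓞 K, α ≠ 0 → β ≠ 0 → ∀ ε : ℝ, 0 ≤ ε → ε ≤ 1 / 2 →
    (∀ w : InfinitePlace K, |w (β : K) - w (α : K)| ≤ ε * w (α : K)) → |WW K β - WW K α| ≤ C * ε := by
  let c : Fin (rank K) → ℝ := fun i => ‖(LinearMap.toContinuousLinearMap ((uB K).coord i))‖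
  have hc : ∀ i v, |(uB K).repr v i| ≤ c i * ‖v‖ := fun i v =>
    (LinearMap.toContinuousLinearMap ((uB K).coord i)).le_opNorm v
  refine ⟨∑ i, c i * 8 + 1, ?_, fun α β hα hβ ε hε0 hε h => ?_⟩
  · have : 0 ≤ ∑ i, c i * 8 := Finset.sum_nonneg fun i _ => by positivity
    linarith
  have hlog : ∀ w : InfinitePlace K, |Real.log (w (β : K)) - Real.log (w (α : K))| ≤ 2 * ε := fun w =>
    log_close (place_pos K hα w) hε (h w)
  have hn : (0 : ℝ) < Module.finrank ℚ K := by exact_mod_cast Module.finrank_pos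
  have hell : |ell K β - ell K α| ≤ 2 * ε := by
    rw [ell, ell, ← sub_div, abs_div, abs_of_pos hn, div_le_iff₀ hn, ← Finset.sum_sub_distrib]
    have h1 : ∑ w : InfinitePlace K, (mult w : ℝ) = Module.finrank ℚ K := by
      rw [← InfinitePlace.sum_mult_eq]; push_cast; rfl
    rw [← h1, Finset.mul_sum]
    refine (Finset.abs_sum_le_sum_abs _ _).trans (Finset.sum_le_sum fun w _ => ?_)
    rw [← mul_sub, abs_mul, Nat.abs_cast, mul_comm]
    exact mul_le_mul_of_nonneg_right (hlog w) (Nat.cast_nonneg _)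
  have hlm : ‖lm K β - lm K α‖ ≤ 8 * ε := by
    rw [pi_norm_le_iff_of_nonneg (by positivity)]
    intro w
    rw [Pi.sub_apply, lm_apply K hα, lm_apply K hβ, ← mul_sub, Real.norm_eq_abs, abs_mul, Nat.abs_cast]
    have h2 : (mult w.1 : ℝ) ≤ 2 := by
      have : mult w.1 ≤ 2 := by unfold mult; split_ifs <;> norm_num
      exact_mod_cast this
    have h3 : |Real.log (w.1 (β : K)) - ell K β - (Real.log (w.1 (α : K)) - ell K α)| ≤ 4 * ε := by
      rw [sub_sub_sub_comm]
      refine (abs_sub _ _).trans ?_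
      linarith [hlog w.1]
    calc _ ≤ 2 * (4 * ε) := mul_le_mul h2 h3 (abs_nonneg _) (by norm_num)
      _ = _ := by ring
  rw [WW, WW, if_neg hα, if_neg hβ]
  refine (prod_lip _ _ (fun i => ⟨tent_nonneg _, tent_le_one _⟩) (fun i => ⟨tent_nonneg _, tent_le_one _⟩)).trans ?_
  have : ∑ i, |tent (xc K β i) - tent (xc K α i)| ≤ ∑ i, c i * 8 * ε := by
    refine Finset.sum_le_sum fun i _ => (tent_lip _ _).trans ?_
    have e : xc K β i - xc K α i = (uB K).repr (lm K β - lm K α) i := by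
      rw [map_sub, Finsupp.sub_apply]; rfl
    rw [e]
    refine (hc i _).trans ?_
    rw [mul_assoc]
    exact mul_le_mul_of_nonneg_left hlm (norm_nonneg _)
  rw [← Finset.sum_mul] at this
  linarith
end W
end AxP

end

section
set_option linter.style.haveILetI false
set_option linter.unusedSectionVars false
open Polynomial
namespace AxP
open NumberField Filter Topology
open NumberField.Units NumberField.InfinitePlace

theorem lattice_summable_gen0 {E : Type} [NormedAddCommGroup E] [NormedSpace ℝ E] [FiniteDimensional ℝ E]
    (L : Submodule ℤ E) [DiscreteTopology L] [IsZLattice ℝ L] {κ : ℝ} (h : (Module.finrank ℝ E : ℝ) < κ) :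
    Summable fun x : L => ‖x‖ ^ (-κ) := by
  refine ZLattice.summable_norm_rpow L (-κ) ?_
  have := ZLattice.rank ℝ L
  rw [this]; linarith

theorem lattice_summable_gen {E X : Type} [NormedAddCommGroup E] [NormedSpace ℝ E] [FiniteDimensional ℝ E]
    (L : Submodule ℤ E) [DiscreteTopology L] [IsZLattice ℝ L] (f : X → E) (hf : ∀ x, f x ∈ L)
    (hi : f.Injective) {κ : ℝ} (h : (Module.finrank ℝ E : ℝ) < κ) :
    Summable fun x => ‖f x‖ ^ (-κ) := by
  have h1 := lattice_summable_gen0 L h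
  have hg : Function.Injective (fun x => (⟨f x, hf x⟩ : L)) := by
    intro a b hab
    exact hi (congrArg Subtype.val hab)
  have := h1.comp_injective hg
  refine this.congr fun x => ?_
  rfl

section D
variable (K : Type) [Field K] [NumberField K]
open NumberField.mixedEmbedding
open scoped Classical

noncomputable def sz (α : 𝓞 K) : ℝ := ‖mixedEmbedding K (α : K)‖

theorem sz_nonneg (α : 𝓞 K) : 0 ≤ sz K α := norm_nonneg _
theorem sz_add (α β : 𝓞 K) : sz K (α + β) ≤ sz K α + sz K β := by
  unfold sz
  rw [show ((α + β : 𝓞 K) : K) = (α : K) + (β : K) from map_add (algebraMap (𝓞 K) K) α β, map_add]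
  exact norm_add_le _ _
theorem sz_neg (α : 𝓞 K) : sz K (-α) = sz K α := by
  unfold sz
  rw [show ((-α : 𝓞 K) : K) = -(α : K) from map_neg (algebraMap (𝓞 K) K) α, map_neg]
  exact norm_neg _
theorem sz_pos {α : 𝓞 K} (h : α ≠ 0) : 0 < sz K α := by
  unfold sz
  rw [norm_pos_iff, ne_eq, map_eq_zero_iff _ (mixedEmbedding_injective K)]
  simpa using h
theorem place_le_sz (α : 𝓞 K) (w : InfinitePlace K) : w (α : K) ≤ sz K α := by
  unfold sz
  rw [norm_eq_sup'_normAtPlace, ← normAtPlace_apply]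
  exact Finset.le_sup' (fun w => normAtPlace w (mixedEmbedding K (α : K))) (Finset.mem_univ w)
theorem sz_eq_place (α : 𝓞 K) : ∃ w : InfinitePlace K, sz K α = w (α : K) := by
  unfold sz
  rw [norm_eq_sup'_normAtPlace]
  obtain ⟨w, _, hw⟩ := Finset.exists_mem_eq_sup' (Finset.univ_nonempty (α := InfinitePlace K))
    (fun w => normAtPlace w (mixedEmbedding K (α : K)))
  exact ⟨w, by rw [hw, normAtPlace_apply]⟩

theorem sz_summable_aux (K : Type) [Field K] [NumberField K] {κ : ℝ} (h : (Module.finrank ℚ K : ℝ) < κ) :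
    Summable fun α : 𝓞 K => sz K α ^ (-κ) := by
  refine lattice_summable_gen (mixedEmbedding.integerLattice K) (fun α : 𝓞 K => mixedEmbedding K (α : K)) ?_ ?_ ?_
  · intro a
    exact ⟨a, rfl⟩
  · intro a b hab
    exact RingOfIntegers.ext (mixedEmbedding_injective K hab)
  · rw [mixedEmbedding.finrank]; exact h

theorem sz_summable {κ : ℝ} (h : (Module.finrank ℚ K : ℝ) < κ) :
    Summable fun α : 𝓞 K => sz K α ^ (-κ) := sz_summable_aux K h

noncomputable def Nr (α : 𝓞 K) : ℝ := ((Algebra.norm ℤ α : ℤ) : ℝ)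

theorem Nr_eq (α : 𝓞 K) : ((Nr K α : ℝ) : ℂ) = ∏ φ : K →ₐ[ℚ] ℂ, φ (α : K) := by
  rw [← Algebra.norm_eq_prod_embeddings ℚ ℂ (α : K), ← Algebra.coe_norm_int]
  simp [Nr]

theorem Nr_ne {α : 𝓞 K} (h : α ≠ 0) : Nr K α ≠ 0 := by
  unfold Nr
  exact_mod_cast Algebra.norm_ne_zero_iff.mpr h

theorem one_le_Nr {α : 𝓞 K} (h : α ≠ 0) : 1 ≤ |Nr K α| := by
  have : Algebra.norm ℤ α ≠ 0 := Algebra.norm_ne_zero_iff.mpr h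
  unfold Nr
  have := Int.one_le_abs this
  exact_mod_cast this

theorem emb_place (φ : K →ₐ[ℚ] ℂ) (x : K) : ‖φ x‖ = InfinitePlace.mk (φ : K →+* ℂ) x := rfl

theorem Nr_lower {α : 𝓞 K} {c : ℝ} (hc : 0 ≤ c) (h : ∀ w : InfinitePlace K, c ≤ w (α : K)) :
    c ^ Module.finrank ℚ K ≤ |Nr K α| := by
  have e : |Nr K α| = ∏ φ : K →ₐ[ℚ] ℂ, ‖φ (α : K)‖ := by
    rw [← norm_prod, ← Nr_eq, Complex.norm_real, Real.norm_eq_abs]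
  rw [e, ← AlgHom.card ℚ K ℂ, ← Finset.card_univ, ← Finset.prod_const]
  exact Finset.prod_le_prod (fun _ _ => hc) fun φ _ => by rw [emb_place]; exact h _

theorem Nr_ratio {α h : 𝓞 K} (hα : α ≠ 0) {ε : ℝ} (hε0 : 0 ≤ ε) (hε : Module.finrank ℚ K * ε ≤ 1)
    (hh : ∀ w : InfinitePlace K, w (h : K) ≤ ε * w (α : K)) :
    |Nr K (α + h) / Nr K α - 1| ≤ 2 * (Module.finrank ℚ K * ε) := by
  have hφ : ∀ φ : K →ₐ[ℚ] ℂ, φ (α : K) ≠ 0 := fun φ => by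
    rw [ne_eq, map_eq_zero]; simpa using hα
  have e : ((Nr K (α + h) / Nr K α - 1 : ℝ) : ℂ) = ∏ φ : K →ₐ[ℚ] ℂ, (1 + φ (h : K) / φ (α : K)) - 1 := by
    push_cast
    rw [Nr_eq, Nr_eq, ← Finset.prod_div_distrib]
    congr 1
    refine Finset.prod_congr rfl fun φ _ => ?_
    rw [show ((α + h : 𝓞 K) : K) = (α : K) + (h : K) from map_add (algebraMap (𝓞 K) K) α h, map_add,
      add_div, div_self (hφ φ)]
  rw [← Real.norm_eq_abs, ← Complex.norm_real, e]
  refine (Finset.norm_prod_one_add_sub_one_le _ _).trans ?_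
  have h1 : ∑ φ : K →ₐ[ℚ] ℂ, ‖φ (h : K) / φ (α : K)‖ ≤ Module.finrank ℚ K * ε := by
    rw [← AlgHom.card ℚ K ℂ, ← Finset.card_univ, ← nsmul_eq_mul]
    refine Finset.sum_le_card_nsmul _ _ _ fun φ _ => ?_
    rw [norm_div, div_le_iff₀ (norm_pos_iff.mpr (hφ φ)), emb_place, emb_place]
    exact hh _
  have h0 : 0 ≤ ∑ φ : K →ₐ[ℚ] ℂ, ‖φ (h : K) / φ (α : K)‖ := Finset.sum_nonneg fun _ _ => norm_nonneg _
  have h2 := Real.abs_exp_sub_one_le (x := ∑ φ : K →ₐ[ℚ] ℂ, ‖φ (h : K) / φ (α : K)‖)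
    (by rw [abs_of_nonneg h0]; linarith)
  rw [abs_of_nonneg h0] at h2
  exact (le_abs_self _).trans (h2.trans (by linarith))

/-- the homogeneous kernel -/
noncomputable def FF (s : ℂ) (α : 𝓞 K) : ℂ :=
  ((WW K α * (Nr K α / |Nr K α|) : ℝ) : ℂ) * Complex.exp (-s * (Real.log |Nr K α| : ℝ))

theorem FF_zero (s : ℂ) : FF K s 0 = 0 := by simp [FF, WW_zero]

theorem norm_expo (s : ℂ) {x : ℝ} (hx : 0 < x) : ‖Complex.exp (-s * (Real.log x : ℝ))‖ = x ^ (-s.re) := by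
  rw [Complex.norm_exp, Real.rpow_def_of_pos hx]
  congr 1
  simp; ring

theorem FF_norm_le (s : ℂ) {α : 𝓞 K} (h : α ≠ 0) : ‖FF K s α‖ = WW K α * |Nr K α| ^ (-s.re) := by
  have h1 : 0 < |Nr K α| := abs_pos.mpr (Nr_ne K h)
  rw [FF, norm_mul, norm_expo s h1, Complex.norm_real, Real.norm_eq_abs, abs_mul, abs_div, abs_abs,
    div_self h1.ne', mul_one, abs_of_nonneg (WW_nonneg K α)]

theorem FF_norm_le_one (s : ℂ) (hs : 0 ≤ s.re) (α : 𝓞 K) : ‖FF K s α‖ ≤ 1 := by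
  by_cases h : α = 0
  · simp [h, FF_zero]
  rw [FF_norm_le K s h]
  exact mul_le_one₀ (WW_le_one K α) (by positivity)
    (Real.rpow_le_one_of_one_le_of_nonpos (one_le_Nr K h) (by linarith))

end D
end AxP

end

section
set_option linter.style.haveILetI false
set_option linter.unusedSectionVars false
open Polynomial
namespace AxP
open NumberField Filter Topology
open NumberField.Units NumberField.InfinitePlace

section D
variable (K : Type) [Field K] [NumberField K]

theorem sub_core (W W' : ℝ) (sg : ℝ) (e E s : ℂ) (ℓ δ X : ℝ) (hsg : |sg| ≤ 1) (hW' : |W'| ≤ 1)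
    (hs : ‖s‖ ≤ 2) (he : e = Complex.exp (-s * (ℓ : ℝ))) (hℓ : |ℓ| ≤ 1 / 2) (hd : |W' - W| ≤ δ)
    (hE : ‖E‖ = X) :
    ‖((W' * sg : ℝ) : ℂ) * (E * e) - ((W * sg : ℝ) : ℂ) * E‖ ≤ (4 * |ℓ| + δ) * X := by
  have h1 : ‖e - 1‖ ≤ 4 * |ℓ| := by
    have h2 : ‖-s * (ℓ : ℂ)‖ ≤ 2 * |ℓ| := by
      rw [norm_mul, norm_neg, Complex.norm_real, Real.norm_eq_abs]
      exact mul_le_mul_of_nonneg_right hs (abs_nonneg _)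
    have := Complex.norm_exp_sub_one_le (x := -s * (ℓ : ℂ)) (by linarith)
    rw [he]
    linarith
  have e1 : ((W' * sg : ℝ) : ℂ) * (E * e) - ((W * sg : ℝ) : ℂ) * E
      = (sg : ℂ) * (((W' : ℝ) : ℂ) * (e - 1) + ((W' - W : ℝ) : ℂ)) * E := by
    push_cast; ring
  rw [e1, norm_mul, norm_mul, hE, Complex.norm_real, Real.norm_eq_abs]
  have hX : 0 ≤ X := hE ▸ norm_nonneg _
  refine mul_le_mul_of_nonneg_right ?_ hX
  have h3 : ‖((W' : ℝ) : ℂ) * (e - 1) + ((W' - W : ℝ) : ℂ)‖ ≤ 4 * |ℓ| + δ := by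
    refine (norm_add_le _ _).trans (add_le_add ?_ ?_)
    · rw [norm_mul, Complex.norm_real, Real.norm_eq_abs]
      calc _ ≤ 1 * ‖e - 1‖ := mul_le_mul_of_nonneg_right hW' (norm_nonneg _)
        _ ≤ _ := by linarith
    · rw [Complex.norm_real, Real.norm_eq_abs]; exact hd
  calc _ ≤ 1 * ‖((W' : ℝ) : ℂ) * (e - 1) + ((W' - W : ℝ) : ℂ)‖ :=
        mul_le_mul_of_nonneg_right hsg (norm_nonneg _)
    _ ≤ _ := by linarith

theorem FF_core : ∃ C > 0, ∀ (s : ℂ), ‖s‖ ≤ 2 → ∀ (α h : 𝓞 K) (ε : ℝ), α ≠ 0 → 0 ≤ ε →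
    Module.finrank ℚ K * ε ≤ 1 / 8 → (∀ w : InfinitePlace K, w (h : K) ≤ ε * w (α : K)) →
    ‖FF K s (α + h) - FF K s α‖ ≤ C * ε * |Nr K α| ^ (-s.re) := by
  obtain ⟨C2, hC2, hlip⟩ := WW_lip K
  set n : ℝ := (Module.finrank ℚ K : ℝ) with hn
  have hn1 : 1 ≤ n := by
    have : 0 < Module.finrank ℚ K := Module.finrank_pos
    rw [hn]; exact_mod_cast this
  refine ⟨16 * n + C2, by positivity, ?_⟩
  intro s hs α h ε hα hε0 hε hh
  have hεh : ε ≤ 1 / 8 := by nlinarith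
  have hN := Nr_ne K hα
  have hNp : 0 < |Nr K α| := abs_pos.mpr hN
  have hr := Nr_ratio K hα hε0 (by linarith) hh
  rw [← hn] at hr
  set ρ := Nr K (α + h) / Nr K α with hρ
  have hρ0 : 0 < ρ := by
    have := (abs_le.mp hr).1
    linarith
  have hN' : Nr K (α + h) = ρ * Nr K α := by rw [hρ]; field_simp
  have hα' : α + h ≠ 0 := by
    intro h0
    rw [h0] at hN'
    have : Nr K (0 : 𝓞 K) = 0 := by simp [Nr]
    rw [this] at hN'
    rcases mul_eq_zero.mp hN'.symm with h | h
    · exact hρ0.ne' h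
    · exact hN h
  have hlog := log_close (a := 1) (b := ρ) one_pos (ε := 2 * (n * ε)) (by linarith) (by linarith)
  rw [Real.log_one, sub_zero] at hlog
  have hd := hlip α (α + h) hα hα' ε hε0 (by linarith) (by
    intro w
    rw [show ((α + h : 𝓞 K) : K) = (α : K) + (h : K) from map_add (algebraMap (𝓞 K) K) α h]
    have h1 := hh w
    have h2 : w ((α : K) + h) ≤ w (α : K) + w (h : K) := w.1.add_le _ _
    have h3 : w (α : K) ≤ w ((α : K) + h) + w (h : K) := by
      have := w.1.add_le ((α : K) + h) (-(h : K))
      rw [add_neg_cancel_right, w.1.map_neg] at this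
      exact this
    rw [abs_le]; constructor <;> linarith)
  have hW : |WW K (α + h)| ≤ 1 := by
    rw [abs_of_nonneg (WW_nonneg K _)]; exact WW_le_one K _
  have key := sub_core (WW K α) (WW K (α + h)) (Nr K α / |Nr K α|) _
    (Complex.exp (-s * (Real.log |Nr K α| : ℝ))) s (Real.log ρ) (C2 * ε) (|Nr K α| ^ (-s.re))
    (by rw [abs_div, abs_abs, div_self hNp.ne']) hW hs rfl (by linarith) hd (norm_expo s hNp)
  have e1 : Nr K (α + h) / |Nr K (α + h)| = Nr K α / |Nr K α| := by
    rw [hN', abs_mul, abs_of_pos hρ0, mul_div_mul_left _ _ hρ0.ne']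
  have e2 : Real.log |Nr K (α + h)| = Real.log |Nr K α| + Real.log ρ := by
    rw [hN', abs_mul, abs_of_pos hρ0, Real.log_mul hρ0.ne' hNp.ne', add_comm]
  have e3 : FF K s (α + h) = ((WW K (α + h) * (Nr K α / |Nr K α|) : ℝ) : ℂ) *
      (Complex.exp (-s * (Real.log |Nr K α| : ℝ)) * Complex.exp (-s * (Real.log ρ : ℝ))) := by
    rw [FF, e1, e2, ← Complex.exp_add]
    congr 2
    push_cast; ring
  rw [e3]
  unfold FF
  refine key.trans ?_
  have : 0 ≤ |Nr K α| ^ (-s.re) := by positivity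
  refine mul_le_mul_of_nonneg_right ?_ this
  linarith

theorem FF_far (H : ℝ) (hH : 0 < H) : ∃ C > 0, ∃ R > 0, ∀ (s : ℂ), ‖s‖ ≤ 2 →
    1 - 1 / (2 * (Module.finrank ℚ K : ℝ)) ≤ s.re → ∀ (α h : 𝓞 K), WW K α ≠ 0 → sz K h ≤ H →
    R ≤ sz K α →
    ‖FF K s (α + h) - FF K s α‖ ≤ C * sz K α ^ (-((Module.finrank ℚ K : ℝ) + 1 / 2)) := by
  obtain ⟨C0, hC0, hcore⟩ := FF_core K
  obtain ⟨C1, hC1, hbal⟩ := WW_bal K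
  set n : ℝ := (Module.finrank ℚ K : ℝ) with hn
  have hn1 : 1 ≤ n := by
    have : 0 < Module.finrank ℚ K := Module.finrank_pos
    rw [hn]; exact_mod_cast this
  refine ⟨C0 * (H * C1) * C1 ^ (n - 1 / 2), by positivity, 8 * n * H * C1, by positivity, ?_⟩
  intro s hs hre α h hW hh hR
  have hα : α ≠ 0 := by
    rintro rfl
    exact hW (WW_zero K)
  have hz := sz_pos K hα
  set ε := H * C1 / sz K α with hε
  have hlow : ∀ w : InfinitePlace K, sz K α / C1 ≤ w (α : K) := by
    intro w
    obtain ⟨w0, hw0⟩ := sz_eq_place K α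
    rw [div_le_iff₀ hC1, hw0, mul_comm]
    exact hbal α hW w0 w
  have h1 := hcore s hs α h ε hα (by positivity) (by
      rw [hε, ← mul_div_assoc, div_le_iff₀ hz]; linarith) (by
    intro w
    refine (place_le_sz K h w).trans (hh.trans ?_)
    calc H = ε * (sz K α / C1) := by rw [hε]; field_simp
      _ ≤ _ := mul_le_mul_of_nonneg_left (hlow w) (by positivity))
  refine h1.trans ?_
  have h2 := Nr_lower K (by positivity) hlow
  have h3 : |Nr K α| ^ (-s.re) ≤ (sz K α / C1) ^ (-(n - 1 / 2)) := by
    calc |Nr K α| ^ (-s.re) ≤ |Nr K α| ^ (-(1 - 1 / (2 * n))) :=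
          Real.rpow_le_rpow_of_exponent_le (one_le_Nr K hα) (by linarith)
      _ ≤ ((sz K α / C1) ^ Module.finrank ℚ K) ^ (-(1 - 1 / (2 * n))) := by
          refine Real.rpow_le_rpow_of_nonpos (by positivity) h2 ?_
          have : 1 / (2 * n) ≤ 1 := by rw [div_le_one (by linarith)]; linarith
          linarith
      _ = _ := by
          rw [← Real.rpow_natCast, ← Real.rpow_mul (by positivity), ← hn]
          congr 1
          field_simp
  have h4 : (sz K α / C1) ^ (-(n - 1 / 2)) = sz K α ^ (-(n - 1 / 2)) * C1 ^ (n - 1 / 2) := by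
    rw [Real.div_rpow hz.le hC1.le, Real.rpow_neg hC1.le (n - 1 / 2), div_inv_eq_mul]
  have h5 : sz K α ^ (-(n + 1 / 2)) = sz K α ^ (-(n - 1 / 2)) / sz K α := by
    rw [← Real.rpow_sub_one hz.ne']; congr 1; ring
  calc _ ≤ C0 * ε * (sz K α / C1) ^ (-(n - 1 / 2)) := mul_le_mul_of_nonneg_left h3 (by positivity)
    _ = _ := by rw [h4, h5, hε]; ring

theorem FF_diff (H : ℝ) (hH : 0 < H) : ∃ C > 0, ∀ (s : ℂ), ‖s‖ ≤ 2 →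
    1 - 1 / (2 * (Module.finrank ℚ K : ℝ)) ≤ s.re → ∀ (α h : 𝓞 K), α ≠ 0 → sz K h ≤ H →
    ‖FF K s (α + h) - FF K s α‖ ≤ C * sz K α ^ (-((Module.finrank ℚ K : ℝ) + 1 / 2)) := by
  obtain ⟨C, hC, R, hR, hfar⟩ := FF_far K H hH
  set n : ℝ := (Module.finrank ℚ K : ℝ) with hn
  have hn1 : 1 ≤ n := by
    have : 0 < Module.finrank ℚ K := Module.finrank_pos
    rw [hn]; exact_mod_cast this
  set κ := n + 1 / 2 with hκ
  set R0 := 2 * R + 2 * H with hR0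
  have hR0p : 0 < R0 := by positivity
  refine ⟨2 * R0 ^ κ + C + C * 2 ^ κ, by positivity, ?_⟩
  intro s hs hre α h hα hh
  have hz := sz_pos K hα
  have hzk : 0 < sz K α ^ (-κ) := by positivity
  have hre0 : 0 ≤ s.re := by
    have : 1 / (2 * n) ≤ 1 := by rw [div_le_one (by linarith)]; linarith
    linarith
  by_cases hsm : sz K α ≤ R0
  · have h1 : ‖FF K s (α + h) - FF K s α‖ ≤ 2 := by
      refine (norm_sub_le _ _).trans ?_
      have := FF_norm_le_one K s hre0 (α + h)
      have := FF_norm_le_one K s hre0 α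
      linarith
    have h2 : 1 ≤ R0 ^ κ * sz K α ^ (-κ) := by
      rw [Real.rpow_neg hz.le, ← div_eq_mul_inv, one_le_div (by positivity)]
      exact Real.rpow_le_rpow hz.le hsm (by linarith)
    have h3 : 0 ≤ (C + C * 2 ^ κ) * sz K α ^ (-κ) := by positivity
    nlinarith
  push Not at hsm
  by_cases hW : WW K α = 0
  · by_cases hW' : WW K (α + h) = 0
    · have e1 : FF K s α = 0 := by simp [FF, hW]
      have e2 : FF K s (α + h) = 0 := by simp [FF, hW']
      rw [e1, e2, sub_zero, norm_zero]
      positivity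
    · have hz' : sz K α / 2 ≤ sz K (α + h) := by
        have h1 := sz_add K (α + h) (-h)
        rw [add_neg_cancel_right, sz_neg] at h1
        linarith
      have h1 := hfar s hs hre (α + h) (-h) hW' (by rw [sz_neg]; exact hh) (by linarith)
      rw [add_neg_cancel_right, norm_sub_rev] at h1
      refine h1.trans ?_
      have h2 : sz K (α + h) ^ (-κ) ≤ 2 ^ κ * sz K α ^ (-κ) := by
        calc _ ≤ (sz K α / 2) ^ (-κ) := Real.rpow_le_rpow_of_nonpos (by positivity) hz' (by linarith)
          _ = _ := by
            rw [Real.div_rpow hz.le (by norm_num), Real.rpow_neg (by norm_num : (0:ℝ) ≤ 2), div_inv_eq_mul]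
            ring
      calc _ ≤ C * (2 ^ κ * sz K α ^ (-κ)) := mul_le_mul_of_nonneg_left h2 hC.le
        _ ≤ _ := by
          have : 0 ≤ (2 * R0 ^ κ + C) * sz K α ^ (-κ) := by positivity
          nlinarith
  · have h1 := hfar s hs hre α h hW hh (by linarith)
    refine h1.trans ?_
    have : 0 ≤ (2 * R0 ^ κ + C * 2 ^ κ) * sz K α ^ (-κ) := by positivity
    nlinarith

end D
end AxP

end

section
set_option linter.style.haveILetI false
set_option linter.unusedSectionVars false
open Polynomial
namespace AxP
open NumberField Filter Topology
open NumberField.Units NumberField.InfinitePlace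

theorem bij6 (ι : Type) : Function.Bijective
    (fun p : (ι → ℤ) × (ι → Fin 6) => (6 : ℤ) • p.1 - (5 : ℤ) • (fun i => ((p.2 i : ℕ) : ℤ))) := by
  constructor
  · rintro ⟨x, r⟩ ⟨y, t⟩ h
    have h1 : ∀ i, r i = t i ∧ x i = y i := by
      intro i
      have := congrFun h i
      simp only [Pi.sub_apply, Pi.smul_apply, smul_eq_mul] at this
      have h2 := (r i).2
      have h3 := (t i).2
      have h4 : (r i : ℕ) = t i := by omega
      exact ⟨Fin.ext h4, by omega⟩
    exact Prod.ext (funext fun i => (h1 i).2) (funext fun i => (h1 i).1)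
  · intro z
    refine ⟨⟨fun i => (z i + 5 * (z i % 6)) / 6, fun i => ⟨(z i % 6).toNat, by omega⟩⟩, ?_⟩
    funext i
    simp only [Pi.sub_apply, Pi.smul_apply, smul_eq_mul]
    omega

section D
variable (K : Type) [Field K] [NumberField K]

theorem FF_summable (s : ℂ) (hs : 1 < s.re) : Summable fun α : 𝓞 K => ‖FF K s α‖ := by
  obtain ⟨C1, hC1, hbal⟩ := WW_bal K
  set n : ℝ := (Module.finrank ℚ K : ℝ) with hn
  have hn1 : 1 ≤ n := by
    have : 0 < Module.finrank ℚ K := Module.finrank_pos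
    rw [hn]; exact_mod_cast this
  have h0 := (sz_summable K (κ := n * s.re) (by nlinarith)).mul_left (C1 ^ (n * s.re))
  refine Summable.of_nonneg_of_le (fun _ => norm_nonneg _) (fun α => ?_) h0
  by_cases hW : WW K α = 0
  · have e1 : FF K s α = 0 := by simp [FF, hW]
    rw [e1, norm_zero]
    have := sz_nonneg K α
    positivity
  have hα : α ≠ 0 := by
    rintro rfl
    exact hW (WW_zero K)
  have hz := sz_pos K hα
  have hlow : ∀ w : InfinitePlace K, sz K α / C1 ≤ w (α : K) := by
    intro w
    obtain ⟨w0, hw0⟩ := sz_eq_place K α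
    rw [div_le_iff₀ hC1, hw0, mul_comm]
    exact hbal α hW w0 w
  have h2 := Nr_lower K (by positivity) hlow
  rw [FF_norm_le K s hα]
  calc _ ≤ 1 * |Nr K α| ^ (-s.re) := mul_le_mul_of_nonneg_right (WW_le_one K α) (by positivity)
    _ ≤ ((sz K α / C1) ^ Module.finrank ℚ K) ^ (-s.re) := by
      rw [one_mul]
      exact Real.rpow_le_rpow_of_nonpos (by positivity) h2 (by linarith)
    _ = (sz K α / C1) ^ (-(n * s.re)) := by
      rw [← Real.rpow_natCast, ← Real.rpow_mul (by positivity), ← hn]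
      congr 1
      ring
    _ = _ := by
      rw [Real.div_rpow hz.le hC1.le, Real.rpow_neg hC1.le, div_inv_eq_mul, mul_comm]

theorem FF_six (s : ℂ) (α : 𝓞 K) :
    FF K s (6 * α) = Complex.exp (-s * (Module.finrank ℚ K * Real.log 6 : ℝ)) * FF K s α := by
  by_cases hα : α = 0
  · simp [hα, FF_zero]
  have h6 : Nr K (6 * α) = 6 ^ Module.finrank ℚ K * Nr K α := by
    unfold Nr
    rw [map_mul]
    have : Algebra.norm ℤ (6 : 𝓞 K) = 6 ^ Module.finrank ℚ K := by
      have := Algebra.norm_algebraMap (R := ℤ) (S := 𝓞 K) 6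
      rw [RingOfIntegers.rank] at this
      simpa using this
    rw [this]; push_cast; ring
  have hp : (0 : ℝ) < 6 ^ Module.finrank ℚ K := by positivity
  have hNp : 0 < |Nr K α| := abs_pos.mpr (Nr_ne K hα)
  rw [FF, FF, WW_six, h6, abs_mul, abs_of_pos hp, mul_div_mul_left _ _ hp.ne',
    Real.log_mul hp.ne' hNp.ne', Real.log_pow]
  rw [mul_left_comm, ← Complex.exp_add]
  congr 2
  push_cast; ring

theorem FF_differentiable (α : 𝓞 K) : Differentiable ℂ fun s => FF K s α := by
  unfold FF
  fun_prop

variable {ι : Type} [Fintype ι]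

theorem ZZ_analytic (hι : Fintype.card ι = Module.finrank ℚ K) (j : (ι → ℤ) →+ 𝓞 K)
    (hj : Function.Injective j) (c : (ι → ℤ) → ℂ) (hc : ∀ x, ‖c x‖ ≤ 1)
    (hc5 : ∀ x y, c (x + (5 : ℤ) • y) = c x) :
    ∃ G : ℂ → ℂ, AnalyticAt ℂ G 1 ∧ ∀ s : ℂ, 1 < s.re →
      (1 - Complex.exp ((1 - s) * (Module.finrank ℚ K * Real.log 6 : ℝ))) *
        ∑' x, c x * FF K s (j x) = G s := by
  classical
  set rr : (ι → Fin 6) → (ι → ℤ) := fun r i => ((r i : ℕ) : ℤ) with hrr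
  set H : ℝ := ∑ r, sz K (j (-((5 : ℤ) • rr r))) + 1 with hHdef
  have hH : 0 < H := by
    have : 0 ≤ ∑ r, sz K (j (-((5 : ℤ) • rr r))) := Finset.sum_nonneg fun _ _ => sz_nonneg K _
    linarith
  have hrH : ∀ r, sz K (j (-((5 : ℤ) • rr r))) ≤ H := by
    intro r
    have := Finset.single_le_sum (f := fun r => sz K (j (-((5 : ℤ) • rr r))))
      (fun _ _ => sz_nonneg K _) (Finset.mem_univ r)
    linarith
  obtain ⟨C, hC, hdiff⟩ := FF_diff K H hH
  set n : ℝ := (Module.finrank ℚ K : ℝ) with hn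
  have hn1 : 1 ≤ n := by
    have : 0 < Module.finrank ℚ K := Module.finrank_pos
    rw [hn]; exact_mod_cast this
  set T : (ι → ℤ) → ℂ → ℂ := fun x s => ∑ r : ι → Fin 6,
    c x * (FF K s (j ((6 : ℤ) • x) + j (-((5 : ℤ) • rr r))) - FF K s (j ((6 : ℤ) • x))) with hT
  refine ⟨fun s => ∑' x, T x s, ?_, ?_⟩
  · set U : Set ℂ := Metric.ball 1 (1 / (2 * n)) with hU
    have hUo : IsOpen U := Metric.isOpen_ball
    have hinj : Function.Injective fun x : ι → ℤ => j ((6 : ℤ) • x) := by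
      intro x y hxy
      exact smul_right_injective _ (by norm_num : (6 : ℤ) ≠ 0) (hj hxy)
    have hsum : Summable fun x : ι → ℤ => (Fintype.card (ι → Fin 6) : ℝ) *
        (C * sz K (j ((6 : ℤ) • x)) ^ (-(n + 1 / 2)) + if x = 0 then 1 else 0) := by
      refine Summable.mul_left _ (Summable.add (Summable.mul_left _ ?_) ?_)
      · exact (sz_summable K (κ := n + 1 / 2) (by linarith)).comp_injective hinj
      · exact summable_of_ne_finset_zero (s := {0}) fun b hb => by
          rw [if_neg]; simpa using hb
    have hd : DifferentiableOn ℂ (fun s => ∑' x, T x s) U := by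
      refine Complex.differentiableOn_tsum_of_summable_norm hsum ?_ hUo ?_
      · intro x
        refine Differentiable.differentiableOn ?_
        simp only [hT]
        refine Differentiable.fun_sum fun r _ => ?_
        exact (((FF_differentiable K _).sub (FF_differentiable K _)).const_mul (c x))
      · intro x s hs
        have hs1 : ‖s - 1‖ < 1 / (2 * n) := by simpa [hU, dist_eq_norm] using hs
        have hn2 : 1 / (2 * n) ≤ 1 := by rw [div_le_one (by linarith)]; linarith
        have hs2 : ‖s‖ ≤ 2 := by
          have := norm_add_le (s - 1) 1
          rw [sub_add_cancel, norm_one] at this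
          linarith
        have hs3 : 1 - 1 / (2 * n) ≤ s.re := by
          have := (Complex.abs_re_le_norm (s - 1)).trans hs1.le
          rw [abs_le] at this
          simp only [Complex.sub_re, Complex.one_re] at this
          linarith
        rw [← nsmul_eq_mul, ← Finset.card_univ]
        refine (norm_sum_le _ _).trans (Finset.sum_le_card_nsmul _ _ _ fun r _ => ?_)
        rw [norm_mul]
        refine (mul_le_mul_of_nonneg_right (hc x) (norm_nonneg _)).trans ?_
        rw [one_mul]
        by_cases hx : x = 0
        · rw [if_pos hx, hx, smul_zero, map_zero, zero_add, FF_zero, sub_zero]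
          have h1 := FF_norm_le_one K s (by linarith) (j (-((5 : ℤ) • rr r)))
          have h2 : 0 ≤ C * sz K (0 : 𝓞 K) ^ (-(n + 1 / 2)) := by
            have := sz_nonneg K (0 : 𝓞 K)
            positivity
          linarith
        · rw [if_neg hx, add_zero]
          refine hdiff s hs2 hs3 _ _ ?_ (hrH r)
          intro h0
          apply hx
          apply hinj
          simpa using h0
    exact hd.analyticAt (hUo.mem_nhds (Metric.mem_ball_self (by positivity)))
  · intro s hs
    have hS : Summable fun x : ι → ℤ => c x * FF K s (j x) := by
      refine Summable.of_norm_bounded ((FF_summable K s hs).comp_injective hj) fun x => ?_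
      rw [norm_mul]
      exact (mul_le_mul_of_nonneg_right (hc x) (norm_nonneg _)).trans (by simp)
    set Z := ∑' x, c x * FF K s (j x) with hZ
    have h1 : HasSum (fun p : (ι → ℤ) × (ι → Fin 6) =>
        c p.1 * FF K s (j ((6 : ℤ) • p.1) + j (-((5 : ℤ) • rr p.2)))) Z := by
      have := (Equiv.ofBijective _ (bij6 ι)).hasSum_iff.mpr hS.hasSum
      convert! this using 2
      rename_i p
      simp only [Function.comp_apply, Equiv.ofBijective_apply]
      rw [← map_add, ← sub_eq_add_neg]
      congr 1
      rw [← hc5 p.1 (p.1 - rr p.2)]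
      congr 1
      funext i
      simp only [Pi.add_apply, Pi.sub_apply, Pi.smul_apply, smul_eq_mul, hrr]
      ring
    have h2 : HasSum (fun x => ∑ r : ι → Fin 6,
        c x * FF K s (j ((6 : ℤ) • x) + j (-((5 : ℤ) • rr r)))) Z :=
      h1.prod_fiberwise fun x => hasSum_fintype _
    have h3 : HasSum (fun x => ∑ r : ι → Fin 6, c x * FF K s (j ((6 : ℤ) • x)))
        (Complex.exp ((1 - s) * (n * Real.log 6 : ℝ)) * Z) := by
      have := hS.hasSum.mul_left (Complex.exp ((1 - s) * (n * Real.log 6 : ℝ)))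
      convert! this using 2
      rename_i x
      have e6 : j ((6 : ℤ) • x) = 6 * j x := by
        rw [map_zsmul]; simp
      rw [Finset.sum_const, Finset.card_univ, e6, FF_six, nsmul_eq_mul, Fintype.card_fun, hι,
        Fintype.card_fin]
      have e7 : (((6 ^ Module.finrank ℚ K : ℕ)) : ℂ) = Complex.exp ((n * Real.log 6 : ℝ)) := by
        rw [← Complex.ofReal_exp, mul_comm, Real.exp_mul, Real.exp_log (by norm_num), hn, Real.rpow_natCast]
        push_cast; rfl
      rw [e7]
      have e8 : Complex.exp ((1 - s) * (n * Real.log 6 : ℝ)) =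
          Complex.exp ((n * Real.log 6 : ℝ)) * Complex.exp (-s * (n * Real.log 6 : ℝ)) := by
        rw [← Complex.exp_add]; congr 1; ring
      rw [e8, ← hn]; ring
    have h4 := h2.sub h3
    simp only [← Finset.sum_sub_distrib, ← mul_sub] at h4
    refine Eq.trans ?_ h4.tsum_eq.symm
    ring

end D
end AxP

end

section
set_option linter.style.haveILetI false
set_option linter.unusedSectionVars false
open Polynomial
namespace AxP

section Mat
variable {S ι : Type} [CommRing S] [Fintype ι] [DecidableEq ι] (b : Module.Basis ι ℤ S) (J : Ideal S)
  (bJ : Module.Basis ι ℤ J)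

noncomputable def jm : (ι → ℤ) →+ S where
  toFun x := ((bJ.equivFun.symm x : J) : S)
  map_zero' := by rw [map_zero]; rfl
  map_add' x y := by rw [map_add]; rfl

theorem jm_mem (x : ι → ℤ) : jm J bJ x ∈ J := (bJ.equivFun.symm x).2

theorem jm_inj : Function.Injective (jm J bJ) := by
  intro x y h
  exact bJ.equivFun.symm.injective (Subtype.ext h)

theorem jm_surj {α : S} (h : α ∈ J) : ∃ x, jm J bJ x = α :=
  ⟨bJ.equivFun ⟨α, h⟩, by
    change ((bJ.equivFun.symm (bJ.equivFun ⟨α, h⟩) : J) : S) = α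
    rw [LinearEquiv.symm_apply_apply]⟩

noncomputable def Mx : (ι → ℤ) →+ Matrix ι ι ℤ where
  toFun x := Matrix.of fun i k => bJ.equivFun ⟨b k * jm J bJ x, J.mul_mem_left _ (jm_mem J bJ x)⟩ i
  map_zero' := by
    ext i k
    have : (⟨b k * jm J bJ 0, J.mul_mem_left _ (jm_mem J bJ 0)⟩ : J) = 0 := by
      ext; simp
    change bJ.equivFun ⟨b k * jm J bJ 0, J.mul_mem_left _ (jm_mem J bJ 0)⟩ i = 0
    rw [this, map_zero]; rfl
  map_add' x y := by
    ext i k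
    have : (⟨b k * jm J bJ (x + y), J.mul_mem_left _ (jm_mem J bJ (x + y))⟩ : J) =
        ⟨b k * jm J bJ x, J.mul_mem_left _ (jm_mem J bJ x)⟩ +
        ⟨b k * jm J bJ y, J.mul_mem_left _ (jm_mem J bJ y)⟩ := by
      ext; simp [mul_add]
    change bJ.equivFun ⟨b k * jm J bJ (x + y), J.mul_mem_left _ (jm_mem J bJ (x + y))⟩ i = _
    rw [this, map_add]; rfl

theorem Mx_mul (x : ι → ℤ) : b.toMatrix (fun i => (bJ i : S)) * Mx b J bJ x =
    Algebra.leftMulMatrix b (jm J bJ x) := by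
  ext i k
  rw [Matrix.mul_apply, Algebra.leftMulMatrix_eq_repr_mul]
  set y : J := ⟨b k * jm J bJ x, J.mul_mem_left _ (jm_mem J bJ x)⟩ with hy
  have h1 : jm J bJ x * b k = ∑ l, bJ.equivFun y l • (bJ l : S) := by
    have := bJ.sum_equivFun y
    have := congrArg (Subtype.val) this
    rw [AddSubmonoidClass.coe_finsetSum] at this
    rw [mul_comm]
    exact this.symm
  rw [h1, map_sum, Finsupp.finsetSum_apply]
  refine Finset.sum_congr rfl fun l _ => ?_
  rw [map_zsmul, Finsupp.smul_apply, smul_eq_mul, Module.Basis.toMatrix_apply, mul_comm]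
  rfl

noncomputable def Dx (x : ι → ℤ) : ℤ := (Mx b J bJ x).det

theorem Dx_mul (x : ι → ℤ) : b.det (fun i => (bJ i : S)) * Dx b J bJ x = Algebra.norm ℤ (jm J bJ x) := by
  rw [Algebra.norm_eq_matrix_det b, ← Mx_mul, Matrix.det_mul, Module.Basis.det_apply, Dx]

theorem Dx_per (x y : ι → ℤ) : ((Dx b J bJ (x + (5 : ℤ) • y) : ℤ) : ZMod 5) = (Dx b J bJ x : ZMod 5) := by
  unfold Dx
  rw [Int.cast_det, Int.cast_det]
  congr 1
  ext i k
  rw [map_add, map_zsmul]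
  simp only [Matrix.map_apply, Matrix.add_apply, Matrix.smul_apply, smul_eq_mul, Int.cast_add, Int.cast_mul]
  have : ((5 : ℤ) : ZMod 5) = 0 := by decide
  rw [this]; simp

end Mat

open NumberField Filter Topology
open NumberField.Units NumberField.InfinitePlace

section D
variable (K : Type) [Field K] [NumberField K]

theorem chi_sign (χ : DirichletCharacter ℂ 5) (hχ : χ (-1) = -1) (d : ℤ) (hd : d ≠ 0) :
    χ ((d.natAbs : ℕ) : ZMod 5) = χ (d : ZMod 5) * (((d : ℝ) / |(d : ℝ)| : ℝ) : ℂ) := by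
  rcases lt_or_gt_of_ne hd with h | h
  · have h1 : (d : ℝ) < 0 := by exact_mod_cast h
    have e : ((d.natAbs : ℕ) : ZMod 5) = -1 * (d : ZMod 5) := by
      have h2 : ((d.natAbs : ℕ) : ℤ) = -1 * d := by omega
      have h3 := congrArg (fun z : ℤ => (z : ZMod 5)) h2
      simp only [Int.cast_natCast, Int.cast_mul, Int.cast_neg, Int.cast_one] at h3
      exact h3
    rw [e, map_mul, hχ, abs_of_neg h1, div_neg, div_self h1.ne]
    push_cast; ring
  · have h1 : (0 : ℝ) < d := by exact_mod_cast h
    have e : ((d.natAbs : ℕ) : ZMod 5) = (d : ZMod 5) := by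
      have h2 : ((d.natAbs : ℕ) : ℤ) = d := by omega
      have h3 := congrArg (fun z : ℤ => (z : ZMod 5)) h2
      simp only [Int.cast_natCast] at h3
      exact h3
    rw [e, abs_of_pos h1, div_self h1.ne']
    simp

theorem scal (d D W : ℝ) (s : ℂ) (hd : d ≠ 0) (hD : D ≠ 0) (k : ℂ) :
    (W : ℂ) * (k * ((D / |D| : ℝ) : ℂ) * Complex.exp (-s * (Real.log |D| : ℝ))) =
    ((d / |d| : ℝ) : ℂ) * Complex.exp (s * (Real.log |d| : ℝ)) * (k *
      (((W * ((d * D) / |d * D|) : ℝ) : ℂ) * Complex.exp (-s * (Real.log |d * D| : ℝ)))) := by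
  have h1 : |d| ≠ 0 := abs_ne_zero.mpr hd
  have h2 : |D| ≠ 0 := abs_ne_zero.mpr hD
  rw [abs_mul, Real.log_mul h1 h2]
  have h3 : Complex.exp (-s * ((Real.log |d| + Real.log |D| : ℝ) : ℂ)) =
      Complex.exp (-s * (Real.log |D| : ℝ)) * (Complex.exp (s * (Real.log |d| : ℝ)))⁻¹ := by
    rw [← Complex.exp_neg, ← Complex.exp_add]
    congr 1
    push_cast; ring
  rw [h3]
  have h4 : (d / |d|) * (W * (d * D / (|d| * |D|))) = W * (D / |D|) := by
    have : |d| * |d| = d * d := abs_mul_abs_self d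
    field_simp
    rw [sq_abs]
  have h5 := congrArg (Complex.ofReal) h4
  rw [Complex.ofReal_mul, Complex.ofReal_mul W (D / |D|)] at h5
  have h6 := Complex.exp_ne_zero (s * (Real.log |d| : ℝ))
  generalize Complex.exp (s * (Real.log |d| : ℝ)) = E at *
  generalize Complex.exp (-s * (Real.log |D| : ℝ)) = F at *
  generalize ((W * (d * D / (|d| * |D|)) : ℝ) : ℂ) = Y at *
  generalize ((d / |d| : ℝ) : ℂ) = X at *
  have h7 : E * E⁻¹ = 1 := mul_inv_cancel₀ h6
  linear_combination (-(k * F)) * h5 - X * k * Y * F * h7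

theorem J_analytic (χ : DirichletCharacter ℂ 5) (hχ : χ (-1) = -1) (J : Ideal (𝓞 K)) (hJ : J ≠ ⊥) :
    ∃ (φ : ℂ → 𝓞 K → ℂ) (G : ℂ → ℂ), AnalyticAt ℂ G 1 ∧
      ∀ (s : ℂ) (_ : 1 < s.re) (hs' : s ≠ 0),
      (Summable fun x : J => φ s x) ∧
      (1 - Complex.exp ((1 - s) * (Module.finrank ℚ K * Real.log 6 : ℝ))) * ∑' x : J, φ s x = G s ∧
      φ s 0 = 0 ∧
      ∀ (α : 𝓞 K) (𝔞 : Ideal (𝓞 K)), α ≠ 0 → 𝔞 * J = Ideal.span {α} →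
        φ s α = WW K α * fch K χ s hs' 𝔞 := by
  classical
  obtain ⟨b⟩ : Nonempty (Module.Basis (Fin (Module.finrank ℤ (𝓞 K))) ℤ (𝓞 K)) :=
    ⟨Module.finBasis ℤ (𝓞 K)⟩
  obtain ⟨bJ⟩ : Nonempty (Module.Basis (Fin (Module.finrank ℤ (𝓞 K))) ℤ J) := ⟨J.selfBasis b hJ⟩
  set d : ℤ := b.det (fun i => (bJ i : 𝓞 K)) with hd
  have hdn : d.natAbs = Ideal.absNorm J := Ideal.natAbs_det_basis_change b J bJ
  have hJ0 : Ideal.absNorm J ≠ 0 := by rwa [ne_eq, Ideal.absNorm_eq_zero_iff]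
  have hd0 : d ≠ 0 := by
    intro h
    rw [h] at hdn
    exact hJ0 hdn.symm
  have hd0' : (d : ℝ) ≠ 0 := by exact_mod_cast hd0
  have hinj := jm_inj J bJ
  set c : (Fin (Module.finrank ℤ (𝓞 K)) → ℤ) → ℂ := fun x => χ ((Dx b J bJ x : ℤ) : ZMod 5) with hc
  have hc1 : ∀ x, ‖c x‖ ≤ 1 := fun x => DirichletCharacter.norm_le_one χ _
  obtain ⟨G0, hG0, hG⟩ := ZZ_analytic K (by rw [Fintype.card_fin, RingOfIntegers.rank]) (jm J bJ) hinj
    c hc1 (fun x y => by simp only [hc]; rw [Dx_per])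
  set A : ℂ → ℂ := fun s => (((d : ℝ) / |(d : ℝ)| : ℝ) : ℂ) * Complex.exp (s * (Real.log |(d : ℝ)| : ℝ)) with hA
  have hAan : AnalyticAt ℂ A 1 := by
    have : Differentiable ℂ A := by simp only [hA]; fun_prop
    exact this.analyticAt 1
  have hinv : ∀ x, Function.invFun (jm J bJ) (jm J bJ x) = x := Function.leftInverse_invFun hinj
  refine ⟨fun s α => A s * (c (Function.invFun (jm J bJ) α) * FF K s α), fun s => A s * G0 s,
    hAan.mul hG0, fun s hs hs' => ?_⟩
  have hS : Summable fun x => c x * FF K s (jm J bJ x) := by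
    refine Summable.of_norm_bounded ((FF_summable K s hs).comp_injective hinj) fun x => ?_
    rw [norm_mul]
    exact (mul_le_mul_of_nonneg_right (hc1 x) (norm_nonneg _)).trans (by simp)
  have h1 : HasSum (fun x : J => A s * (c (Function.invFun (jm J bJ) x) * FF K s x))
      (A s * ∑' x, c x * FF K s (jm J bJ x)) := by
    rw [← (bJ.equivFun.symm.toEquiv).hasSum_iff]
    convert! hS.hasSum.mul_left (A s) using 2
    rename_i x
    exact (congrArg (fun z => A s * (c z * FF K s (jm J bJ x))) (hinv x))
  refine ⟨h1.summable, ?_, by simp [FF_zero], ?_⟩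
  · rw [h1.tsum_eq]
    change _ = A s * G0 s
    rw [← hG s hs]; ring
  · intro α 𝔞 hα h𝔞
    have hαJ : α ∈ J := by
      have h2 : α ∈ 𝔞 * J := by rw [h𝔞]; exact Ideal.mem_span_singleton_self α
      exact (Ideal.mul_le_right : 𝔞 * J ≤ J) h2
    obtain ⟨x, rfl⟩ := jm_surj J bJ hαJ
    set D := Dx b J bJ x with hD
    have hdD : d * D = Algebra.norm ℤ (jm J bJ x) := Dx_mul b J bJ x
    have hN0 : Algebra.norm ℤ (jm J bJ x) ≠ 0 := Algebra.norm_ne_zero_iff.mpr hα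
    have hD0 : D ≠ 0 := by
      intro h
      rw [h, mul_zero] at hdD
      exact hN0 hdD.symm
    have hnorm : Ideal.absNorm 𝔞 = D.natAbs := by
      have h2 := congrArg Ideal.absNorm h𝔞
      rw [map_mul, Ideal.absNorm_span_singleton, ← hdD, Int.natAbs_mul, hdn, mul_comm] at h2
      exact Nat.eq_of_mul_eq_mul_left (Nat.pos_of_ne_zero hJ0) h2
    have hNr : Nr K (jm J bJ x) = (d : ℝ) * (D : ℝ) := by
      unfold Nr; rw [← hdD]; push_cast; rfl
    change A s * (c (Function.invFun (jm J bJ) (jm J bJ x)) * FF K s (jm J bJ x)) =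
      WW K (jm J bJ x) * (χ (Ideal.absNorm 𝔞 : ℕ) * (Ideal.absNorm 𝔞 : ℂ) ^ (-s))
    have hcp : ((D.natAbs : ℕ) : ℂ) ^ (-s) = Complex.exp (-s * (Real.log |(D : ℝ)| : ℝ)) := by
      rw [Complex.cpow_def_of_ne_zero (by exact_mod_cast Int.natAbs_ne_zero.mpr hD0), ← Complex.natCast_log,
        mul_comm, Nat.cast_natAbs, Int.cast_abs]
    rw [hinv, hnorm, hcp, chi_sign χ hχ D hD0, FF, hNr,
      scal (d : ℝ) (D : ℝ) _ s hd0' (by exact_mod_cast hD0)]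

end D
end AxP

end

section
set_option linter.style.haveILetI false
set_option linter.unusedSectionVars false
open Polynomial
namespace AxP

theorem fiber_sum {A U X : Type} (Ψ : A × U → X) (hΨ : Function.Injective Ψ) (x0 : X)
    (hr : ∀ x, x ≠ x0 → x ∈ Set.range Ψ) (φ : X → ℂ) (hφ : Summable φ) (hφ0 : φ x0 = 0)
    (w : A → U → ℝ) (f : A → ℂ) (hw : ∀ a u, φ (Ψ (a, u)) = w a u * f a) (ω : ℝ)
    (hω : ∀ a, HasSum (w a) ω) : HasSum (fun a => (ω : ℂ) * f a) (∑' x, φ x) := by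
  have h1 : HasSum (φ ∘ Ψ) (∑' x, φ x) := by
    rw [hΨ.hasSum_iff]
    · exact hφ.hasSum
    · intro x hx
      by_cases h : x = x0
      · rw [h, hφ0]
      · exact absurd (hr x h) hx
  refine h1.prod_fiberwise fun a => ?_
  have h2 := (Complex.hasSum_ofReal.mpr (hω a)).mul_right (f a)
  convert! h2 using 2
  rename_i u
  exact hw a u

theorem fiber_total {I J : Type} [Fintype J] (m : I → J) (f : I → ℂ) (hf : Summable f) :
    ∑ c, ∑' a : {x // m x = c}, f a = ∑' x, f x := by
  have h1 := (Equiv.sigmaFiberEquiv m).hasSum_iff.mpr hf.hasSum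
  have h2 := h1.sigma (g := fun c => ∑' a : {x // m x = c}, f a) (fun c => by
    exact (hf.comp_injective (i := fun a : {x // m x = c} => (a : I)) Subtype.val_injective).hasSum)
  rw [← h2.tsum_eq, tsum_fintype]

open NumberField Filter Topology
open NumberField.Units NumberField.InfinitePlace
open nonZeroDivisors

section D
variable (K : Type) [Field K] [NumberField K]

theorem class_analytic (χ : DirichletCharacter ℂ 5) (hχ : χ (-1) = -1) (c : ClassGroup (𝓞 K)) :
    ∃ G : ℂ → ℂ, AnalyticAt ℂ G 1 ∧ ∀ (s : ℂ) (_ : 1 < s.re) (hs' : s ≠ 0),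
      (1 - Complex.exp ((1 - s) * (Module.finrank ℚ K * Real.log 6 : ℝ))) *
        ∑' a : {I : (Ideal (𝓞 K))⁰ // ClassGroup.mk0 I = c}, fch K χ s hs' a.1.1 = G s := by
  obtain ⟨J, hJ⟩ := ClassGroup.mk0_surjective c⁻¹
  have hJ0 : (J : Ideal (𝓞 K)) ≠ ⊥ := nonZeroDivisors.coe_ne_zero J
  obtain ⟨φ, G, hG, H⟩ := J_analytic K χ hχ J hJ0
  have hω : (Nat.card (torsion K) : ℂ) ≠ 0 := by
    exact_mod_cast Nat.card_pos.ne'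
  have hex : ∀ a : {I : (Ideal (𝓞 K))⁰ // ClassGroup.mk0 I = c}, ∃ α : 𝓞 K, α ≠ 0 ∧
      (a.1.1 * J.1 : Ideal (𝓞 K)) = Ideal.span {α} := by
    intro a
    have h1 : ClassGroup.mk0 (a.1 * J) = 1 := by rw [map_mul, a.2, hJ, mul_inv_cancel]
    have h2 := (ClassGroup.mk0_eq_one_iff (a.1 * J).2).mp h1
    obtain ⟨α, hα⟩ := h2
    refine ⟨α, ?_, hα⟩
    rintro rfl
    have h3 : ((a.1 * J : (Ideal (𝓞 K))⁰) : Ideal (𝓞 K)) ≠ 0 := nonZeroDivisors.coe_ne_zero _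
    apply h3
    refine hα.trans ?_
    simp
  choose α hα0 hα using hex
  have hspan : ∀ (a) (u : (𝓞 K)ˣ), (a.1.1 * J.1 : Ideal (𝓞 K)) = Ideal.span {(u : 𝓞 K) * α a} := by
    intro a u
    rw [hα, Ideal.span_singleton_mul_left_unit u.isUnit]
  let Ψ : {I : (Ideal (𝓞 K))⁰ // ClassGroup.mk0 I = c} × (𝓞 K)ˣ → J.1 := fun p =>
    ⟨(p.2 : 𝓞 K) * α p.1, (Ideal.mul_le_right : p.1.1.1 * J.1 ≤ J.1) (by
      rw [hspan p.1 p.2]; exact Ideal.mem_span_singleton_self _)⟩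
  have hΨ : Function.Injective Ψ := by
    rintro ⟨a, u⟩ ⟨a', u'⟩ h
    have h1 : (u : 𝓞 K) * α a = u' * α a' := congrArg Subtype.val h
    have h2 : (a.1.1 * J.1 : Ideal (𝓞 K)) = a'.1.1 * J.1 := by
      rw [hspan a u, hspan a' u', h1]
    have h3 : a = a' := Subtype.ext (Subtype.ext (mul_right_cancel₀ hJ0 h2))
    subst h3
    have h4 := mul_right_cancel₀ (hα0 a) h1
    rw [Units.ext h4]
  have hr : ∀ x : J.1, x ≠ 0 → x ∈ Set.range Ψ := by
    intro x hx
    have hx0 : (x : 𝓞 K) ≠ 0 := fun h => hx (Subtype.ext h)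
    have h1 : (J.1 : Ideal (𝓞 K)) ∣ Ideal.span {(x : 𝓞 K)} := by
      rw [Ideal.dvd_iff_le, Ideal.span_singleton_le_iff_mem]; exact x.2
    obtain ⟨I, hI⟩ := h1
    have hI0 : I ≠ 0 := by
      rintro rfl
      rw [mul_zero, Ideal.zero_eq_bot, Ideal.span_singleton_eq_bot] at hI
      exact hx0 hI
    let I' : (Ideal (𝓞 K))⁰ := ⟨I, mem_nonZeroDivisors_of_ne_zero hI0⟩
    have h2 : ClassGroup.mk0 (J * I') = 1 := by
      rw [ClassGroup.mk0_eq_one_iff (J * I').2]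
      exact ⟨⟨x, hI.symm⟩⟩
    have h3 : ClassGroup.mk0 I' = c := by
      rw [map_mul, hJ] at h2
      exact (inv_mul_eq_one.mp h2).symm
    have h4 : Ideal.span {α ⟨I', h3⟩} = Ideal.span {(x : 𝓞 K)} := by
      rw [← hα ⟨I', h3⟩, hI, mul_comm]
    rw [Ideal.span_singleton_eq_span_singleton] at h4
    obtain ⟨u, hu⟩ := h4
    exact ⟨⟨⟨I', h3⟩, u⟩, Subtype.ext ((mul_comm _ _).trans hu)⟩
  refine ⟨fun s => (Nat.card (torsion K) : ℂ)⁻¹ * G s, analyticAt_const.mul hG, fun s hs hs' => ?_⟩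
  obtain ⟨h1, h2, h3, h4⟩ := H s hs hs'
  have h5 := fiber_sum Ψ hΨ 0 hr (fun x : J.1 => φ s x) h1 h3
    (fun a u => WW K (u * α a)) (fun a => fch K χ s hs' a.1.1)
    (fun a u => h4 _ _ (mul_ne_zero u.ne_zero (hα0 a)) (hspan a u)) (Nat.card (torsion K))
    (fun a => WW_hasSum K (hα0 a))
  have h6 := h5.tsum_eq
  rw [tsum_mul_left] at h6
  change _ = (Nat.card (torsion K) : ℂ)⁻¹ * G s
  rw [← h2, ← h6]
  push_cast
  field_simp

theorem L_analytic (χ : DirichletCharacter ℂ 5) (hχ : χ (-1) = -1) :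
    ∃ G : ℂ → ℂ, AnalyticAt ℂ G 1 ∧ ∀ (s : ℂ) (_ : 1 < s.re) (hs' : s ≠ 0),
      (1 - Complex.exp ((1 - s) * (Module.finrank ℚ K * Real.log 6 : ℝ))) *
        ∑' I, fch K χ s hs' I = G s := by
  choose G hG H using class_analytic K χ hχ
  refine ⟨fun s => ∑ c, G c s, Finset.analyticAt_fun_sum _ fun c _ => hG c, fun s hs hs' => ?_⟩
  have h1 := (fch_summable K χ s hs hs').of_norm
  have h2 : ∑' I : (Ideal (𝓞 K))⁰, fch K χ s hs' I = ∑' I, fch K χ s hs' I := by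
    refine Function.Injective.tsum_eq (f := fun I => fch K χ s hs' I) Subtype.val_injective ?_
    intro I hI
    have : I ≠ 0 := by
      rintro rfl
      exact hI (map_zero _)
    exact ⟨⟨I, mem_nonZeroDivisors_of_ne_zero this⟩, rfl⟩
  have h3 := fiber_total (fun I : (Ideal (𝓞 K))⁰ => ClassGroup.mk0 I) (fun I => fch K χ s hs' I.1)
    (h1.comp_injective Subtype.val_injective)
  rw [← h2, ← h3, Finset.mul_sum]
  exact Finset.sum_congr rfl fun c _ => H c s hs hs'

end D
end AxP

end

section
set_option linter.style.haveILetI false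
set_option linter.unusedSectionVars false
open Polynomial
namespace AxP
open NumberField Filter Topology IsDedekindDomain

noncomputable def chi5 : DirichletCharacter ℂ 5 where
  toFun x := (![0, 1, Complex.I, -Complex.I, -1] : Fin 5 → ℂ) x
  map_one' := rfl
  map_mul' x y := by
    change Fin 5 at x y
    have h1 : (-1 : ℂ) = Complex.I * Complex.I := by simp
    have h2 : (1 : ℂ) = Complex.I * -Complex.I := by simp
    have h3 : (1 : ℂ) = -Complex.I * Complex.I := by simp
    have h4 : (-1 : ℂ) = -Complex.I * -Complex.I := by simp
    have h5 : -Complex.I = Complex.I * -1 := by simp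
    have h6 : -Complex.I = -1 * Complex.I := by simp
    have h7 : Complex.I = -Complex.I * -1 := by simp
    have h8 : Complex.I = -1 * -Complex.I := by simp
    have h9 : (1 : ℂ) = -1 * -1 := by simp
    fin_cases x <;> fin_cases y <;> first
      | exact (zero_mul _).symm | exact (mul_zero _).symm | exact (one_mul _).symm | exact (mul_one _).symm
      | exact h1 | exact h2 | exact h3 | exact h4 | exact h5 | exact h6 | exact h7 | exact h8 | exact h9
  map_nonunit' x hx := by
    have : x = 0 := by
      by_contra h
      haveI : Fact (Nat.Prime 5) := ⟨by norm_num⟩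
      exact hx (isUnit_iff_ne_zero.mpr h)
    rw [this]; rfl

theorem chi5_odd : chi5 (-1) = -1 := rfl

theorem chi5_im (m : ℕ) : (chi5 (m : ZMod 5)).im = if m % 5 = 2 then 1 else if m % 5 = 3 then -1 else 0 := by
  rw [← ZMod.natCast_mod]
  have : m % 5 < 5 := Nat.mod_lt _ (by norm_num)
  generalize m % 5 = k at *
  interval_cases k
  · change (0 : ℂ).im = _; simp
  · change (1 : ℂ).im = _; simp
  · change (Complex.I : ℂ).im = _; simp
  · change (-Complex.I : ℂ).im = _; simp
  · change (-1 : ℂ).im = _; simp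

theorem arg_bdd (θ : ℝ → ℝ) (hθ : ContinuousOn θ (Set.Ioi 1)) (w : ℂ) (δ : ℝ) (hδ : 0 < δ)
    (h : ∀ σ ∈ Set.Ioo 1 (1 + δ), 0 < (Complex.exp (θ σ * Complex.I) * w).re) :
    ∃ C, ∀ σ ∈ Set.Ioo 1 (1 + δ), |θ σ| ≤ C := by
  set σ1 := 1 + δ / 2 with hσ1
  have h1 : σ1 ∈ Set.Ioo 1 (1 + δ) := ⟨by linarith, by linarith⟩
  have hc : ContinuousOn θ (Set.Ioo 1 (1 + δ)) := hθ.mono fun x hx => hx.1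
  have key : ∀ a ∈ Set.Ioo 1 (1 + δ), ∀ b ∈ Set.Ioo 1 (1 + δ), θ b < θ a + Real.pi := by
    intro a ha b hb
    by_contra hcon
    push Not at hcon
    obtain ⟨c, hcm, hce⟩ := isPreconnected_Ioo.intermediate_value ha hb hc
      ⟨(by linarith [Real.pi_pos] : θ a ≤ θ a + Real.pi), hcon⟩
    have h2 := h c hcm
    have h3 := h a ha
    rw [hce] at h2
    have e : Complex.exp (((θ a + Real.pi : ℝ) : ℂ) * Complex.I) = - Complex.exp (θ a * Complex.I) := by
      push_cast
      rw [add_mul, Complex.exp_add, Complex.exp_pi_mul_I]; ring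
    rw [e, neg_mul, Complex.neg_re] at h2
    linarith
  refine ⟨|θ σ1| + Real.pi, fun σ hσ => ?_⟩
  have h2 := key σ hσ σ1 h1
  have h3 := key σ1 h1 σ hσ
  have h4 := le_abs_self (θ σ1)
  have h5 := neg_abs_le (θ σ1)
  rw [abs_le]; constructor <;> linarith

section D
variable (K : Type) [Field K] [NumberField K]

noncomputable def fv (v : HeightOneSpectrum (𝓞 K)) (σ : ℝ) : ℂ :=
  chi5 (nv v : ℕ) * (nv v : ℂ) ^ (-(σ : ℂ))

theorem fv_eq (v : HeightOneSpectrum (𝓞 K)) (σ : ℝ) (hs' : (σ : ℂ) ≠ 0) :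
    fch K chi5 σ hs' v.asIdeal = fv K v σ := rfl

noncomputable def SS (σ : ℝ) : ℂ := ∑' v : HeightOneSpectrum (𝓞 K), Complex.log (1 - fv K v σ)

theorem fv_half (v : HeightOneSpectrum (𝓞 K)) {σ : ℝ} (hσ : 1 < σ) : ‖fv K v σ‖ ≤ 1 / 2 := by
  have hs' : (σ : ℂ) ≠ 0 := by exact_mod_cast (by linarith : σ ≠ 0)
  rw [← fv_eq K v σ hs']
  exact fch_half K chi5 σ (by simpa using hσ) hs' v

theorem fv_norm (v : HeightOneSpectrum (𝓞 K)) {σ : ℝ} (hσ : 1 < σ) : ‖fv K v σ‖ ≤ (nv v : ℝ) ^ (-σ) := by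
  have hs' : (σ : ℂ) ≠ 0 := by exact_mod_cast (by linarith : σ ≠ 0)
  rw [← fv_eq K v σ hs']
  have := fch_norm K chi5 σ (by simp; linarith) hs' v.asIdeal
  exact this

theorem SS_cont : ContinuousOn (SS K) (Set.Ioi 1) := by
  intro σ hσ
  have hσ' : (1 : ℝ) < σ := hσ
  set a := (1 + σ) / 2 with ha
  have ha1 : 1 < a := by rw [ha]; linarith
  have hc : ContinuousOn (SS K) (Set.Ioi a) := by
    unfold SS
    refine continuousOn_tsum (u := fun v => 3 / 2 * (nv v : ℝ) ^ (-a)) ?_ ((nv_summable K ha1).mul_left _) ?_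
    · intro v τ hτ
      have hτ1 : 1 < τ := lt_trans ha1 hτ
      refine ContinuousAt.continuousWithinAt ?_
      have h1 := fv_half K v hτ1
      refine ContinuousAt.clog ?_ ?_
      · refine continuousAt_const.sub ?_
        unfold fv
        refine continuousAt_const.mul ?_
        have h0 : (nv v : ℂ) ≠ 0 := by
          have := two_le_nv v
          exact_mod_cast (by omega : nv v ≠ 0)
        refine ContinuousAt.const_cpow ?_ (Or.inl h0)
        fun_prop
      · left
        have := (Complex.abs_re_le_norm (fv K v τ)).trans h1
        rw [abs_le] at this
        rw [Complex.sub_re, Complex.one_re]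
        linarith
    · intro v τ hτ
      have hτ1 : 1 < τ := lt_trans ha1 hτ
      have h1 := Complex.norm_log_one_add_half_le_self (z := -fv K v τ) (by rw [norm_neg]; exact fv_half K v hτ1)
      rw [norm_neg, ← sub_eq_add_neg] at h1
      refine h1.trans (mul_le_mul_of_nonneg_left ((fv_norm K v hτ1).trans ?_) (by norm_num))
      refine Real.rpow_le_rpow_of_exponent_le ?_ (by linarith [show a < τ from hτ])
      have := two_le_nv v
      exact_mod_cast (by omega : 1 ≤ nv v)
  exact (hc.continuousAt (Ioi_mem_nhds (by rw [ha]; linarith))).continuousWithinAt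

theorem SS_im_bdd : ∃ δ > 0, ∃ C, ∀ σ ∈ Set.Ioo (1 : ℝ) (1 + δ), |(SS K σ).im| ≤ C := by
  obtain ⟨G, hG, HG⟩ := L_analytic K chi5 chi5_odd
  set n : ℝ := (Module.finrank ℚ K : ℝ) with hn
  have hn1 : 1 ≤ n := by
    have : 0 < Module.finrank ℚ K := Module.finrank_pos
    rw [hn]; exact_mod_cast this
  -- G σ = positive * exp (-SS σ)
  have hpos : ∀ σ : ℝ, 1 < σ → ∃ p : ℝ, 0 < p ∧ G σ = p * Complex.exp (-SS K σ) := by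
    intro σ hσ
    have hs' : (σ : ℂ) ≠ 0 := by exact_mod_cast (by linarith : σ ≠ 0)
    have hre : 1 < (σ : ℂ).re := by simpa using hσ
    have h1 := HG σ hre hs'
    have h2 := fch_euler K chi5 σ hre hs'
    change _ * Complex.exp (SS K σ) = 1 at h2
    refine ⟨1 - Real.exp ((1 - σ) * (n * Real.log 6)), ?_, ?_⟩
    · have h3 : 0 < Real.log 6 := Real.log_pos (by norm_num)
      have : (1 - σ) * (n * Real.log 6) < 0 := by
        have : 0 < n * Real.log 6 := by positivity
        nlinarith
      have := (Real.exp_lt_one_iff).mpr this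
      linarith
    · rw [← h1, Complex.exp_neg, ← eq_inv_of_mul_eq_one_left h2]
      push_cast
      rfl
  have hne : ∀ σ : ℝ, 1 < σ → G σ ≠ 0 := by
    intro σ hσ
    obtain ⟨p, hp, e⟩ := hpos σ hσ
    rw [e]
    exact mul_ne_zero (by exact_mod_cast hp.ne') (Complex.exp_ne_zero _)
  have hcast : Tendsto (fun σ : ℝ => (σ : ℂ)) (𝓝[>] 1) (𝓝 1) := by
    have : Tendsto (fun σ : ℝ => (σ : ℂ)) (𝓝 1) (𝓝 ((1 : ℝ) : ℂ)) := Complex.continuous_ofReal.tendsto 1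
    rw [Complex.ofReal_one] at this
    exact this.mono_left nhdsWithin_le_nhds
  have hnz : ¬ ∀ᶠ z in 𝓝 (1 : ℂ), G z = 0 := by
    intro h
    have h1 := hcast.eventually h
    obtain ⟨σ, h2, h3⟩ := (h1.and self_mem_nhdsWithin).exists
    exact hne σ h3 h2
  obtain ⟨k, g, hg, hg1, hgG⟩ := hG.exists_eventuallyEq_pow_smul_nonzero_iff.mpr hnz
  have hclose : ∀ᶠ z in 𝓝 (1 : ℂ), 0 < (g z * (starRingEnd ℂ) (g 1)).re := by
    have hc : ContinuousAt (fun z => (g z * (starRingEnd ℂ) (g 1)).re) 1 :=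
      Complex.continuous_re.continuousAt.comp (hg.continuousAt.mul continuousAt_const)
    refine hc.eventually (lt_mem_nhds ?_)
    change 0 < (g 1 * (starRingEnd ℂ) (g 1)).re
    rw [Complex.mul_conj, Complex.ofReal_re]
    exact Complex.normSq_pos.mpr hg1
  have hev := (hcast.eventually (hgG.and hclose)).and self_mem_nhdsWithin
  obtain ⟨b, hb, hb'⟩ := mem_nhdsGT_iff_exists_Ioo_subset.mp hev
  have hb1 : (1 : ℝ) < b := hb
  refine ⟨b - 1, by linarith, ?_⟩
  obtain ⟨C, hC⟩ := arg_bdd (fun σ => -(SS K σ).im)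
    ((Complex.continuous_im.comp_continuousOn (SS_cont K)).neg) ((starRingEnd ℂ) (g 1)) (b - 1) (by linarith) (by
    intro σ hσ
    obtain ⟨⟨h1, h2⟩, h3⟩ := hb' (show σ ∈ Set.Ioo 1 b from ⟨hσ.1, by linarith [hσ.2]⟩)
    obtain ⟨p, hp, e⟩ := hpos σ hσ.1
    have hσp : 0 < (σ - 1) ^ k := pow_pos (by linarith [hσ.1]) k
    set θ : ℝ := -(SS K σ).im with hθ
    have e2 : Complex.exp (-SS K σ) = (Real.exp (-(SS K σ).re) : ℝ) * Complex.exp (θ * Complex.I) := by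
      rw [Complex.ofReal_exp, ← Complex.exp_add]
      congr 1
      apply Complex.ext <;> simp [hθ]
    have e3 : Complex.exp (θ * Complex.I) = (((σ - 1) ^ k / (p * Real.exp (-(SS K σ).re)) : ℝ) : ℂ) * g σ := by
      rw [smul_eq_mul, e, e2] at h1
      have hp' : (p : ℂ) ≠ 0 := by exact_mod_cast hp.ne'
      have he' : ((Real.exp (-(SS K σ).re) : ℝ) : ℂ) ≠ 0 := by exact_mod_cast (Real.exp_pos _).ne'
      push_cast at h1 he' ⊢
      field_simp
      linear_combination h1
    rw [e3, mul_assoc, Complex.re_ofReal_mul]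
    positivity)
  refine ⟨C, fun σ hσ => ?_⟩
  have := hC σ hσ
  rwa [abs_neg] at this

end D
end AxP

end

section
set_option linter.style.haveILetI false
set_option linter.unusedSectionVars false
open Polynomial
namespace AxP
open NumberField Filter Topology IsDedekindDomain

section D
variable (K : Type) [Field K] [NumberField K]
open scoped Classical

noncomputable def Ar (r : ℕ) (σ : ℝ) (v : HeightOneSpectrum (𝓞 K)) : ℝ :=
  if (nv v).Prime ∧ nv v % 5 = r then (nv v : ℝ) ^ (-σ) else 0

theorem Ar_nonneg (r : ℕ) (σ : ℝ) (v : HeightOneSpectrum (𝓞 K)) : 0 ≤ Ar K r σ v := by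
  unfold Ar; split_ifs <;> positivity

theorem Ar_le (r : ℕ) (σ : ℝ) (v : HeightOneSpectrum (𝓞 K)) : Ar K r σ v ≤ (nv v : ℝ) ^ (-σ) := by
  unfold Ar; split_ifs
  · exact le_rfl
  · positivity

theorem Ar_summable (r : ℕ) {σ : ℝ} (hσ : 1 < σ) : Summable (Ar K r σ) :=
  Summable.of_nonneg_of_le (Ar_nonneg K r σ) (Ar_le K r σ) (nv_summable K hσ)

theorem fv_im (v : HeightOneSpectrum (𝓞 K)) (σ : ℝ) : (fv K v σ).im =
    (if nv v % 5 = 2 then 1 else if nv v % 5 = 3 then -1 else 0) * (nv v : ℝ) ^ (-σ) := by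
  unfold fv
  have : (nv v : ℂ) ^ (-(σ : ℂ)) = (((nv v : ℝ) ^ (-σ) : ℝ) : ℂ) := by
    rw [Complex.ofReal_cpow (by positivity)]
    push_cast; rfl
  rw [this, Complex.im_mul_ofReal, chi5_im]

theorem diff_bdd : ∃ δ > 0, ∃ C, ∀ σ ∈ Set.Ioo (1 : ℝ) (1 + δ),
    |∑' v, Ar K 2 σ v - ∑' v, Ar K 3 σ v| ≤ C := by
  obtain ⟨δ, hδ, C1, h1⟩ := SS_im_bdd K
  obtain ⟨C2, h2⟩ := fch_log_bound K
  obtain ⟨C3, h3⟩ := deg2_bound K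
  refine ⟨δ, hδ, C1 + C2 + C3, fun σ hσ => ?_⟩
  have hσ1 : 1 < σ := hσ.1
  have hs' : (σ : ℂ) ≠ 0 := by exact_mod_cast (by linarith : σ ≠ 0)
  have hre : 1 < (σ : ℂ).re := by simpa using hσ1
  have k1 := h1 σ hσ
  have k2 : ‖SS K σ + ∑' v, fv K v σ‖ ≤ C2 := h2 chi5 σ hre hs'
  have k3 := h3 σ hσ1
  have hsum : Summable fun v => fv K v σ := fch_prime_summable K chi5 σ hre hs'
  have k4 : |(∑' v, fv K v σ).im| ≤ C1 + C2 := by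
    have := (Complex.abs_im_le_norm _).trans k2
    rw [Complex.add_im] at this
    rw [abs_le] at *
    constructor <;> linarith [this.1, this.2, k1.1, k1.2]
  have hD : Summable fun v : HeightOneSpectrum (𝓞 K) => if (nv v).Prime then 0 else (nv v : ℝ) ^ (-σ) := by
    refine Summable.of_nonneg_of_le (fun v => ?_) (fun v => ?_) (nv_summable K hσ1)
    · split_ifs <;> positivity
    · split_ifs
      · positivity
      · exact le_rfl
  have hdiff : Summable fun v => (fv K v σ).im - (Ar K 2 σ v - Ar K 3 σ v) :=
    (Complex.hasSum_im hsum.hasSum).summable.sub ((Ar_summable K 2 hσ1).sub (Ar_summable K 3 hσ1))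
  have hpt : ∀ v, |(fv K v σ).im - (Ar K 2 σ v - Ar K 3 σ v)| ≤
      if (nv v).Prime then 0 else (nv v : ℝ) ^ (-σ) := by
    intro v
    have hp : 0 ≤ (nv v : ℝ) ^ (-σ) := by positivity
    rw [fv_im]
    unfold Ar
    by_cases a : (nv v).Prime
    · by_cases b : nv v % 5 = 2
      · simp [a, b]
      · by_cases c : nv v % 5 = 3 <;> simp [a, b, c]
    · simp only [a, false_and, if_false, sub_zero]
      rw [abs_mul, abs_of_nonneg hp]
      refine mul_le_of_le_one_left hp ?_
      split_ifs <;> simp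
  have k5 : |∑' v, ((fv K v σ).im - (Ar K 2 σ v - Ar K 3 σ v))| ≤ C3 := by
    refine le_trans ?_ k3
    rw [← Real.norm_eq_abs]
    exact tsum_of_norm_bounded hD.hasSum hpt
  rw [Summable.tsum_sub (Complex.hasSum_im hsum.hasSum).summable
    ((Ar_summable K 2 hσ1).sub (Ar_summable K 3 hσ1)),
    (Ar_summable K 2 hσ1).tsum_sub (Ar_summable K 3 hσ1), (Complex.hasSum_im hsum.hasSum).tsum_eq] at k5
  rw [abs_le] at *
  constructor <;> linarith [k4.1, k4.2, k5.1, k5.2]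

theorem Ar_bdd (r B : ℕ) (h : ∀ v : HeightOneSpectrum (𝓞 K), (nv v).Prime → nv v % 5 = r → nv v < B) :
    ∃ C, ∀ σ : ℝ, 1 < σ → ∑' v, Ar K r σ v ≤ C := by
  have hs := (nv_summable K (σ := 2) (by norm_num)).mul_left ((B : ℝ) ^ (2 : ℝ))
  refine ⟨_, fun σ hσ => Summable.tsum_le_tsum (fun v => ?_) (Ar_summable K r hσ) hs⟩
  unfold Ar
  have h2 := two_le_nv v
  have h1 : (1 : ℝ) ≤ nv v := by exact_mod_cast (by omega : 1 ≤ nv v)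
  split_ifs with hc
  · have h3 : (nv v : ℝ) ≤ B := by exact_mod_cast (h v hc.1 hc.2).le
    have h4 : (nv v : ℝ) ^ (-σ) ≤ 1 := Real.rpow_le_one_of_one_le_of_nonpos h1 (by linarith)
    refine h4.trans ?_
    rw [Real.rpow_neg (by positivity), ← div_eq_mul_inv, one_le_div (by positivity)]
    exact Real.rpow_le_rpow (by positivity) h3 (by norm_num)
  · positivity

theorem arith_field (hK : ∀ x : K, x ^ 2 ≠ 5) (B r : ℕ) (hr : r = 2 ∨ r = 3) :
    ∃ q, B ≤ q ∧ q.Prime ∧ q % 5 = r ∧ Nonempty (𝓞 K →+* ZMod q) := by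
  by_contra hcon
  have hB : ∀ v : HeightOneSpectrum (𝓞 K), (nv v).Prime → nv v % 5 = r → nv v < B := by
    intro v hp hv
    by_contra hb
    obtain ⟨g, _⟩ := homOfV v hp rfl
    exact hcon ⟨nv v, by omega, hp, hv, ⟨g⟩⟩
  obtain ⟨C1, h1⟩ := Ar_bdd K r B hB
  obtain ⟨δ, hδ, C2, h2⟩ := diff_bdd K
  have h3 := inert_diverge hK (2 * C1 + C2 + 1)
  have h4 : ∀ᶠ σ in 𝓝[>] (1 : ℝ), σ ∈ Set.Ioo (1 : ℝ) (1 + δ) := Ioo_mem_nhdsGT (by linarith)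
  obtain ⟨σ, h5, h6⟩ := (h3.and h4).exists
  have e : ∀ v : HeightOneSpectrum (𝓞 K), (if (nv v).Prime ∧ (nv v % 5 = 2 ∨ nv v % 5 = 3) then
      (nv v : ℝ) ^ (-σ) else 0) = Ar K 2 σ v + Ar K 3 σ v := by
    intro v
    unfold Ar
    by_cases a : (nv v).Prime
    · by_cases b : nv v % 5 = 2
      · simp [a, b]
      · by_cases c : nv v % 5 = 3 <;> simp [a, b, c]
    · simp [a]
  rw [tsum_congr e, (Ar_summable K 2 h6.1).tsum_add (Ar_summable K 3 h6.1)] at h5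
  have h7 := h2 σ h6
  have h8 := h1 σ h6.1
  rw [abs_le] at h7
  rcases hr with rfl | rfl <;> linarith [h7.1, h7.2]

end D

theorem arithInput : ArithInput := fun E _ _ hE B r hr => arith_field E hE B r hr

end AxP

end

open FirstOrder

theorem stmt12 :
    (¬ ∃ ρ : Language.ring.Sentence, ∀ (F : Type) [Field F] [Fintype F],
        (letI := Ring.compatibleRingOfRing F; F ⊨ ρ) ↔ Fintype.card F % 5 = 2) ∧
    (¬ ∃ ρ : Language.ring.Sentence, ∀ p : ℕ, p.Prime →
        ((letI := Ring.compatibleRingOfRing (ZMod p); (ZMod p) ⊨ ρ) ↔ p % 5 = 2)) := by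
  have h2 := AxP.final AxP.arithInput
  refine ⟨?_, h2⟩
  rintro ⟨ρ, hρ⟩
  refine h2 ⟨ρ, fun p hp => ?_⟩
  haveI : Fact p.Prime := ⟨hp⟩
  have h := hρ (ZMod p)
  rw [ZMod.card p] at h
  exact h
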